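/- arXiv:2005.01466 — 2 statements merged into one kernel-verified Lean document; each statement's English description precedes it below -/
import Mathlib

section
/- Let G be a strongly connected digraph of order n ≥ 3 such that d(u)+d(v) ≥ 2n whenever u and v are non-adjacent. Then G is either pancyclic, or a tournament, or n is even and G is isomorphic to the complete bipartite digraph K*_{n/2,n/2}. -/
open Finset Function

variable {V : Type*}

/-- Out-degree of a vertex in a digraph given by arc relation `A`. -/
noncomputable def outDeg (A : V → V → Prop) (u : V) : ℕ := {v | A u v}.ncard

/-- In-degree of a vertex. -/
noncomputable def inDeg (A : V → V → Prop) (u : V) : ℕ := {v | A v u}.ncard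

/-- Degree `d(u) = d⁺(u) + d⁻(u)`. -/
noncomputable def deg (A : V → V → Prop) (u : V) : ℕ := outDeg A u + inDeg A u

/-- Strong connectedness: a directed path between every ordered pair of vertices. -/
def StronglyConnected (A : V → V → Prop) : Prop :=
  ∀ u v : V, Relation.ReflTransGen A u v

/-- `X, Y` form a bipartition of the digraph `A`. -/
def IsBipartition (A : V → V → Prop) (X Y : Set V) : Prop :=
  Disjoint X Y ∧ X ∪ Y = Set.univ ∧
    ∀ u v, A u v → (u ∈ X ∧ v ∈ Y) ∨ (u ∈ Y ∧ v ∈ X)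

/-- `{u,v}` is a dominating pair: a common out-neighbour exists. -/
def IsDominatingPair (A : V → V → Prop) (u v : V) : Prop :=
  u ≠ v ∧ ∃ w, A u w ∧ A v w

/-- `{u,v}` is a dominated pair: a common in-neighbour exists. -/
def IsDominatedPair (A : V → V → Prop) (u v : V) : Prop :=
  u ≠ v ∧ ∃ w, A w u ∧ A w v

/-- The digraph contains a directed cycle of length `l`. -/
def HasCycleOfLength (A : V → V → Prop) (l : ℕ) : Prop :=
  ∃ f : ZMod l → V, Function.Injective f ∧ ∀ i, A (f i) (f (i + 1))

/-- The digraph contains a Hamiltonian (directed) cycle. -/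
def IsHamiltonian [Fintype V] (A : V → V → Prop) : Prop :=
  ∃ f : ZMod (Fintype.card V) ≃ V, ∀ i, A (f i) (f (i + 1))

/-- The digraph is exactly one directed cycle through all its vertices. -/
def IsDirectedCycleDigraph [Fintype V] (A : V → V → Prop) : Prop :=
  ∃ f : ZMod (Fintype.card V) ≃ V, ∀ u v, A u v ↔ ∃ i, u = f i ∧ v = f (i + 1)

/-- A balanced bipartite digraph of order `2a` is bipancyclic: it has cycles of
all even lengths `2, 4, …, 2a`. -/
def Bipancyclic [Fintype V] (A : V → V → Prop) (a : ℕ) : Prop :=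
  ∀ l, 1 ≤ l → l ≤ a → HasCycleOfLength A (2 * l)

/-- A digraph is pancyclic: cycles of all lengths `2, …, n`. -/
def Pancyclic [Fintype V] (A : V → V → Prop) : Prop :=
  ∀ l, 2 ≤ l → l ≤ Fintype.card V → HasCycleOfLength A l

/-- A cycle factor: a spanning collection of vertex-disjoint directed cycles,
i.e. a permutation `σ` with `v → σ v` an arc for every `v` (in a loopless
digraph all orbits have length `≥ 2`). -/
def HasCycleFactor (A : V → V → Prop) : Prop :=
  ∃ σ : Equiv.Perm V, ∀ v, A v (σ v)

/-- `arcs(S,T) = |A[S,T]| + |A[T,S]|`. -/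
noncomputable def arcsCount (A : V → V → Prop) (S T : Set V) : ℕ :=
  {p : V × V | p.1 ∈ S ∧ p.2 ∈ T ∧ A p.1 p.2}.ncard +
  {p : V × V | p.1 ∈ T ∧ p.2 ∈ S ∧ A p.1 p.2}.ncard

namespace Thomassen

section

open scoped Classical

variable {V : Type*} {A : V → V → Prop}

/-- The indicator of an arc. -/
noncomputable def ar (A : V → V → Prop) (a b : V) : ℕ := if A a b then 1 else 0

/-- The number of arcs between two vertices. -/
noncomputable def arcs (A : V → V → Prop) (a b : V) : ℕ := ar A a b + ar A b a

theorem ar_le (A : V → V → Prop) (a b : V) : ar A a b ≤ 1 := by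
  unfold ar; split_ifs <;> simp

theorem ar_eq_one {a b : V} : ar A a b = 1 ↔ A a b := by
  unfold ar; split_ifs <;> simp_all

theorem ar_eq_zero {a b : V} : ar A a b = 0 ↔ ¬ A a b := by
  unfold ar; split_ifs <;> simp_all

theorem arcs_comm (A : V → V → Prop) (a b : V) : arcs A a b = arcs A b a := by
  unfold arcs; omega

theorem arcs_le (A : V → V → Prop) (a b : V) : arcs A a b ≤ 2 := by
  have := ar_le A a b; have := ar_le A b a; unfold arcs; omega

theorem arcs_eq_two {a b : V} : arcs A a b = 2 ↔ A a b ∧ A b a := by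
  rw [← ar_eq_one (A := A), ← ar_eq_one (A := A)]
  have := ar_le A a b; have := ar_le A b a; unfold arcs; omega

theorem arcs_eq_zero {a b : V} : arcs A a b = 0 ↔ ¬ A a b ∧ ¬ A b a := by
  rw [← ar_eq_zero (A := A), ← ar_eq_zero (A := A)]
  unfold arcs; omega

theorem arcs_flip (a b : V) : arcs (flip A) a b = arcs A a b := by
  unfold arcs ar flip; omega

theorem arcs_add_arcs_le {y z w : V} (h1 : ¬ (A z y ∧ A y w)) (h2 : ¬ (A w y ∧ A y z)) :
    arcs A y z + arcs A y w ≤ 2 := by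
  unfold arcs ar; split_ifs <;> simp_all

theorem deg_eq_sum [Fintype V] (A : V → V → Prop) (a : V) : deg A a = ∑ b, arcs A a b := by
  unfold deg outDeg inDeg arcs ar
  rw [sum_add_distrib, Set.ncard_eq_toFinset_card', Set.ncard_eq_toFinset_card']
  simp

theorem deg_flip (a : V) : deg (flip A) a = deg A a := by
  unfold deg outDeg inDeg flip; omega

/-- `l` is a walk from `a` to `b`, given by its list of vertices. -/
def Wk (A : V → V → Prop) (a : V) (l : List V) (b : V) : Prop :=
  l.IsChain A ∧ l.head? = some a ∧ l.getLast? = some b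

/-- `l` lists the vertices of a directed cycle. -/
def Cyc (A : V → V → Prop) (l : List V) : Prop :=
  l.Nodup ∧ ∃ a b, Wk A a l b ∧ A b a

theorem Wk.single (a : V) : Wk A a [a] a := by simp [Wk]

theorem Wk.append {a b c d : V} {l l' : List V} (h : Wk A a l b) (hbc : A b c)
    (h' : Wk A c l' d) : Wk A a (l ++ l') d := by
  obtain ⟨h1, h2, h3⟩ := h
  obtain ⟨h1', h2', h3'⟩ := h'
  refine ⟨?_, ?_, ?_⟩
  · rw [List.isChain_append]; grind
  · simp [h2]
  · simp [h3']

theorem Wk.cons {a b c : V} {l : List V} (h : A a b) (h' : Wk A b l c) : Wk A a (a :: l) c :=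
  (Wk.single a).append h h'

theorem Wk.concat {a b c : V} {l : List V} (h : Wk A a l b) (h' : A b c) : Wk A a (l ++ [c]) c :=
  h.append h' (Wk.single c)

theorem Wk.ne_nil {a b : V} {l : List V} (h : Wk A a l b) : l ≠ [] := by
  rintro rfl; simp [Wk] at h

theorem Wk.head_mem {a b : V} {l : List V} (h : Wk A a l b) : a ∈ l :=
  List.mem_of_mem_head? h.2.1

theorem Wk.last_mem {a b : V} {l : List V} (h : Wk A a l b) : b ∈ l :=
  List.mem_of_mem_getLast? h.2.2

/-- Cutting a walk between two nonempty pieces. -/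
theorem Wk.split {a b c : V} {l l' : List V} (h : Wk A a (l ++ c :: l') b) (hl : l ≠ []) :
    ∃ d, Wk A a l d ∧ A d c ∧ Wk A c (c :: l') b := by
  obtain ⟨h1, h2, h3⟩ := h
  rw [List.isChain_append] at h1
  obtain ⟨x, hx⟩ : ∃ x, l.getLast? = some x := ⟨_, List.getLast?_eq_some_getLast hl⟩
  refine ⟨x, ⟨h1.1, ?_, hx⟩, h1.2.2 x hx c (by simp), h1.2.1, by simp, ?_⟩
  · cases l <;> simp_all
  · simpa using h3

theorem Wk.initial {a b c : V} {l l' : List V} (h : Wk A a (l ++ c :: l') b) :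
    Wk A a (l ++ [c]) c := by
  rcases eq_or_ne l [] with rfl | hl
  · obtain ⟨-, h2, -⟩ := h
    obtain rfl : c = a := by simpa using h2
    exact Wk.single _
  · obtain ⟨d, hd, hdc, -⟩ := h.split hl
    exact hd.concat hdc

theorem Wk.suffix {a b c : V} {l l' : List V} (h : Wk A a (l ++ c :: l') b) :
    Wk A c (c :: l') b := by
  rcases eq_or_ne l [] with rfl | hl
  · obtain ⟨h1, h2, h3⟩ := h
    obtain rfl : c = a := by simpa using h2
    exact ⟨h1, h2, h3⟩
  · exact (h.split hl).choose_spec.2.2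

/-- Cutting a walk after a given vertex. -/
theorem Wk.tail {a b c : V} {l l' : List V} (h : Wk A a (l ++ c :: l') b) (hl : l' ≠ []) :
    ∃ d, A c d ∧ Wk A d l' b := by
  obtain ⟨d, l'', rfl⟩ := List.exists_cons_of_ne_nil hl
  obtain ⟨e, he, hed, hd⟩ := (h.suffix).split (l := [c]) (by simp)
  obtain rfl : c = e := by simpa [Wk] using he
  exact ⟨d, hed, hd⟩

theorem Wk.flip {a b : V} {l : List V} (h : Wk A a l b) : Wk (flip A) b l.reverse a := by
  obtain ⟨h1, h2, h3⟩ := h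
  refine ⟨?_, by simpa using h3, by simpa using h2⟩
  rw [List.isChain_reverse]; exact h1

theorem Cyc.mk {a b : V} {l : List V} (h : Wk A a l b) (hba : A b a) (hl : l.Nodup) : Cyc A l :=
  ⟨hl, a, b, h, hba⟩

theorem Cyc.flip {l : List V} (h : Cyc A l) : Cyc (flip A) l.reverse := by
  obtain ⟨h, a, b, hw, hba⟩ := h
  exact ⟨by simpa using h, b, a, hw.flip, hba⟩

theorem Cyc.rotate {l l' : List V} (h : Cyc A (l ++ l')) : Cyc A (l' ++ l) := by
  obtain ⟨hn, a, b, hw, hba⟩ := h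
  rcases eq_or_ne l [] with rfl | hl
  · exact ⟨by simpa using hn, a, b, by simpa using hw, hba⟩
  rcases eq_or_ne l' [] with rfl | hl'
  · exact ⟨by simpa using hn, a, b, by simpa using hw, hba⟩
  obtain ⟨c, t, rfl⟩ := List.exists_cons_of_ne_nil hl'
  obtain ⟨d, h1, h2, h3⟩ := hw.split hl
  exact ⟨(List.nodup_append_comm.1 hn), c, d, h3.append hba h1, h2⟩

theorem Cyc.length_pos {c : List V} (h : Cyc A c) : 0 < c.length := by
  obtain ⟨-, a, b, hw, -⟩ := h
  exact List.length_pos_iff.2 hw.ne_nil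

theorem Cyc.exists_fun {l : List V} (h : Cyc A l) : ∃ f : ZMod l.length → V, Injective f ∧
    (∀ i, A (f i) (f (i + 1))) ∧ ∀ v, v ∈ l ↔ ∃ i, f i = v := by
  have hpos := h.length_pos
  have : NeZero l.length := ⟨hpos.ne'⟩
  obtain ⟨hn, a, b, ⟨h1, h2, h3⟩, hba⟩ := h
  refine ⟨fun i => l.get ⟨i.val, ZMod.val_lt i⟩, ?_, ?_, ?_⟩
  · intro i j hij
    simp only [List.get_eq_getElem] at hij
    exact ZMod.val_injective _ ((List.Nodup.getElem_inj_iff hn).1 hij)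
  · intro i
    have hi := ZMod.val_lt i
    have hv : (i + 1).val = if i.val + 1 < l.length then i.val + 1 else 0 := by
      rw [ZMod.val_add, ZMod.val_one_eq_one_mod, Nat.add_mod_mod]
      split_ifs with hlt
      · exact Nat.mod_eq_of_lt hlt
      · rw [show i.val + 1 = l.length by omega, Nat.mod_self]
    simp only [List.get_eq_getElem, hv]
    split_ifs with hlt
    · exact List.isChain_iff_getElem.1 h1 _ hlt
    · have hb : l[i.val] = b := by
        rw [List.getLast?_eq_getElem?] at h3
        have : i.val = l.length - 1 := by omega
        simp only [this]
        grind
      have ha : l[0] = a := by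
        rw [List.head?_eq_getElem?] at h2
        grind
      simp only [ha, hb]
      exact hba
  · intro v
    rw [List.mem_iff_get]
    constructor
    · rintro ⟨i, rfl⟩
      refine ⟨((i : ℕ) : ZMod l.length), ?_⟩
      have hi : (⟨_, ZMod.val_lt ((i : ℕ) : ZMod l.length)⟩ : Fin l.length) = i :=
        Fin.ext (ZMod.val_natCast_of_lt i.2)
      exact congrArg l.get hi
    · rintro ⟨i, rfl⟩
      exact ⟨_, rfl⟩

theorem Cyc.hasCycle {l : List V} (h : Cyc A l) : HasCycleOfLength A l.length := by
  obtain ⟨f, h1, h2, -⟩ := h.exists_fun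
  exact ⟨f, h1, h2⟩

/-- The segment of `k` consecutive vertices of a closed walk starting at index `s`. -/
def seg {m : ℕ} (f : ZMod m → V) (s : ZMod m) (k : ℕ) : List V :=
  (List.range k).map fun i : ℕ => f (s + (i : ZMod m))

@[simp] theorem length_seg {m : ℕ} (f : ZMod m → V) (s : ZMod m) (k : ℕ) :
    (seg f s k).length = k := by simp [seg]

theorem mem_seg {m : ℕ} {f : ZMod m → V} {s : ZMod m} {k : ℕ} {x : V} :
    x ∈ seg f s k ↔ ∃ i < k, f (s + (i : ZMod m)) = x := by simp [seg]

theorem seg_succ {m : ℕ} (f : ZMod m → V) (s : ZMod m) (k : ℕ) :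
    seg f s (k + 1) = seg f s k ++ [f (s + (k : ZMod m))] := by
  simp [seg, List.range_succ]

theorem wk_seg {m : ℕ} {f : ZMod m → V} (hf : ∀ i, A (f i) (f (i + 1))) (s : ZMod m) (k : ℕ) :
    Wk A (f s) (seg f s (k + 1)) (f (s + (k : ZMod m))) := by
  induction k with
  | zero => simpa [seg] using Wk.single (A := A) (f s)
  | succ k ih =>
    rw [seg_succ]
    refine ih.concat ?_
    have := hf (s + (k : ZMod m))
    rwa [add_assoc, ← Nat.cast_succ] at this

theorem nodup_seg {m : ℕ} {f : ZMod m → V} (hf : Injective f) (s : ZMod m) {k : ℕ}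
    (hk : k ≤ m) : (seg f s k).Nodup := by
  refine List.Nodup.map_on ?_ List.nodup_range
  intro i hi j hj hij
  have h := add_left_cancel (hf hij)
  rw [ZMod.natCast_eq_natCast_iff'] at h
  simp only [List.mem_range] at hi hj
  rwa [Nat.mod_eq_of_lt (by omega), Nat.mod_eq_of_lt (by omega)] at h

/-- Cycles through a vertex `x` outside of a given cycle, using a segment of that cycle. -/
theorem hasCycle_through {m : ℕ} {f : ZMod m → V} (hi : Injective f)
    (hf : ∀ i, A (f i) (f (i + 1))) {x : V} (hx : ∀ i, f i ≠ x) {j : ZMod m} {k : ℕ} (hk : k < m)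
    (h1 : A x (f j)) (h2 : A (f (j + (k : ZMod m))) x) : HasCycleOfLength A (k + 2) := by
  have hc : Cyc A (x :: seg f j (k + 1)) := by
    refine ⟨?_, _, _, (wk_seg hf j k).cons h1, h2⟩
    rw [List.nodup_cons]
    refine ⟨?_, nodup_seg hi _ hk⟩
    rw [mem_seg]
    rintro ⟨i, -, h⟩
    exact hx _ h
  simpa using hc.hasCycle

/-- A vertex joined by many arcs to a cycle of length `m` yields cycles of all lengths up to
`m + 1`. -/
theorem hasCycle_of_many_arcs {m : ℕ} [NeZero m] {f : ZMod m → V} (hi : Injective f)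
    (hf : ∀ i, A (f i) (f (i + 1))) {x : V} (hx : ∀ i, f i ≠ x)
    (h : m + 1 ≤ ∑ i, arcs A x (f i)) {l : ℕ} (h2 : 2 ≤ l) (hl : l ≤ m + 1) :
    HasCycleOfLength A l := by
  by_contra hcon
  obtain ⟨k, rfl⟩ : ∃ k, l = k + 2 := ⟨l - 2, by omega⟩
  have key : ∀ j, ar A x (f j) + ar A (f (j + (k : ZMod m))) x ≤ 1 := by
    intro j
    by_contra! hj
    have h1 := ar_le A x (f j)
    have h2 := ar_le A (f (j + (k : ZMod m))) x
    have h3 : ar A x (f j) = 1 := by omega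
    have h4 : ar A (f (j + (k : ZMod m))) x = 1 := by omega
    exact hcon (hasCycle_through hi hf hx (by omega) (ar_eq_one.1 h3) (ar_eq_one.1 h4))
  have hs : ∑ i, arcs A x (f i) = ∑ j, (ar A x (f j) + ar A (f (j + (k : ZMod m))) x) := by
    unfold arcs
    rw [sum_add_distrib, sum_add_distrib]
    congr 1
    exact (Equiv.sum_comp (Equiv.addRight (k : ZMod m)) fun j => ar A (f j) x).symm
  have := sum_le_card_nsmul univ _ 1 fun j _ => key j
  rw [← hs] at this
  simp [ZMod.card] at this
  omega

/-- `v` can be inserted between two consecutive vertices of `l`. -/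
def Insertable (A : V → V → Prop) (v : V) (l : List V) : Prop :=
  ∃ l₁ a b l₂, l = l₁ ++ a :: b :: l₂ ∧ A a v ∧ A v b

theorem Wk.insert {a b c d v : V} {l₁ l₂ : List V} (h : Wk A a (l₁ ++ c :: d :: l₂) b)
    (h1 : A c v) (h2 : A v d) : Wk A a (l₁ ++ c :: v :: d :: l₂) b := by
  have h3 : Wk A a ((l₁ ++ [c]) ++ d :: l₂) b := by simpa using h
  have h4 : Wk A a (l₁ ++ [c]) c := h.initial
  have := h4.append h1 (h3.suffix.cons h2)
  simpa using this

theorem sum_arcs_le_of_not_insertable {v b : V} {l : List V} :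
    ∀ {a : V}, Wk A a l b → ¬ Insertable A v l →
      (l.map (arcs A v)).sum + 1 ≤ l.length + ar A b v + ar A v a := by
  induction l with
  | nil => intro a h; exact absurd rfl h.ne_nil
  | cons c t ih =>
    intro a h hins
    obtain rfl : c = a := by simpa using h.2.1
    cases t with
    | nil =>
      obtain rfl : c = b := by simpa using h.2.2
      simp [arcs]; omega
    | cons d t =>
      have ht : Wk A d (d :: t) b := Wk.suffix (l := [c]) h
      have hi : ¬ Insertable A v (d :: t) := by
        rintro ⟨l₁, x, y, l₂, h1, h2⟩
        exact hins ⟨c :: l₁, x, y, l₂, by simp [h1], h2⟩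
      have h1 := ih ht hi
      have h2 : ar A c v + ar A v d ≤ 1 := by
        by_contra! hc
        have h3 := ar_le A c v
        have h4 := ar_le A v d
        have h5 : ar A c v = 1 := by omega
        have h6 : ar A v d = 1 := by omega
        exact hins ⟨[], c, d, t, rfl, ar_eq_one.1 h5, ar_eq_one.1 h6⟩
      simp only [List.map_cons, List.sum_cons, List.length_cons] at h1 ⊢
      have : arcs A v c = ar A v c + ar A c v := rfl
      omega

/-- Inserting as many vertices of `W` into the walk `Q` as possible. -/
theorem exists_insertion {a b : V} (W : List V) : ∀ (k : ℕ) (Q : List V),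
    (W.toFinset \ Q.toFinset).card = k → Wk A a Q b → Q.Nodup →
    ∃ Q', Wk A a Q' b ∧ Q'.Nodup ∧ Q.Sublist Q' ∧ (∀ y ∈ Q', y ∈ Q ∨ y ∈ W) ∧
      ∀ v ∈ W, v ∉ Q' → ¬ Insertable A v Q' := by
  intro k
  induction k with
  | zero =>
    intro Q hk hQ hn
    refine ⟨Q, hQ, hn, List.Sublist.refl _, fun y hy => Or.inl hy, fun v hv hvQ => ?_⟩
    have : v ∈ W.toFinset \ Q.toFinset := by simp [hv, hvQ]
    rw [card_eq_zero] at hk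
    simp [hk] at this
  | succ k ih =>
    intro Q hk hQ hn
    by_cases hex : ∃ v ∈ W, v ∉ Q ∧ Insertable A v Q
    · obtain ⟨v, hv, hvQ, l₁, c, d, l₂, rfl, h1, h2⟩ := hex
      have hp : (l₁ ++ c :: v :: d :: l₂).Perm (v :: (l₁ ++ c :: d :: l₂)) := by
        have : l₁ ++ c :: v :: d :: l₂ = (l₁ ++ [c]) ++ v :: d :: l₂ := by simp
        rw [this]
        refine List.perm_middle.trans ?_
        simp
      obtain ⟨Q', g1, g2, g3, g4, g5⟩ := ih (l₁ ++ c :: v :: d :: l₂) (by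
        have : (l₁ ++ c :: v :: d :: l₂).toFinset = insert v (l₁ ++ c :: d :: l₂).toFinset := by
          rw [List.toFinset_eq_of_perm _ _ hp]; simp
        rw [this, sdiff_insert, card_erase_of_mem, hk]
        · simp
        · simp only [mem_sdiff, List.mem_toFinset]; exact ⟨hv, hvQ⟩) (hQ.insert h1 h2)
        (hp.nodup_iff.2 (List.nodup_cons.2 ⟨hvQ, hn⟩))
      refine ⟨Q', g1, g2, List.Sublist.trans ?_ g3, fun y hy => ?_, g5⟩
      · simp
      · rcases g4 y hy with h | h
        · rw [hp.mem_iff, List.mem_cons] at h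
          rcases h with rfl | h
          · exact Or.inr hv
          · exact Or.inl h
        · exact Or.inr h
    · push Not at hex
      exact ⟨Q, hQ, hn, List.Sublist.refl _, fun y hy => Or.inl hy, hex⟩

theorem sum_toFinset_eq {l : List V} (hl : l.Nodup) (g : V → ℕ) :
    ∑ y ∈ l.toFinset, g y = (l.map g).sum :=
  List.sum_toFinset g hl

/-- Degree sum of two vertices, bounded by counting arcs vertex by vertex outside a set `S`. -/
theorem deg_add_deg_le [Fintype V] {S F : Finset V} {z w : V} (hzw : z ≠ w) (hzS : z ∉ S)
    (hwS : w ∉ S) (hzF : z ∉ F) (hwF : w ∉ F) (hSF : Disjoint S F)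
    (hz : arcs A z z + arcs A z w = 0) (hw : arcs A w z + arcs A w w = 0)
    (hy : ∀ y, y ∉ S → y ∉ F → y ≠ z → y ≠ w → arcs A y z + arcs A y w ≤ 2) :
    deg A z + deg A w + 2 * S.card + 4 ≤
      ∑ y ∈ S, (arcs A z y + arcs A w y) + 2 * F.card + 2 * Fintype.card V ∧
    (deg A z + deg A w + 2 * S.card + 4 =
      ∑ y ∈ S, (arcs A z y + arcs A w y) + 2 * F.card + 2 * Fintype.card V →
      (∀ y ∈ F, arcs A y z + arcs A y w = 4) ∧
      ∀ y, y ∉ S → y ∉ F → y ≠ z → y ≠ w → arcs A y z + arcs A y w = 2) := by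
  set cap : V → ℕ := fun y => if y ∈ F then 4 else if y = z ∨ y = w then 0 else 2 with hcap
  have hle : ∀ y ∈ Sᶜ, arcs A y z + arcs A y w ≤ cap y := by
    intro y hyS
    rw [mem_compl] at hyS
    have h1 := arcs_le A y z
    have h2 := arcs_le A y w
    simp only [hcap]
    split_ifs with h3 h4
    · omega
    · rcases h4 with rfl | rfl <;> omega
    · push Not at h4
      exact hy y hyS h3 h4.1 h4.2
  have hdeg : deg A z + deg A w = ∑ y ∈ S, (arcs A z y + arcs A w y) +
      ∑ y ∈ Sᶜ, (arcs A y z + arcs A y w) := by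
    rw [deg_eq_sum, deg_eq_sum, ← sum_add_distrib, ← sum_add_sum_compl S]
    simp only [arcs_comm A z, arcs_comm A w]
  have hsum : ∑ y ∈ Sᶜ, cap y + 2 * S.card + 4 = 2 * F.card + 2 * Fintype.card V := by
    have hd1 : Disjoint (insert z (insert w F)) S := by
      rw [disjoint_left]
      intro y hy hyS
      simp only [mem_insert] at hy
      rcases hy with rfl | rfl | hy
      · exact hzS hyS
      · exact hwS hyS
      · exact (disjoint_left.1 hSF) hyS hy
    have hsub : insert z (insert w F) ⊆ Sᶜ := by
      intro y hy; rw [mem_compl]; exact fun h => (disjoint_left.1 hd1) hy h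
    rw [← sum_sdiff hsub]
    have e1 : ∑ y ∈ insert z (insert w F), cap y = 4 * F.card := by
      rw [sum_insert (by simp [hzw, hzF]), sum_insert hwF]
      have : ∑ y ∈ F, cap y = ∑ y ∈ F, 4 := sum_congr rfl fun y hy => by simp [hcap, hy]
      rw [this]
      simp [hcap, hzF, hwF]; omega
    have e2 : ∑ y ∈ Sᶜ \ insert z (insert w F), cap y =
        2 * (Sᶜ \ insert z (insert w F)).card := by
      have : ∑ y ∈ Sᶜ \ insert z (insert w F), cap y =
          ∑ y ∈ Sᶜ \ insert z (insert w F), 2 := by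
        refine sum_congr rfl fun y hy => ?_
        simp only [mem_sdiff, mem_insert, not_or] at hy
        simp [hcap, hy.2.1, hy.2.2.1, hy.2.2.2]
      rw [this]; simp; omega
    rw [e1, e2, card_sdiff_of_subset hsub, card_compl]
    have h3 : (insert z (insert w F)).card = F.card + 2 := by
      rw [card_insert_of_notMem (by simp [hzw, hzF]), card_insert_of_notMem hwF]
    have h4 := card_le_card hsub
    rw [card_compl] at h4
    have h5 := card_le_univ S
    omega
  have hle' := sum_le_sum hle
  refine ⟨by omega, fun heq => ?_⟩
  have heq' : ∑ y ∈ Sᶜ, (arcs A y z + arcs A y w) = ∑ y ∈ Sᶜ, cap y := by omega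
  have hall := (sum_eq_sum_iff_of_le hle).1 heq'
  constructor
  · intro y hyF
    rw [hall y (by rw [mem_compl]; exact fun h => (disjoint_left.1 hSF) h hyF)]
    simp [hcap, hyF]
  · intro y hyS hyF hyz hyw
    rw [hall y (by rwa [mem_compl])]
    simp [hcap, hyF, hyz, hyw]

section

/-- A cycle avoiding `F`, cut into a walk `Q` from `q` to `q'` and a walk `W` from `w` to `w'`. -/
structure Gap (A : V → V → Prop) (F : Finset V) (Q W : List V) (q q' w w' : V) : Prop where
  wkQ : Wk A q Q q'
  wkW : Wk A w W w'
  arcQW : A q' w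
  arcWQ : A w' q
  nodup : (Q ++ W).Nodup
  avoid : ∀ y ∈ Q ++ W, y ∉ F

/-- A path `P` outside of `F` and the cycle `Q ++ W` which closes `Q` into a cycle. -/
structure Bypass (A : V → V → Prop) (F : Finset V) (Q W P : List V) (q q' p p' : V) : Prop where
  wkP : Wk A p P p'
  arcQP : A q' p
  arcPQ : A p' q
  nodup : P.Nodup
  avoid : ∀ y ∈ P, y ∉ Q ∧ y ∉ W ∧ y ∉ F

/-- All cycles avoiding `F` have length at most `m`. -/
def MaxLen (A : V → V → Prop) (F : Finset V) (m : ℕ) : Prop :=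
  ∀ c, Cyc A c → (∀ y ∈ c, y ∉ F) → c.length ≤ m

variable {F : Finset V} {Q W P : List V} {q q' w w' p p' : V} {m : ℕ}

theorem Gap.not_insertable (h : Gap A F Q W q q' w w') (hm : MaxLen A F m)
    (hlen : Q.length + W.length = m) {z : V} (hzQ : z ∉ Q) (hzW : z ∉ W) (hzF : z ∉ F) :
    ¬ Insertable A z Q := by
  rintro ⟨l₁, c, d, l₂, rfl, h1, h2⟩
  have hp : (l₁ ++ c :: z :: d :: l₂ ++ W).Perm (z :: (l₁ ++ c :: d :: l₂ ++ W)) := by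
    have : l₁ ++ c :: z :: d :: l₂ ++ W = (l₁ ++ [c]) ++ z :: (d :: l₂ ++ W) := by simp
    rw [this]
    refine List.perm_middle.trans ?_
    simp
  have hc : Cyc A (l₁ ++ c :: z :: d :: l₂ ++ W) :=
    Cyc.mk ((h.wkQ.insert h1 h2).append h.arcQW h.wkW) h.arcWQ
      (hp.nodup_iff.2 (List.nodup_cons.2 ⟨by simp at hzQ; simp [hzQ, hzW], h.nodup⟩))
  have := hm _ hc (fun y hy => by
    rw [hp.mem_iff, List.mem_cons] at hy
    rcases hy with rfl | hy
    · exact hzF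
    · exact h.avoid y hy)
  rw [hp.length_eq] at this
  simp at this hlen
  omega

theorem Gap.exists_deg_add_le [Fintype V] (hirr : ∀ v, ¬ A v v) (h : Gap A F Q W q q' w w')
    (hb : Bypass A F Q W P q q' p p') (hm : MaxLen A F m) (hlen : Q.length + W.length = m)
    {z : V} (hz : z ∈ P) (hzW : ∀ y ∈ W, arcs A z y = 0)
    (ho : ∀ v ∈ W, ∀ y, y ∉ Q → y ∉ W → y ∉ F → y ≠ z → arcs A y z + arcs A y v ≤ 2) :
    ∃ v ∈ W, ∃ Q', Wk A q Q' q' ∧ Q'.Nodup ∧ Q.Sublist Q' ∧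
      (∀ y ∈ W, y ∉ Q' → ¬ Insertable A y Q') ∧
      (∀ y ∈ Q', y ∈ Q ∨ y ∈ W) ∧
      deg A z + deg A v + Q'.length + 2 ≤ Q.length + 2 * F.card + 2 * Fintype.card V := by
  obtain ⟨hzQ, hzW', hzF⟩ := hb.avoid z hz
  have hQn : Q.Nodup := (List.nodup_append.1 h.nodup).1
  have hWn : W.Nodup := (List.nodup_append.1 h.nodup).2.1
  obtain ⟨Q', g1, g2, g3, g4, g5⟩ := exists_insertion W _ Q rfl h.wkQ hQn
  have hQ'F : ∀ y ∈ Q', y ∉ F := fun y hy => by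
    rcases g4 y hy with h' | h' <;> exact h.avoid y (by simp [h'])
  have hex : ∃ v ∈ W, v ∉ Q' := by
    by_contra! hcon
    have hsub : (Q ++ W) ⊆ Q' := by
      intro y hy
      rcases List.mem_append.1 hy with h' | h'
      · exact g3.subset h'
      · exact hcon y h'
    have hle := (List.subperm_of_subset h.nodup hsub).length_le
    have hc : Cyc A (Q' ++ P) := Cyc.mk (g1.append hb.arcQP hb.wkP) hb.arcPQ (by
      rw [List.nodup_append]
      refine ⟨g2, hb.nodup, ?_⟩
      rintro a ha b hb' rfl
      have := hb.avoid a hb'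
      rcases g4 a ha with h' | h'
      · exact this.1 h'
      · exact this.2.1 h')
    have := hm _ hc (fun y hy => by
      rcases List.mem_append.1 hy with h' | h'
      · exact hQ'F y h'
      · exact (hb.avoid y h').2.2)
    have hpos := List.length_pos_iff.2 hb.wkP.ne_nil
    simp at this hle
    omega
  obtain ⟨v, hv, hvQ'⟩ := hex
  refine ⟨v, hv, Q', g1, g2, g3, g5, g4, ?_⟩
  have hzQ' : z ∉ Q' := fun hz' => by
    rcases g4 z hz' with h' | h'
    · exact hzQ h'
    · exact hzW' h'
  have harc0 : ∀ a, arcs A a a = 0 := fun a => arcs_eq_zero.2 ⟨hirr a, hirr a⟩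
  have hcount := (deg_add_deg_le (A := A) (S := Q'.toFinset) (F := F) (z := z) (w := v)
    (by rintro rfl; exact hzW' hv) (by simpa using hzQ') (by simpa using hvQ') hzF
    (h.avoid v (by simp [hv])) (by
      rw [disjoint_left]; intro y hy; exact hQ'F y (by simpa using hy))
    (by rw [harc0, hzW v hv]) (by rw [harc0, arcs_comm, hzW v hv]) (by
      intro y hy1 hy2 hy3 hy4
      rw [List.mem_toFinset] at hy1
      by_cases hyW : y ∈ W
      · rw [arcs_comm A y z, hzW y hyW]
        have := arcs_le A y v
        omega
      · exact ho v hv y (fun hq => hy1 (g3.subset hq)) hyW hy2 hy3)).1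
  have hsw : ∑ y ∈ Q'.toFinset, arcs A v y ≤ Q'.length + 1 := by
    rw [sum_toFinset_eq g2]
    have := sum_arcs_le_of_not_insertable g1 (g5 v hv hvQ')
    have h1 := ar_le A q' v
    have h2 := ar_le A v q
    omega
  have hsz : ∑ y ∈ Q'.toFinset, arcs A z y ≤ Q.length + 1 := by
    have hsub : Q.toFinset ⊆ Q'.toFinset := fun y hy => by
      rw [List.mem_toFinset] at hy ⊢; exact g3.subset hy
    rw [← sum_subset hsub (fun y hy hyQ => by
      rw [List.mem_toFinset] at hy hyQ
      exact hzW y ((g4 y hy).resolve_left hyQ)), sum_toFinset_eq hQn]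
    have := sum_arcs_le_of_not_insertable h.wkQ (h.not_insertable hm hlen hzQ hzW' hzF)
    have h1 := ar_le A q' z
    have h2 := ar_le A z q
    omega
  rw [sum_add_distrib, List.toFinset_card_of_nodup g2] at hcount
  omega

/-- The degree condition forces equality everywhere in the counting argument. -/
theorem Gap.tight [Fintype V] (hirr : ∀ v, ¬ A v v) {x : V} (h : Gap A {x} Q W q q' w w')
    (hb : Bypass A {x} Q W P q q' p p') (hm : MaxLen A {x} m) (hlen : Q.length + W.length = m)
    (hore : ∀ u v : V, u ≠ v → ¬ A u v → ¬ A v u → 2 * Fintype.card V ≤ deg A u + deg A v)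
    {z : V} (hz : z ∈ P) (hzW : ∀ y ∈ W, arcs A z y = 0)
    (ho : ∀ v ∈ W, ∀ y, y ∉ Q → y ∉ W → y ≠ x → y ≠ z → arcs A y z + arcs A y v ≤ 2)
    {v : V} (hv : v ∈ W) :
    deg A z + deg A v = 2 * Fintype.card V ∧ (A z x ∧ A x z) ∧ (A v x ∧ A x v) ∧
      (A q' z ∧ A z q) ∧ (A q' v ∧ A v q) ∧ (∀ y ∈ W, y ≠ v → A y v) ∧
      (∀ y, y ∉ Q → y ∉ W → y ≠ x → y ≠ z → arcs A y z + arcs A y v = 2) ∧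
      ∑ y ∈ Q.toFinset, arcs A z y = Q.length + 1 ∧
      ∑ y ∈ Q.toFinset, arcs A v y = Q.length + 1 := by
  have ho' : ∀ v ∈ W, ∀ y, y ∉ Q → y ∉ W → y ∉ ({x} : Finset V) → y ≠ z →
      arcs A y z + arcs A y v ≤ 2 := fun v hv y h1 h2 h3 => ho v hv y h1 h2 (by simpa using h3)
  obtain ⟨hzQ, hzW', hzF⟩ := hb.avoid z hz
  have hQn : Q.Nodup := (List.nodup_append.1 h.nodup).1
  have hdisj : ∀ y ∈ W, y ∉ Q := fun y hy hyQ => (List.nodup_append.1 h.nodup).2.2 y hyQ y hy rfl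
  have hge : ∀ v ∈ W, 2 * Fintype.card V ≤ deg A z + deg A v := fun v hv => by
    have := arcs_eq_zero.1 (hzW v hv)
    exact hore z v (by rintro rfl; exact hzW' hv) this.1 this.2
  have hni : ∀ v ∈ W, ¬ Insertable A v Q := by
    obtain ⟨u, hu, Q', g1, g2, g3, g4, g5, g6⟩ := h.exists_deg_add_le hirr hb hm hlen hz hzW ho'
    have := hge u hu
    rw [card_singleton] at g6
    have hQ' : Q = Q' := g3.eq_of_length_le (by omega)
    subst hQ'
    exact fun v hv => g4 v hv (hdisj v hv)
  have harc0 : ∀ a, arcs A a a = 0 := fun a => arcs_eq_zero.2 ⟨hirr a, hirr a⟩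
  obtain ⟨hc1, hc2⟩ := deg_add_deg_le (A := A) (S := Q.toFinset) (F := {x}) (z := z) (w := v)
    (by rintro rfl; exact hzW' hv) (by simpa using hzQ) (by simpa using hdisj v hv) hzF
    (h.avoid v (by simp [hv])) (by
      rw [disjoint_left]; intro y hy
      exact h.avoid y (List.mem_append_left _ (by simpa using hy)))
    (by rw [harc0, hzW v hv]) (by rw [harc0, arcs_comm, hzW v hv]) (by
      intro y hy1 hy2 hy3 hy4
      rw [List.mem_toFinset] at hy1
      by_cases hyW : y ∈ W
      · rw [arcs_comm A y z, hzW y hyW]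
        have := arcs_le A y v
        omega
      · exact ho' v hv y hy1 hyW hy2 hy3)
  have e1 := sum_arcs_le_of_not_insertable h.wkQ (hni v hv)
  have e2 := sum_arcs_le_of_not_insertable h.wkQ (h.not_insertable hm hlen hzQ hzW' hzF)
  have a1 := ar_le A q' v
  have a2 := ar_le A v q
  have a3 := ar_le A q' z
  have a4 := ar_le A z q
  have hgev := hge v hv
  rw [sum_add_distrib, List.toFinset_card_of_nodup hQn, sum_toFinset_eq hQn, sum_toFinset_eq hQn,
    card_singleton] at hc1 hc2
  obtain ⟨hF, hR⟩ := hc2 (by omega)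
  have hx := hF x (by simp)
  have b1 := arcs_le A x z
  have b2 := arcs_le A x v
  have b3 : arcs A x z = 2 := by omega
  have b4 : arcs A x v = 2 := by omega
  have b5 := arcs_eq_two.1 b3
  have b6 := arcs_eq_two.1 b4
  have c1 : ar A q' v = 1 := by omega
  have c2 : ar A v q = 1 := by omega
  have c3 : ar A q' z = 1 := by omega
  have c4 : ar A z q = 1 := by omega
  rw [ar_eq_one] at c1 c2 c3 c4
  refine ⟨by omega, b5.symm, b6.symm, ⟨c3, c4⟩, ⟨c1, c2⟩, fun y hy hyv => ?_,
    fun y h1 h2 h3 h4 => ?_, ?_, ?_⟩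
  · have := hR y (by simpa using hdisj y hy) (h.avoid y (by simp [hy]))
      (by rintro rfl; exact hzW' hy) hyv
    rw [arcs_comm A y z, hzW y hy, zero_add, arcs_eq_two] at this
    exact this.1
  · exact hR y (by simpa using h1) (by simpa using h3) h4 (by rintro rfl; exact h2 hv)
  · rw [sum_toFinset_eq hQn]; omega
  · rw [sum_toFinset_eq hQn]; omega

/-- A path leading into a set `S`, cut at the first visit to `S`. -/
theorem exists_path_to {B : V → V → Prop} {S : Set V} {y c : V}
    (h : Relation.ReflTransGen B y c) (hc : c ∈ S) (hy : y ∉ S) :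
    ∃ P p' s, Wk B y P p' ∧ P.Nodup ∧ (∀ v ∈ P, v ∉ S) ∧ B p' s ∧ s ∈ S := by
  induction h using Relation.ReflTransGen.head_induction_on with
  | refl => exact absurd hc hy
  | @head y y' h1 h2 ih =>
    by_cases hy' : y' ∈ S
    · exact ⟨[y], y, y', Wk.single _, by simp, by simpa using hy, h1, hy'⟩
    obtain ⟨P, p', s, g1, g2, g3, g4, g5⟩ := ih hy'
    by_cases hyP : y ∈ P
    · obtain ⟨l₁, l₂, rfl⟩ := List.append_of_mem hyP
      exact ⟨y :: l₂, p', s, g1.suffix, (List.nodup_append.1 g2).2.1,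
        fun v hv => g3 v (List.mem_append_right _ hv), g4, g5⟩
    · exact ⟨y :: P, p', s, g1.cons h1, List.nodup_cons.2 ⟨hyP, g2⟩, by
        intro v hv
        rcases List.mem_cons.1 hv with rfl | hv
        · exact hy
        · exact g3 v hv, g4, g5⟩

theorem exists_first_exit {B : V → V → Prop} {S : Set V} {c y : V}
    (h : Relation.ReflTransGen B c y) (hc : c ∈ S) (hy : y ∉ S) :
    ∃ a ∈ S, ∃ b, b ∉ S ∧ B a b := by
  induction h with
  | refl => exact absurd hc hy
  | @tail b d h1 h2 ih =>
    by_cases hb : b ∈ S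
    · exact ⟨b, hb, d, hy, h2⟩
    · exact ih hb

end

section

/-- The arcs avoiding `F`. -/
def offArc (A : V → V → Prop) (F : Finset V) (a b : V) : Prop := A a b ∧ a ∉ F ∧ b ∉ F

/-- The digraph obtained by deleting `F` is strongly connected. -/
def StrongOff (A : V → V → Prop) (F : Finset V) : Prop :=
  ∀ u v, u ∉ F → v ∉ F → Relation.ReflTransGen (offArc A F) u v

theorem StrongOff.flip {F : Finset V} (h : StrongOff A F) : StrongOff (flip A) F := by
  intro u v hu hv
  refine Relation.ReflTransGen.mono ?_ _ _ (Relation.ReflTransGen.swap _ _ (h v u hv hu))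
  rintro a b ⟨h1, h2, h3⟩
  exact ⟨h1, h3, h2⟩

variable {F : Finset V} {Q W P : List V} {q q' w w' p p' : V} {m : ℕ}

theorem wk_of_offArc {a b : V} {l : List V} (h : Wk (offArc A F) a l b) : Wk A a l b :=
  ⟨h.1.imp fun _ _ hab => hab.1, h.2⟩

theorem not_mem_of_wk_offArc {a b : V} {l : List V} (h : Wk (offArc A F) a l b) (ha : a ∉ F) :
    ∀ v ∈ l, v ∉ F := by
  intro v hv
  obtain ⟨l₁, l₂, rfl⟩ := List.append_of_mem hv
  rcases eq_or_ne l₁ [] with rfl | hl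
  · obtain rfl : v = a := by simpa using h.2.1
    exact ha
  · obtain ⟨d, -, hd, -⟩ := h.split hl
    exact hd.2.2

theorem exists_cyc_off (h : StrongOff A F) {a b : V} (hab : a ≠ b) (ha : a ∉ F) (hb : b ∉ F) :
    ∃ c, Cyc A c ∧ ∀ y ∈ c, y ∉ F := by
  obtain ⟨a', ha', y, hy, hay⟩ := exists_first_exit (S := {a}) (h a b ha hb) rfl hab.symm
  obtain rfl : a' = a := ha'
  obtain ⟨P, p', s, g1, g2, g3, g4, g5⟩ :=
    exists_path_to (S := {a'}) (h y a' hay.2.2 ha) rfl hy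
  obtain rfl : s = a' := g5
  refine ⟨s :: P, Cyc.mk ((wk_of_offArc g1).cons hay.1) g4.1
    (List.nodup_cons.2 ⟨fun hs => g3 s hs rfl, g2⟩), ?_⟩
  intro v hv
  rcases List.mem_cons.1 hv with rfl | hv
  · exact ha
  · exact not_mem_of_wk_offArc g1 hay.2.2 v hv

theorem exists_longest [Fintype V] (Φ : List V → Prop) (h : ∃ c, Cyc A c ∧ Φ c) :
    ∃ c, (Cyc A c ∧ Φ c) ∧ ∀ c', Cyc A c' → Φ c' → c'.length ≤ c.length := by
  obtain ⟨c₀, h₀, h₀'⟩ := h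
  let p : ℕ → Prop := fun l => ∃ c, Cyc A c ∧ Φ c ∧ c.length = l
  have hb : ∀ c, Cyc A c → c.length ≤ Fintype.card V := fun c hc => hc.1.length_le_card
  obtain ⟨c, h1, h2, h3⟩ := Nat.findGreatest_spec (P := p) (hb c₀ h₀) ⟨c₀, h₀, h₀', rfl⟩
  refine ⟨c, ⟨h1, h2⟩, fun c' h1' h2' => ?_⟩
  rw [h3]
  exact Nat.le_findGreatest (hb c' h1') ⟨c', h1', h2', rfl⟩

/-- There is a longest cycle avoiding `F` with a bypass over a gap of size `k`. -/
def HasGap (A : V → V → Prop) (F : Finset V) (m k : ℕ) : Prop :=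
  ∃ Q W P q q' w w' p p', Gap A F Q W q q' w w' ∧ Bypass A F Q W P q q' p p' ∧
    Q.length + W.length = m ∧ W.length = k

theorem exists_hasGap (h : StrongOff A F) (hm : MaxLen A F m) {c : List V} (hc : Cyc A c)
    (hcF : ∀ y ∈ c, y ∉ F) (hlen : c.length = m) {y : V} (hyc : y ∉ c) (hyF : y ∉ F) :
    ∃ k, HasGap A F m k := by
  obtain ⟨v, hv⟩ : ∃ v, v ∈ c := List.exists_mem_of_length_pos hc.length_pos
  obtain ⟨q', hq', p, hp, hqp⟩ :=
    exists_first_exit (S := {v | v ∈ c}) (h v y (hcF v hv) hyF) hv hyc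
  obtain ⟨P, p', q, g1, g2, g3, g4, g5⟩ :=
    exists_path_to (S := {v | v ∈ c}) (h p v hqp.2.2 (hcF v hv)) hv hp
  have hPF := not_mem_of_wk_offArc g1 hqp.2.2
  have hwP := wk_of_offArc g1
  obtain ⟨l₁, l₂, rfl⟩ := List.append_of_mem (show q ∈ c from g5)
  have hrot : (q :: l₂ ++ l₁).Perm (l₁ ++ q :: l₂) := List.perm_append_comm
  obtain ⟨hn, a, b, hw, hba⟩ := hc.rotate
  obtain rfl : q = a := by simpa using hw.2.1
  obtain ⟨s, t, hst⟩ := List.append_of_mem (hrot.mem_iff.2 (show q' ∈ l₁ ++ q :: l₂ from hq'))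
  rw [hst] at hrot hn hw
  have hQ := hw.initial
  have hst' : s ++ q' :: t = (s ++ [q']) ++ t := by simp
  rw [hst'] at hrot hn
  have hav : ∀ y ∈ P, y ∉ (s ++ [q']) ∧ y ∉ t ∧ y ∉ F := fun y hy => by
    have := g3 y hy
    simp only [Set.mem_ofPred_eq, ← hrot.mem_iff, List.mem_append, not_or] at this ⊢
    exact ⟨this.1, this.2, hPF y hy⟩
  rcases eq_or_ne t [] with rfl | ht
  · exfalso
    have hcyc : Cyc A ((s ++ [q']) ++ P) := Cyc.mk (hQ.append hqp.1 hwP) g4.1 (by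
      rw [List.nodup_append]
      refine ⟨by simpa using hn, g2, ?_⟩
      rintro a ha b hb rfl
      exact (hav a hb).1 ha)
    have := hm _ hcyc (fun y hy => by
      rcases List.mem_append.1 hy with h' | h'
      · exact hcF y (hrot.mem_iff.1 (by simpa using h'))
      · exact hPF y h')
    have h2 := hrot.length_eq
    have hpos := List.length_pos_iff.2 hwP.ne_nil
    simp at this h2 hlen
    omega
  · obtain ⟨d, hd1, hd2⟩ := hw.tail ht
    exact ⟨t.length, s ++ [q'], t, P, q, q', d, b, p, p',
      ⟨hQ, hd2, hd1, hba, hn, fun y hy => hcF y (hrot.mem_iff.1 hy)⟩,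
      ⟨hwP, hqp.1, g4.1, g2, hav⟩,
      by have := hrot.length_eq; rw [List.length_append] at this; omega, rfl⟩

/-- A bypass over a smallest possible gap in a longest cycle avoiding `F`. -/
structure MinGap (A : V → V → Prop) (F : Finset V) (m : ℕ) (Q W P : List V)
    (q q' w w' p p' : V) : Prop where
  gap : Gap A F Q W q q' w w'
  byp : Bypass A F Q W P q q' p p'
  maxLen : MaxLen A F m
  len : Q.length + W.length = m
  min : ∀ k < W.length, ¬ HasGap A F m k

theorem exists_minGap (h : StrongOff A F) (hm : MaxLen A F m) {c : List V} (hc : Cyc A c)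
    (hcF : ∀ y ∈ c, y ∉ F) (hlen : c.length = m) {y : V} (hyc : y ∉ c) (hyF : y ∉ F) :
    ∃ Q W P q q' w w' p p', MinGap A F m Q W P q q' w w' p p' := by
  have hex := exists_hasGap h hm hc hcF hlen hyc hyF
  obtain ⟨Q, W, P, q, q', w, w', p, p', h1, h2, h3, h4⟩ := Nat.find_spec hex
  exact ⟨Q, W, P, q, q', w, w', p, p', h1, h2, hm, h3, fun k hk => Nat.find_min hex (by omega)⟩

theorem MinGap.no_path_to (h : MinGap A F m Q W P q q' w w' p p') {X : List V} {x x' v : V}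
    (hX : Wk A x X x') (hn : X.Nodup) (hav : ∀ y ∈ X, y ∉ Q ∧ y ∉ W ∧ y ∉ F) (hv : v ∈ W)
    (h1 : A q' x) (h2 : A x' v) : False := by
  have hlen := h.len
  have hnd := h.gap.nodup
  have hF := h.gap.avoid
  have hmin := h.min
  have hW := h.gap.wkW
  obtain ⟨W1, W2, rfl⟩ := List.append_of_mem hv
  have hQ' := hW.suffix.append h.gap.arcWQ h.gap.wkQ
  rcases eq_or_ne W1 [] with rfl | hne
  · have hcyc : Cyc A ((v :: W2 ++ Q) ++ X) := Cyc.mk (hQ'.append h1 hX) h2 (by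
      simp only [List.nil_append] at *
      grind)
    have := h.maxLen _ hcyc (by grind)
    have hpos := List.length_pos_iff.2 hX.ne_nil
    simp at this hlen
    omega
  · obtain ⟨d, hd1, hd2, -⟩ := hW.split hne
    refine hmin W1.length (by simp) ⟨v :: W2 ++ Q, W1, X, v, q', w, d, x, x',
      ⟨hQ', hd1, h.gap.arcQW, hd2, by grind, by grind⟩, ⟨hX, h1, h2, hn, by grind⟩, ?_, rfl⟩
    simp at hlen ⊢
    omega

theorem MinGap.no_path_from (h : MinGap A F m Q W P q q' w w' p p') {X : List V} {x x' v : V}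
    (hX : Wk A x X x') (hn : X.Nodup) (hav : ∀ y ∈ X, y ∉ Q ∧ y ∉ W ∧ y ∉ F) (hv : v ∈ W)
    (h1 : A v x) (h2 : A x' q) : False := by
  have hlen := h.len
  have hnd := h.gap.nodup
  have hF := h.gap.avoid
  have hmin := h.min
  have hW := h.gap.wkW
  obtain ⟨W1, W2, rfl⟩ := List.append_of_mem hv
  have hQ' := h.gap.wkQ.append h.gap.arcQW hW.initial
  rcases eq_or_ne W2 [] with rfl | hne
  · have hcyc : Cyc A ((Q ++ (W1 ++ [v])) ++ X) := Cyc.mk (hQ'.append h1 hX) h2 (by grind)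
    have := h.maxLen _ hcyc (by grind)
    have hpos := List.length_pos_iff.2 hX.ne_nil
    simp at this hlen
    omega
  · obtain ⟨d, hd1, hd2⟩ := hW.tail hne
    refine hmin W2.length (by simp; omega) ⟨Q ++ (W1 ++ [v]), W2, X, q, v, d, w', x, x',
      ⟨hQ', hd2, hd1, h.gap.arcWQ, by grind, by grind⟩, ⟨hX, h1, h2, hn, by grind⟩, ?_, rfl⟩
    simp at hlen ⊢
    omega

theorem MinGap.not_arc_to (h : MinGap A F m Q W P q q' w w' p p') {z v : V} (hz : z ∈ P)
    (hv : v ∈ W) : ¬ A z v := by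
  intro hzv
  have hP := h.byp.wkP
  have hn := h.byp.nodup
  have hav := h.byp.avoid
  obtain ⟨P1, P2, rfl⟩ := List.append_of_mem hz
  exact h.no_path_to hP.initial (by grind) (by grind) hv h.byp.arcQP hzv

theorem MinGap.not_arc_from (h : MinGap A F m Q W P q q' w w' p p') {z v : V} (hz : z ∈ P)
    (hv : v ∈ W) : ¬ A v z := by
  intro hzv
  have hP := h.byp.wkP
  have hn := h.byp.nodup
  have hav := h.byp.avoid
  obtain ⟨P1, P2, rfl⟩ := List.append_of_mem hz
  exact h.no_path_from hP.suffix (by grind) (by grind) hv hzv h.byp.arcPQ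

theorem MinGap.not_arc_arc_to (h : MinGap A F m Q W P q q' w w' p p') {z v y : V} (hz : z ∈ P)
    (hv : v ∈ W) (hyQ : y ∉ Q) (hyW : y ∉ W) (hyF : y ∉ F) : ¬ (A z y ∧ A y v) := by
  rintro ⟨h1, h2⟩
  have hyP : y ∉ P := fun hy => h.not_arc_to hy hv h2
  have hP := h.byp.wkP
  have hn := h.byp.nodup
  have hav := h.byp.avoid
  obtain ⟨P1, P2, rfl⟩ := List.append_of_mem hz
  exact h.no_path_to (hP.initial.concat h1) (by grind) (by grind) hv h.byp.arcQP h2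

theorem MinGap.not_arc_arc_from (h : MinGap A F m Q W P q q' w w' p p') {z v y : V} (hz : z ∈ P)
    (hv : v ∈ W) (hyQ : y ∉ Q) (hyW : y ∉ W) (hyF : y ∉ F) : ¬ (A v y ∧ A y z) := by
  rintro ⟨h1, h2⟩
  have hyP : y ∉ P := fun hy => h.not_arc_from hy hv h1
  have hP := h.byp.wkP
  have hn := h.byp.nodup
  have hav := h.byp.avoid
  obtain ⟨P1, P2, rfl⟩ := List.append_of_mem hz
  exact h.no_path_from (hP.suffix.cons h2) (by grind) (by grind) hv h1 h.byp.arcPQ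

theorem MinGap.arcs_eq_zero (h : MinGap A F m Q W P q q' w w' p p') {z v : V} (hz : z ∈ P)
    (hv : v ∈ W) : arcs A z v = 0 :=
  Thomassen.arcs_eq_zero.2 ⟨h.not_arc_to hz hv, h.not_arc_from hz hv⟩

theorem MinGap.arcs_add_le (h : MinGap A F m Q W P q q' w w' p p') {z v y : V} (hz : z ∈ P)
    (hv : v ∈ W) (hyQ : y ∉ Q) (hyW : y ∉ W) (hyF : y ∉ F) :
    arcs A y z + arcs A y v ≤ 2 :=
  arcs_add_arcs_le (h.not_arc_arc_to hz hv hyQ hyW hyF) (h.not_arc_arc_from hz hv hyQ hyW hyF)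

/-- The degree condition of Ore type. -/
def Ore [Fintype V] (A : V → V → Prop) : Prop :=
  ∀ u v : V, u ≠ v → ¬ A u v → ¬ A v u → 2 * Fintype.card V ≤ deg A u + deg A v

theorem Ore.flip [Fintype V] (h : Ore A) : Ore (flip A) := by
  intro u v huv h1 h2
  rw [deg_flip, deg_flip]
  exact h u v huv h2 h1

/-- A form of Meyniel's theorem. -/
theorem hasCycle_card [Fintype V] (hirr : ∀ v, ¬ A v v) (hsc : StronglyConnected A)
    (hore : Ore A) (hV : 2 ≤ Fintype.card V) : HasCycleOfLength A (Fintype.card V) := by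
  have hso : StrongOff A ∅ := fun u v _ _ =>
    Relation.ReflTransGen.mono (fun a b hab => ⟨hab, by simp, by simp⟩) _ _ (hsc u v)
  obtain ⟨a, b, hab⟩ := Fintype.exists_pair_of_one_lt_card (α := V) (by omega)
  obtain ⟨c₀, hc₀, -⟩ := exists_cyc_off hso hab (by simp) (by simp)
  obtain ⟨c, ⟨hc, -⟩, hmax⟩ := exists_longest (A := A) (fun _ => True) ⟨c₀, hc₀, trivial⟩
  by_cases hsp : ∀ y, y ∈ c
  · have : c.length = Fintype.card V := by
      rw [← List.toFinset_card_of_nodup hc.1, ← card_univ]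
      congr 1
      ext y; simp [hsp y]
    rw [← this]
    exact hc.hasCycle
  · exfalso
    push Not at hsp
    obtain ⟨y, hy⟩ := hsp
    obtain ⟨Q, W, P, q, q', w, w', p, p', h⟩ := exists_minGap (m := c.length) hso
      (fun c' hc' _ => hmax c' hc' trivial) hc (by simp) rfl hy (by simp)
    have hp := h.byp.wkP.head_mem
    obtain ⟨v, hv, Q', g1, g2, g3, -, -, g6⟩ := h.gap.exists_deg_add_le hirr h.byp h.maxLen h.len hp
      (fun y hy => h.arcs_eq_zero hp hy)
      (fun v hv y h1 h2 h3 _ => h.arcs_add_le hp hv h1 h2 h3)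
    have h0 := h.not_arc_to hp hv
    have h1 := h.not_arc_from hp hv
    have := hore p v (by rintro rfl; exact (h.byp.avoid p hp).2.1 hv) h0 h1
    have := g3.length_le
    simp at g6
    omega

end

theorem sum_comp_of_cyc {m : ℕ} [NeZero m] {f : ZMod m → V} (hi : Injective f) {c : List V}
    (hc : ∀ v, v ∈ c ↔ ∃ i, f i = v) (g : V → ℕ) : ∑ i, g (f i) = ∑ v ∈ c.toFinset, g v := by
  have : c.toFinset = univ.image f := by
    ext v; simp [hc]
  rw [this, sum_image hi.injOn]

/-- In a strong semicomplete digraph a cycle which is not spanning can be prolonged. -/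
theorem hasCycle_succ_of_semicomplete [Fintype V] (hirr : ∀ v, ¬ A v v)
    (hsc : StronglyConnected A) (hcomp : ∀ u v, u ≠ v → A u v ∨ A v u) {m : ℕ} (hm : 2 ≤ m)
    (hmV : m < Fintype.card V) (h : HasCycleOfLength A m) : HasCycleOfLength A (m + 1) := by
  have : NeZero m := ⟨by omega⟩
  obtain ⟨f, hi, hf⟩ := h
  obtain ⟨y, hy⟩ : ∃ y, ∀ i, f i ≠ y := by
    by_contra! hcon
    have := Fintype.card_le_of_surjective f hcon
    rw [ZMod.card] at this
    omega
  by_contra hno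
  have hback : ∀ i : ZMod m, i + 1 + ((m - 1 : ℕ) : ZMod m) = i := by
    intro i
    have h1 : ((m - 1 : ℕ) : ZMod m) + 1 = 0 := by
      have : ((m - 1 + 1 : ℕ) : ZMod m) = 0 := by
        rw [Nat.sub_add_cancel (by omega)]; exact ZMod.natCast_self m
      exact_mod_cast this
    rw [add_assoc, add_comm 1, h1, add_zero]
  have hins : ∀ v, (∀ i, f i ≠ v) → ∀ i, A (f i) v → ¬ A v (f (i + 1)) := by
    intro v hv i h1 h2
    have := hasCycle_through hi hf hv (k := m - 1) (by omega) h2 (by rwa [hback])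
    rw [show m - 1 + 2 = m + 1 by omega] at this
    exact hno this
  have hall : ∀ v, (∀ i, f i ≠ v) → ∀ i, A (f i) v → ∀ j, A (f j) v := by
    intro v hv i h1
    have hk : ∀ k : ℕ, A (f (i + (k : ZMod m))) v := by
      intro k
      induction k with
      | zero => simpa using h1
      | succ k ih =>
        have := (hcomp (f (i + (k : ZMod m) + 1)) v (hv _)).resolve_right (hins v hv _ ih)
        rwa [add_assoc, ← Nat.cast_succ] at this
    intro j
    have := hk (j - i).val
    rwa [ZMod.natCast_zmod_val, add_sub_cancel] at this
  obtain ⟨u, hu, w, hw, huw, hfu, hwf⟩ : ∃ u, (∀ i, f i ≠ u) ∧ ∃ w, (∀ i, f i ≠ w) ∧ A u w ∧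
      (∀ i, A (f i) u) ∧ ∀ i, A w (f i) := by
    by_cases hyD : ∀ i, A (f i) y
    · obtain ⟨a, ha, b, hb, hab⟩ := exists_first_exit
        (S := {v | (∀ i, f i ≠ v) ∧ ∀ i, A (f i) v}) (hsc y (f 0)) ⟨hy, hyD⟩
        (fun h => h.1 0 rfl)
      have hbf : ∀ i, f i ≠ b := by
        rintro i rfl
        refine hins a ha.1 (i - 1) (ha.2 _) ?_
        rwa [sub_add_cancel]
      refine ⟨a, ha.1, b, hbf, hab, ha.2, fun i => ?_⟩
      exact (hcomp (f i) b (hbf i)).resolve_left fun h => hb ⟨hbf, hall b hbf i h⟩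
    · obtain ⟨a, ha, b, hb, hab⟩ := exists_first_exit
        (S := {v | (∀ i, f i ≠ v) → ∀ i, A (f i) v}) (hsc (f 0) y)
        (fun h => absurd rfl (h 0)) (fun h => hyD (h hy))
      simp only [Set.mem_ofPred_eq, Classical.not_imp] at ha hb
      have hbn : ∀ i, ¬ A (f i) b := fun i h => hb.2 (hall b hb.1 i h)
      have haf : ∀ i, f i ≠ a := by
        rintro i rfl
        exact hbn i hab
      exact ⟨a, haf, b, hb.1, hab, ha haf, fun i =>
        (hcomp (f i) b (hb.1 i)).resolve_left (hbn i)⟩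
  obtain ⟨k, rfl⟩ : ∃ k, m = k + 2 := ⟨m - 2, by omega⟩
  have hc : Cyc A (u :: w :: seg f 0 (k + 1)) := by
    refine Cyc.mk (((wk_seg hf 0 k).cons (hwf 0)).cons huw) (hfu _) ?_
    have h1 : ∀ v, (∀ i, f i ≠ v) → v ∉ seg f 0 (k + 1) := fun v hv hmem => by
      obtain ⟨i, -, h⟩ := mem_seg.1 hmem
      exact hv _ h
    have hne : u ≠ w := by rintro rfl; exact hirr u huw
    simp [h1 u hu, h1 w hw, hne, nodup_seg hi 0 (show k + 1 ≤ k + 2 by omega)]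
  have := hc.hasCycle
  simp only [List.length_cons, length_seg] at this
  exact hno this

theorem hasCycle_two (hirr : ∀ v, ¬ A v v) {a b : V} (h1 : A a b) (h2 : A b a) :
    HasCycleOfLength A 2 := by
  have : Cyc A [a, b] := Cyc.mk ((Wk.single b).cons h1) h2
    (by simp; rintro rfl; exact hirr a h1)
  simpa using this.hasCycle

/-- A strong semicomplete digraph with a 2-cycle is pancyclic. -/
theorem pancyclic_of_semicomplete [Fintype V] (hirr : ∀ v, ¬ A v v)
    (hsc : StronglyConnected A) (hcomp : ∀ u v, u ≠ v → A u v ∨ A v u) {a b : V}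
    (h1 : A a b) (h2 : A b a) : Pancyclic A := by
  intro l hl
  induction l, hl using Nat.le_induction with
  | base => exact fun _ => hasCycle_two hirr h1 h2
  | succ k hk ih =>
    exact fun hle => hasCycle_succ_of_semicomplete hirr hsc hcomp hk (by omega) (ih (by omega))

/-- A cycle missing exactly one vertex, of degree at least the order, makes the digraph
pancyclic. -/
theorem pancyclic_of_missed [Fintype V] (hirr : ∀ v, ¬ A v v) {c : List V} (hc : Cyc A c)
    (hlen : c.length + 1 = Fintype.card V) {x : V} (hx : x ∉ c)
    (hdeg : Fintype.card V ≤ deg A x) : Pancyclic A := by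
  obtain ⟨f, hi, hf, hcf⟩ := hc.exists_fun
  have : NeZero c.length := ⟨hc.length_pos.ne'⟩
  intro l hl hl'
  refine hasCycle_of_many_arcs hi hf (x := x) (fun i h => hx ((hcf x).2 ⟨i, h⟩)) ?_ hl (by omega)
  rw [sum_comp_of_cyc hi hcf, hlen]
  refine hdeg.trans ?_
  rw [deg_eq_sum]
  have hu : (univ : Finset V) = insert x c.toFinset := by
    symm
    rw [← card_eq_iff_eq_univ, card_insert_of_notMem (by simpa using hx),
      List.toFinset_card_of_nodup hc.1, hlen]
  rw [hu, sum_insert (by simpa using hx), arcs_eq_zero.2 ⟨hirr x, hirr x⟩, zero_add]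

/-- `A` is the complete bipartite digraph with two sides of equal size. -/
def IsBalancedComplete [Fintype V] (A : V → V → Prop) : Prop :=
  Even (Fintype.card V) ∧ ∃ X Y : Set V, X.ncard = Fintype.card V / 2 ∧
    Y.ncard = Fintype.card V / 2 ∧ Disjoint X Y ∧ X ∪ Y = Set.univ ∧
    ∀ u v, A u v ↔ (u ∈ X ∧ v ∈ Y) ∨ (u ∈ Y ∧ v ∈ X)

/-- The structure around a cycle which misses exactly two vertices of high degree, in a digraph
which is not pancyclic. -/
structure TwoMissed [Fintype V] (A : V → V → Prop) {m : ℕ} (f : ZMod m → V) (y z : V)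
    (E : ZMod m → Prop) : Prop where
  inj : Injective f
  arc : ∀ i, A (f i) (f (i + 1))
  ne : y ≠ z
  ney : ∀ i, f i ≠ y
  nez : ∀ i, f i ≠ z
  cover : ∀ v, v = y ∨ v = z ∨ ∃ i, f i = v
  alt : ∀ j, E j ↔ ¬ E (j + 1)
  ytof : ∀ j, A y (f j) ↔ E j
  ftoy : ∀ j, A (f j) y ↔ E j
  ztof : ∀ j, A z (f j) ↔ ¬ E j
  ftoz : ∀ j, A (f j) z ↔ ¬ E j
  yz : A y z
  zy : A z y
  degy : deg A y = Fintype.card V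
  degz : deg A z = Fintype.card V

theorem TwoMissed.swap [Fintype V] {m : ℕ} {f : ZMod m → V} {y z : V} {E : ZMod m → Prop}
    (h : TwoMissed A f y z E) : TwoMissed A f z y (fun i => ¬ E i) :=
  ⟨h.inj, h.arc, h.ne.symm, h.nez, h.ney, fun v => by have := h.cover v; tauto,
    fun j => not_congr (h.alt j), h.ztof, h.ftoz, fun j => by rw [h.ytof, not_not],
    fun j => by rw [h.ftoy, not_not], h.zy, h.yz, h.degz, h.degy⟩

theorem exists_twoMissed [Fintype V] (hirr : ∀ v, ¬ A v v) (hsc : StronglyConnected A)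
    (hore : Ore A) (hpan : ¬ Pancyclic A) {m : ℕ} (hm : m ≠ 0) (hV : Fintype.card V = m + 2)
    {f : ZMod m → V} (hi : Injective f) (hf : ∀ i, A (f i) (f (i + 1))) {y z : V} (hyz : y ≠ z)
    (hfy : ∀ i, f i ≠ y) (hfz : ∀ i, f i ≠ z) (hy : Fintype.card V ≤ deg A y)
    (hz : Fintype.card V ≤ deg A z) : ∃ E, TwoMissed A f y z E := by
  have : NeZero m := ⟨hm⟩
  have huniv : (univ : Finset V) = insert y (insert z (univ.image f)) := by
    symm
    rw [← card_eq_iff_eq_univ, card_insert_of_notMem (by simp [hyz, hfy]),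
      card_insert_of_notMem (by simp [hfz]), card_image_of_injective _ hi, card_univ, ZMod.card, hV]
  have hcover : ∀ v, v = y ∨ v = z ∨ ∃ i, f i = v := by
    intro v
    have := mem_univ v
    rw [huniv] at this
    simpa using this
  have hdeg : ∀ v, deg A v = arcs A v y + arcs A v z + ∑ i, arcs A v (f i) := by
    intro v
    rw [deg_eq_sum, huniv, sum_insert (by simp [hyz, hfy]), sum_insert (by simp [hfz]),
      sum_image hi.injOn, add_assoc]
  have hham := hasCycle_card hirr hsc hore (by omega)
  have hcount : ∀ v, (∀ i, f i ≠ v) → ∑ i, arcs A v (f i) ≤ m := by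
    intro v hv
    by_contra! hlt
    refine hpan fun l hl hl' => ?_
    rcases Nat.lt_or_ge l (m + 2) with h | h
    · exact hasCycle_of_many_arcs hi hf hv (by omega) hl (by omega)
    · rw [show l = Fintype.card V by omega]; exact hham
  have h0 : ∀ a, arcs A a a = 0 := fun a => arcs_eq_zero.2 ⟨hirr a, hirr a⟩
  have hcy := hcount y hfy
  have hcz := hcount z hfz
  have hdy := hdeg y
  have hdz := hdeg z
  have hayz := arcs_le A y z
  rw [arcs_comm A z y, h0] at hdz
  rw [h0] at hdy
  have h2 : arcs A y z = 2 := by omega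
  obtain ⟨hAyz, hAzy⟩ := arcs_eq_two.1 h2
  obtain ⟨t, ht, htno⟩ : ∃ t, (1 ≤ t ∧ t < m) ∧ ¬ HasCycleOfLength A (t + 2) := by
    by_contra! hcon
    refine hpan fun l hl hl' => ?_
    rcases Nat.lt_or_ge l 3 with h | h
    · rw [show l = 2 by omega]; exact hasCycle_two hirr hAyz hAzy
    · rcases Nat.lt_or_ge l (m + 2) with h' | h'
      · have := hcon (l - 2) ⟨by omega, by omega⟩
        rwa [show l - 2 + 2 = l by omega] at this
      · rw [show l = Fintype.card V by omega]; exact hham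
  have hiff : ∀ v, (∀ i, f i ≠ v) → ∑ i, arcs A v (f i) = m →
      ∀ j, A v (f j) ↔ ¬ A (f (j + (t : ZMod m))) v := by
    intro v hv hs j
    have key : ∀ j ∈ univ, ar A v (f j) + ar A (f (j + (t : ZMod m))) v ≤ 1 := by
      intro j _
      by_contra! hj
      have h1 := ar_le A v (f j)
      have h2 := ar_le A (f (j + (t : ZMod m))) v
      have h3 : ar A v (f j) = 1 := by omega
      have h4 : ar A (f (j + (t : ZMod m))) v = 1 := by omega
      exact htno (hasCycle_through hi hf hv ht.2 (ar_eq_one.1 h3) (ar_eq_one.1 h4))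
    have hs' : ∑ j, (ar A v (f j) + ar A (f (j + (t : ZMod m))) v) = ∑ j : ZMod m, 1 := by
      have e := Equiv.sum_comp (Equiv.addRight (t : ZMod m)) fun j => ar A (f j) v
      simp only [Equiv.coe_addRight] at e
      rw [sum_add_distrib, e, ← sum_add_distrib]
      simpa [ZMod.card, arcs] using hs
    have := (sum_eq_sum_iff_of_le key).1 hs' j (mem_univ j)
    rw [← ar_eq_one (A := A), ← ar_eq_zero (A := A)]
    omega
  have hy' := hiff y hfy (by omega)
  have hz' := hiff z hfz (by omega)
  have hstep : ∀ y z, (∀ i, f i ≠ y) → (∀ i, f i ≠ z) → y ≠ z → A y z →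
      (∀ j, A y (f j) ↔ ¬ A (f (j + (t : ZMod m))) y) → ∀ j, A z (f j) → A y (f (j - 1)) := by
    intro y z hfy hfz hyz hAyz hy' j hj
    rw [hy']
    intro hcon
    obtain ⟨s, rfl⟩ : ∃ s, t = s + 1 := ⟨t - 1, by omega⟩
    have h1 : j - 1 + ((s + 1 : ℕ) : ZMod m) = j + (s : ZMod m) := by push_cast; ring
    rw [h1] at hcon
    have h2 : ∀ v, (∀ i, f i ≠ v) → v ∉ seg f j (s + 1) := fun v hv hmem => by
      obtain ⟨i, -, h⟩ := mem_seg.1 hmem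
      exact hv _ h
    have hc : Cyc A (y :: z :: seg f j (s + 1)) :=
      Cyc.mk (((wk_seg hf j s).cons hj).cons hAyz) hcon
        (by simp [hyz, h2 y hfy, h2 z hfz, nodup_seg hi j (show s + 1 ≤ m by omega)])
    exact htno (by simpa using hc.hasCycle)
  have hzy1 := hstep y z hfy hfz hyz hAyz hy'
  have hyz1 := hstep z y hfz hfy hyz.symm hAzy hz'
  have hdown : ∀ (i : ℕ) j, A y (f j) → A y (f (j - 2 * (i : ZMod m))) := by
    intro i
    induction i with
    | zero => intro j h; simpa using h
    | succ i ih =>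
      intro j h
      have := hzy1 _ (hyz1 _ (ih j h))
      rwa [show j - 2 * (i : ZMod m) - 1 - 1 = j - 2 * ((i + 1 : ℕ) : ZMod m) by
        push_cast; ring] at this
  have hm1 : ((m - 1 : ℕ) : ZMod m) = -1 := by
    rw [Nat.cast_sub (by omega), ZMod.natCast_self]; simp
  have hE2 : ∀ j, A y (f (j - 2)) ↔ A y (f j) := by
    intro j
    constructor
    · intro h
      have := hdown (m - 1) _ h
      rwa [hm1, show j - 2 - 2 * (-1 : ZMod m) = j by ring] at this
    · intro h
      simpa using hdown 1 j h
  have hzE : ∀ j, A z (f j) ↔ A y (f (j - 1)) := by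
    intro j
    refine ⟨hzy1 j, fun h => ?_⟩
    have h1 := (hE2 (j + 1)).1 (by rwa [show j + 1 - 2 = j - 1 by ring])
    simpa using hyz1 _ h1
  have hall : ∀ (p : ZMod m → Prop) j, (∀ i, p i → p (i + 1)) → p j → ∀ i, p i := by
    intro p j hp hj i
    have hk : ∀ k : ℕ, p (j + (k : ZMod m)) := by
      intro k
      induction k with
      | zero => simpa using hj
      | succ k ih =>
        have := hp _ ih
        rwa [add_assoc, ← Nat.cast_succ] at this
    have := hk (i - j).val
    rwa [ZMod.natCast_zmod_val, add_sub_cancel] at this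
  have hnotall : ¬ ∀ j, A y (f j) := by
    intro hcon
    obtain ⟨a, ⟨i, rfl⟩, b, hb, hab⟩ := exists_first_exit (S := Set.range f) (hsc (f 0) y)
      ⟨0, rfl⟩ (by rintro ⟨i, h⟩; exact hfy i h)
    rcases hcover b with rfl | rfl | h
    · refine (hy' (i - (t : ZMod m))).1 (hcon _) ?_
      rwa [sub_add_cancel]
    · refine (hz' (i - (t : ZMod m))).1 ((hzE _).2 (hcon _)) ?_
      rwa [sub_add_cancel]
    · exact hb h
  have hnotnone : ¬ ∀ j, ¬ A y (f j) := by
    intro hcon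
    obtain ⟨a, ha, b, hb, hab⟩ := exists_first_exit (S := (Set.range f)ᶜ) (hsc y (f 0))
      (by rintro ⟨i, h⟩; exact hfy i h) (by simp)
    simp only [Set.mem_compl_iff, not_not] at hb
    obtain ⟨i, rfl⟩ := hb
    rcases hcover a with rfl | rfl | h
    · exact hcon _ hab
    · exact hcon _ ((hzE _).1 hab)
    · exact ha h
  have hE2' : ∀ j, A y (f (j + 1 + 1)) ↔ A y (f j) := by
    intro j
    rw [← hE2 (j + 1 + 1)]
    rw [show j + 1 + 1 - 2 = j by ring]
  have halt : ∀ j, A y (f j) ↔ ¬ A y (f (j + 1)) := by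
    intro j
    by_contra hcon
    by_cases hj : A y (f j)
    · have hj1 : A y (f (j + 1)) := by by_contra h; exact hcon ⟨fun _ => h, fun _ => hj⟩
      have := hall (fun i => A y (f i) ∧ A y (f (i + 1))) j
        (fun i h => ⟨h.2, (hE2' i).2 h.1⟩) ⟨hj, hj1⟩
      exact hnotall fun i => (this i).1
    · have hj1 : ¬ A y (f (j + 1)) := by
        intro h; exact hcon ⟨fun h' => absurd h' hj, fun h' => absurd h h'⟩
      have := hall (fun i => ¬ A y (f i) ∧ ¬ A y (f (i + 1))) j
        (fun i h => ⟨h.2, fun h' => h.1 ((hE2' i).1 h')⟩) ⟨hj, hj1⟩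
      exact hnotnone fun i => (this i).1
  have hpar : ∀ (k : ℕ) j, A y (f (j + (k : ZMod m))) ↔ (A y (f j) ↔ Even k) := by
    intro k j
    induction k with
    | zero => simp
    | succ k ih =>
      have := halt (j + (k : ZMod m))
      rw [add_assoc, ← Nat.cast_succ] at this
      rw [Nat.even_add_one]
      tauto
  have hodd : ¬ Even t := by
    intro hev
    obtain ⟨j, hj⟩ : ∃ j, A y (f j) := by
      by_contra! hcon
      exact hnotnone hcon
    have h1 : ¬ A y (f (j - 1 - (t : ZMod m))) := by
      intro h
      have h2 := (hpar t (j - 1 - (t : ZMod m))).2 ⟨fun _ => hev, fun _ => h⟩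
      rw [sub_add_cancel] at h2
      have := (halt (j - 1)).1 h2
      rw [sub_add_cancel] at this
      exact this hj
    have h2 : A (f (j - 1)) y := by
      by_contra h
      refine h1 ((hy' _).2 ?_)
      rwa [sub_add_cancel]
    have hc : Cyc A (y :: seg f j (m - 1 + 1)) := by
      refine Cyc.mk ((wk_seg hf j (m - 1)).cons hj) ?_ ?_
      · rwa [hm1, ← sub_eq_add_neg]
      · rw [List.nodup_cons, mem_seg]
        refine ⟨?_, nodup_seg hi j (by omega)⟩
        rintro ⟨i, -, h⟩
        exact hfy _ h
    refine hpan (pancyclic_of_missed hirr hc (by simp; omega) (x := z) ?_ hz)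
    rw [List.mem_cons, mem_seg]
    rintro (h | ⟨i, -, h⟩)
    · exact hyz h.symm
    · exact hfz _ h
  have hfty : ∀ j, A (f j) y ↔ A y (f j) := by
    intro j
    have h1 := hy' (j - (t : ZMod m))
    have h2 := hpar t (j - (t : ZMod m))
    rw [sub_add_cancel] at h1 h2
    tauto
  have hzn : ∀ j, A z (f j) ↔ ¬ A y (f j) := by
    intro j
    have := halt (j - 1)
    rw [sub_add_cancel] at this
    rw [hzE, this]
  refine ⟨fun j => A y (f j), hi, hf, hyz, hfy, hfz, hcover, halt, fun j => Iff.rfl, hfty, hzn,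
    fun j => ?_, hAyz, hAzy, by omega, by omega⟩
  have h1 := hz' (j - (t : ZMod m))
  have h2 := hpar t (j - (t : ZMod m))
  have h3 := hzn (j - (t : ZMod m))
  rw [sub_add_cancel] at h1 h2
  tauto

theorem TwoMissed.arc_iff [Fintype V] (hirr : ∀ v, ¬ A v v) (hsc : StronglyConnected A)
    (hore : Ore A) (hpan : ¬ Pancyclic A) {m : ℕ} (hm : m ≠ 0) (hV : Fintype.card V = m + 2)
    {f : ZMod m → V} {y z : V} {E : ZMod m → Prop} (h : TwoMissed A f y z E) {i : ZMod m}
    (hEi : ¬ E i) (j : ZMod m) : (A (f i) (f j) ↔ E j) ∧ (A (f j) (f i) ↔ E j) := by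
  rcases eq_or_ne j i with rfl | hji
  · simp [hirr, hEi]
  have h1 : ¬ A y (f i) := by rwa [h.ytof]
  have h2 : ¬ A (f i) y := by rwa [h.ftoy]
  have h3 := hore y (f i) (h.ney i).symm h1 h2
  rw [h.degy] at h3
  have hE1 : E (i + 1) := by by_contra hc; exact hEi ((h.alt i).2 hc)
  have hE0 : E (i - 1) := by
    rw [h.alt, sub_add_cancel]; exact hEi
  have h11 : i + 1 ≠ i := by intro hc; rw [hc] at hE1; exact hEi hE1
  have h10 : i - 1 ≠ i := by intro hc; rw [hc] at hE0; exact hEi hE0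
  have hupd : ∀ k, update f i y k = if k = i then y else f k := fun k => by
    rw [update_apply]
  have hinj : Injective (update f i y) := by
    intro a b hab
    simp only [hupd] at hab
    split_ifs at hab with ha hb hb
    · rw [ha, hb]
    · exact absurd hab.symm (h.ney b)
    · exact absurd hab (h.ney a)
    · exact h.inj hab
  obtain ⟨E', hE'⟩ := exists_twoMissed hirr hsc hore hpan hm hV (f := update f i y) (y := f i)
    (z := z) hinj (by
      intro k
      simp only [hupd]
      split_ifs with ha hb hb
      · have := hirr; rw [ha] at hb; exact absurd hb h11
      · rw [ha, h.ytof]; exact hE1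
      · rw [h.ftoy, eq_sub_of_add_eq hb]; exact hE0
      · exact h.arc k) (h.nez i) (by
      intro k
      simp only [hupd]
      split_ifs with ha
      · exact (h.ney i).symm
      · exact fun hc => ha (h.inj hc)) (by
      intro k
      simp only [hupd]
      split_ifs with ha
      · exact h.ne
      · exact h.nez k) (by omega) (by rw [h.degz])
  have hEE : E' j ↔ E j := by
    have h4 := hE'.ztof j
    have h5 := h.ztof j
    rw [hupd, if_neg hji] at h4
    tauto
  have h6 := hE'.ytof j
  have h7 := hE'.ftoy j
  rw [hupd, if_neg hji] at h6 h7
  exact ⟨h6.trans hEE, h7.trans hEE⟩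

/-- A cycle missing exactly two vertices, both of high degree. -/
theorem pancyclic_or_balanced_of_two_missed [Fintype V] (hirr : ∀ v, ¬ A v v)
    (hsc : StronglyConnected A) (hore : Ore A) {c : List V} (hc : Cyc A c)
    (hlen : c.length + 2 = Fintype.card V) {y z : V} (hyz : y ≠ z) (hyc : y ∉ c) (hzc : z ∉ c)
    (hy : Fintype.card V ≤ deg A y) (hz : Fintype.card V ≤ deg A z) :
    Pancyclic A ∨ IsBalancedComplete A := by
  by_contra! hcon
  obtain ⟨hpan, hbal⟩ := hcon
  obtain ⟨f, hi, hf, hcf⟩ := hc.exists_fun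
  have hm := hc.length_pos.ne'
  obtain ⟨E, h⟩ := exists_twoMissed hirr hsc hore hpan hm hlen.symm hi hf hyz
    (fun i h => hyc ((hcf y).2 ⟨i, h⟩)) (fun i h => hzc ((hcf z).2 ⟨i, h⟩)) hy hz
  have key : ∀ i j, A (f i) (f j) ↔ (E j ↔ ¬ E i) := by
    intro i j
    by_cases hEi : E i
    · rw [(h.swap.arc_iff hirr hsc hore hpan hm hlen.symm (i := i) (by simpa using hEi) j).1]
      tauto
    · rw [(h.arc_iff hirr hsc hore hpan hm hlen.symm hEi j).1]
      tauto
  set X : Set V := {v | v = y ∨ ∃ i, f i = v ∧ ¬ E i} with hX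
  set Y : Set V := {v | v = z ∨ ∃ i, f i = v ∧ E i} with hY
  have hyX : y ∈ X := Or.inl rfl
  have hzY : z ∈ Y := Or.inl rfl
  have hyY : y ∉ Y := by
    rintro (h' | ⟨i, h', -⟩)
    · exact hyz h'
    · exact h.ney i h'
  have hzX : z ∉ X := by
    rintro (h' | ⟨i, h', -⟩)
    · exact hyz h'.symm
    · exact h.nez i h'
  have hfX : ∀ i, f i ∈ X ↔ ¬ E i := by
    intro i
    constructor
    · rintro (h' | ⟨j, h', hj⟩)
      · exact absurd h' (h.ney i)
      · rwa [← h.inj h']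
    · exact fun h' => Or.inr ⟨i, rfl, h'⟩
  have hfY : ∀ i, f i ∈ Y ↔ E i := by
    intro i
    constructor
    · rintro (h' | ⟨j, h', hj⟩)
      · exact absurd h' (h.nez i)
      · rwa [← h.inj h']
    · exact fun h' => Or.inr ⟨i, rfl, h'⟩
  have hXY : ∀ v, v ∈ X ↔ v ∉ Y := by
    intro v
    rcases h.cover v with rfl | rfl | ⟨i, rfl⟩
    · tauto
    · tauto
    · rw [hfX, hfY]
  clear_value X Y
  clear hX hY
  have hA : ∀ u v, A u v ↔ (u ∈ X ∧ v ∈ Y) ∨ (u ∈ Y ∧ v ∈ X) := by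
    intro u v
    have a1 := h.yz
    have a2 := h.zy
    have a3 := hirr
    rcases h.cover u with rfl | rfl | ⟨i, rfl⟩ <;> rcases h.cover v with rfl | rfl | ⟨j, rfl⟩ <;>
      simp only [key, a1, a2, a3, hyX, hzY, hyY, hzX, hfX, hfY, h.ytof, h.ftoy, h.ztof,
        h.ftoz] <;> tauto
  have hout : ∀ u ∈ X, deg A u = 2 * Y.ncard := by
    intro u hu
    have hu' := (hXY u).1 hu
    have e1 : {v | A u v} = Y := by ext v; simp only [Set.mem_ofPred_eq, hA]; have := hXY v; tauto
    have e2 : {v | A v u} = Y := by ext v; simp only [Set.mem_ofPred_eq, hA]; have := hXY v; tauto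
    rw [deg, outDeg, inDeg, e1, e2]; omega
  have hout' : ∀ u ∈ Y, deg A u = 2 * X.ncard := by
    intro u hu
    have hu' : u ∉ X := fun h' => (hXY u).1 h' hu
    have e1 : {v | A u v} = X := by ext v; simp only [Set.mem_ofPred_eq, hA]; have := hXY v; tauto
    have e2 : {v | A v u} = X := by ext v; simp only [Set.mem_ofPred_eq, hA]; have := hXY v; tauto
    rw [deg, outDeg, inDeg, e1, e2]; omega
  have d1 := hout y hyX
  have d2 := hout' z hzY
  rw [h.degy] at d1
  rw [h.degz] at d2
  refine hbal ⟨⟨Y.ncard, by omega⟩, X, Y, by omega, by omega, ?_, ?_, hA⟩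
  · rw [Set.disjoint_left]; exact fun v hv => (hXY v).1 hv
  · ext v; simp only [Set.mem_union, Set.mem_univ, iff_true]; have := hXY v; tauto

section

theorem strongOff_of_cyc (hsc : StronglyConnected A) {c : List V} (hc : Cyc A c) {z : V}
    (hz : z ∉ c) (h1 : ∀ b ∉ c, b ≠ z → A b z → ∃ k ∈ c, A b k)
    (h2 : ∀ b ∉ c, b ≠ z → A z b → ∃ k ∈ c, A k b) : StrongOff A {z} := by
  have hcc : ∀ a ∈ c, ∀ b ∈ c, Relation.ReflTransGen (offArc A {z}) a b := by
    obtain ⟨f, hi, hf, hm⟩ := hc.exists_fun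
    have : NeZero c.length := ⟨hc.length_pos.ne'⟩
    have hne : ∀ i, f i ∉ ({z} : Finset V) := fun i h =>
      hz (by rw [Finset.mem_singleton] at h; rw [← h, hm]; exact ⟨i, rfl⟩)
    have hk : ∀ (k : ℕ) i, Relation.ReflTransGen (offArc A {z}) (f i) (f (i + (k : ZMod _))) := by
      intro k i
      induction k with
      | zero => simpa using Relation.ReflTransGen.refl
      | succ k ih =>
        refine ih.tail ⟨?_, hne _, hne _⟩
        rw [Nat.cast_succ, ← add_assoc]
        exact hf _
    intro a ha b hb
    obtain ⟨i, rfl⟩ := (hm a).1 ha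
    obtain ⟨j, rfl⟩ := (hm b).1 hb
    have := hk (j - i).val i
    rwa [ZMod.natCast_zmod_val, add_sub_cancel] at this
  obtain ⟨k₀, hk₀⟩ : ∃ v, v ∈ c := List.exists_mem_of_length_pos hc.length_pos
  have hcz : ∀ k ∈ c, k ∉ ({z} : Finset V) := fun k hk h =>
    hz (by rw [Finset.mem_singleton] at h; rwa [← h])
  have hto : ∀ y, y ≠ z → Relation.ReflTransGen (offArc A {z}) y k₀ := by
    by_contra! hcon
    obtain ⟨y, hy, hy'⟩ := hcon
    obtain ⟨a, ⟨ha, ha'⟩, b, hb, hab⟩ := exists_first_exit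
      (S := {a | a ≠ z ∧ ¬ Relation.ReflTransGen (offArc A {z}) a k₀}) (hsc y k₀) ⟨hy, hy'⟩
      (fun h => h.2 .refl)
    have hac : a ∉ c := fun h => ha' (hcc a h k₀ hk₀)
    by_cases hbz : b = z
    · obtain ⟨k, hk, hak⟩ := h1 a hac ha (hbz ▸ hab)
      exact ha' ((hcc k hk k₀ hk₀).head ⟨hak, by simpa using ha, hcz k hk⟩)
    · have : Relation.ReflTransGen (offArc A {z}) b k₀ := by
        by_contra h; exact hb ⟨hbz, h⟩
      exact ha' (this.head ⟨hab, by simpa using ha, by simpa using hbz⟩)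
  have hfrom : ∀ y, y ≠ z → Relation.ReflTransGen (offArc A {z}) k₀ y := by
    by_contra! hcon
    obtain ⟨y, hy, hy'⟩ := hcon
    obtain ⟨b, hb, a, ha, hba⟩ := exists_first_exit
      (S := {a | a = z ∨ Relation.ReflTransGen (offArc A {z}) k₀ a}) (hsc k₀ y) (Or.inr .refl)
      (fun h => h.elim hy hy')
    have haz : a ≠ z := fun h => ha (Or.inl h)
    have ha' : ¬ Relation.ReflTransGen (offArc A {z}) k₀ a := fun h => ha (Or.inr h)
    have hac : a ∉ c := fun h => ha' (hcc k₀ hk₀ a h)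
    by_cases hbz : b = z
    · obtain ⟨k, hk, hak⟩ := h2 a hac haz (hbz ▸ hba)
      exact ha' ((hcc k₀ hk₀ k hk).tail ⟨hak, hcz k hk, by simpa using haz⟩)
    · rcases hb with hb | hb
      · exact hbz hb
      · exact ha' (hb.tail ⟨hba, by simpa using hbz, by simpa using haz⟩)
  intro u v hu hv
  exact (hto u (by simpa using hu)).trans (hfrom v (by simpa using hv))

theorem wk_of_clique : ∀ {l : List V}, l ≠ [] → l.Nodup → (∀ a ∈ l, ∀ b ∈ l, a ≠ b → A a b) →
    ∃ a b, Wk A a l b := by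
  intro l
  induction l with
  | nil => simp
  | cons a l ih =>
    intro _ hn hc
    rcases eq_or_ne l [] with rfl | hl
    · exact ⟨a, a, Wk.single a⟩
    · obtain ⟨b, d, h⟩ := ih hl (List.nodup_cons.1 hn).2
        (fun a ha b hb => hc a (by simp [ha]) b (by simp [hb]))
      refine ⟨a, d, h.cons (hc a (by simp) b (by simp [h.head_mem]) ?_)⟩
      rintro rfl
      exact (List.nodup_cons.1 hn).1 h.head_mem

/-- The configuration in which every estimate of the counting argument is an equality. -/
structure Tight [Fintype V] (A : V → V → Prop) (x : V) (m : ℕ) (Q P W : List V) (q q' : V) :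
    Prop where
  wkQ : Wk A q Q q'
  nodup : (Q ++ (P ++ (x :: W))).Nodup
  neP : P ≠ []
  neW : W ≠ []
  lt : m < Q.length + P.length + W.length
  strong : StrongOff A {x}
  maxLen : ∀ g, StrongOff A {g} → Fintype.card V ≤ deg A g → MaxLen A {g} m
  high : Fintype.card V ≤ deg A x
  ends : ∀ a, a ∈ P ∨ a ∈ W → A a x ∧ A x a ∧ A q' a ∧ A a q ∧
    ∑ y ∈ Q.toFinset, arcs A a y = Q.length + 1
  cliqueP : ∀ a ∈ P, ∀ b ∈ P, a ≠ b → A a b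
  cliqueW : ∀ a ∈ W, ∀ b ∈ W, a ≠ b → A a b
  zero : ∀ u ∈ P, ∀ v ∈ W, arcs A u v = 0
  degs : ∀ u ∈ P, ∀ v ∈ W, deg A u + deg A v = 2 * Fintype.card V
  off : ∀ y, y ∉ Q → y ∉ P → y ∉ W → y ≠ x → ∀ u ∈ P, ∀ v ∈ W,
    arcs A y u + arcs A y v = 2 ∧ ¬ (A u y ∧ A y v) ∧ ¬ (A v y ∧ A y u)

variable {x : V} {m : ℕ} {Q P W : List V} {q q' : V}

theorem Tight.swap [Fintype V] (h : Tight A x m Q P W q q') : Tight A x m Q W P q q' where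
  wkQ := h.wkQ
  nodup := by have := h.nodup; grind
  neP := h.neW
  neW := h.neP
  lt := by have := h.lt; omega
  strong := h.strong
  maxLen := h.maxLen
  high := h.high
  ends := fun a ha => h.ends a ha.symm
  cliqueP := h.cliqueW
  cliqueW := h.cliqueP
  zero := fun u hu v hv => by rw [arcs_comm]; exact h.zero v hv u hu
  degs := fun u hu v hv => by rw [add_comm]; exact h.degs v hv u hu
  off := fun y h1 h2 h3 h4 u hu v hv => by
    have := h.off y h1 h3 h2 h4 v hv u hu
    rw [add_comm (arcs A y u)]
    tauto

theorem Tight.flip [Fintype V] (h : Tight A x m Q P W q q') :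
    Tight (flip A) x m Q.reverse P W q' q where
  wkQ := h.wkQ.flip
  nodup := by have := h.nodup; grind
  neP := h.neP
  neW := h.neW
  lt := by have := h.lt; simpa using this
  strong := h.strong.flip
  maxLen := fun g h1 h2 c hc hcg => by
    have := h.maxLen g h1.flip (by rwa [deg_flip] at h2) c.reverse (by simpa using hc.flip)
      (by simpa using hcg)
    simpa using this
  high := by rw [deg_flip]; exact h.high
  ends := fun a ha => by
    obtain ⟨h1, h2, h3, h4, h5⟩ := h.ends a ha
    refine ⟨h2, h1, h4, h3, ?_⟩
    simpa [arcs_flip] using h5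
  cliqueP := fun a ha b hb hab => h.cliqueP b hb a ha hab.symm
  cliqueW := fun a ha b hb hab => h.cliqueW b hb a ha hab.symm
  zero := fun u hu v hv => by rw [arcs_flip]; exact h.zero u hu v hv
  degs := fun u hu v hv => by rw [deg_flip, deg_flip]; exact h.degs u hu v hv
  off := fun y h1 h2 h3 h4 u hu v hv => by
    obtain ⟨g1, g2, g3⟩ := h.off y (by simpa using h1) h2 h3 h4 u hu v hv
    rw [arcs_flip, arcs_flip]
    exact ⟨g1, fun hh => g3 ⟨hh.2, hh.1⟩, fun hh => g2 ⟨hh.2, hh.1⟩⟩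

theorem MinGap.toTight [Fintype V] (hirr : ∀ v, ¬ A v v) (hore : Ore A) {w w' p p' : V}
    (h : MinGap A {x} m Q W P q q' w w' p p') (hx : StrongOff A {x})
    (hhigh : Fintype.card V ≤ deg A x)
    (hmax : ∀ g, StrongOff A {g} → Fintype.card V ≤ deg A g → MaxLen A {g} m) :
    Tight A x m Q P W q q' := by
  have key := fun (u : V) (hu : u ∈ P) (v : V) (hv : v ∈ W) =>
    h.gap.tight hirr h.byp h.maxLen h.len hore hu (fun y hy => h.arcs_eq_zero hu hy)
      (fun v hv y h1 h2 h3 _ => h.arcs_add_le hu hv h1 h2 (by simpa using h3)) hv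
  have hp := h.byp.wkP.head_mem
  have hw := h.gap.wkW.head_mem
  have hav := h.byp.avoid
  have hga := h.gap.avoid
  have hn1 := h.gap.nodup
  have hn2 := h.byp.nodup
  refine ⟨h.gap.wkQ, ?_, h.byp.wkP.ne_nil, h.gap.wkW.ne_nil, ?_, hx, hmax, hhigh, ?_, ?_, ?_,
    fun u hu v hv => h.arcs_eq_zero hu hv, fun u hu v hv => (key u hu v hv).1, ?_⟩
  · simp only [Finset.mem_singleton] at hav hga
    grind
  · have := h.len
    have := List.length_pos_iff.2 h.byp.wkP.ne_nil
    omega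
  · rintro a (ha | ha)
    · obtain ⟨-, k1, -, k2, -, -, -, k3, -⟩ := key a ha w hw
      exact ⟨k1.1, k1.2, k2.1, k2.2, k3⟩
    · obtain ⟨-, -, k1, -, k2, -, -, -, k3⟩ := key p hp a ha
      exact ⟨k1.1, k1.2, k2.1, k2.2, k3⟩
  · intro a ha b hb hab
    obtain ⟨-, -, -, -, -, -, k, -⟩ := key b hb w hw
    have h1 := k a (hav a ha).1 (hav a ha).2.1 (by simpa using (hav a ha).2.2) hab
    rw [h.arcs_eq_zero ha hw] at h1
    exact (arcs_eq_two.1 h1).1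
  · intro a ha b hb hab
    exact (key p hp b hb).2.2.2.2.2.1 a ha hab
  · intro y h1 h2 h3 h4 u hu v hv
    refine ⟨(key u hu v hv).2.2.2.2.2.2.1 y h1 h3 h4 (fun hh => h2 (hh ▸ hu)),
      h.not_arc_arc_to hu hv h1 h3 (by simpa using h4),
      h.not_arc_arc_from hu hv h1 h3 (by simpa using h4)⟩

theorem Tight.cyc_two [Fintype V] (h : Tight A x m Q P W q q') : Cyc A (Q ++ W) := by
  have hn := h.nodup
  obtain ⟨a, b, hw⟩ := wk_of_clique h.neW (by grind) h.cliqueW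
  exact Cyc.mk (h.wkQ.append (h.ends a (Or.inr hw.head_mem)).2.2.1 hw)
    (h.ends b (Or.inr hw.last_mem)).2.2.2.1 (by grind)

theorem Tight.not_cyc [Fintype V] (h : Tight A x m Q P W q q') {c : List V} (hc : Cyc A c)
    {g : V} (hg : g ∉ c) (hs : StrongOff A {g}) (hd : Fintype.card V ≤ deg A g) :
    c.length < Q.length + P.length + W.length :=
  lt_of_le_of_lt (h.maxLen g hs hd c hc (fun y hy hyg =>
    hg (by rw [Finset.mem_singleton] at hyg; rwa [← hyg]))) h.lt

/-- No vertex is joined by 2-cycles to a high part of the configuration. -/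
theorem Tight.arcs_le_one [Fintype V] (hsc : StronglyConnected A)
    (hore : Ore A) (h : Tight A x m Q P W q q') {u : V} (hu : u ∈ P)
    (hd : Fintype.card V ≤ deg A u) {z : V} (hzQ : z ∉ Q) (hzP : z ∉ P) (hzW : z ∉ W)
    (hzx : z ≠ x) : arcs A z u ≤ 1 := by
  by_contra! hgt
  obtain ⟨v, hv⟩ := List.exists_mem_of_ne_nil _ h.neW
  have hn := h.nodup
  have hz2 : ∀ a ∈ P, arcs A z a = 2 := by
    intro a ha
    have := (h.off z hzQ hzP hzW hzx u hu v hv).1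
    have := (h.off z hzQ hzP hzW hzx a ha v hv).1
    have := arcs_le A z u
    omega
  have hz0 : ∀ b ∈ W, arcs A z b = 0 := by
    intro b hb
    have := (h.off z hzQ hzP hzW hzx u hu b hb).1
    omega
  obtain ⟨a, b, hwP⟩ := wk_of_clique h.neP (by grind) h.cliqueP
  obtain ⟨a', b', hwW⟩ := wk_of_clique h.neW (by grind) h.cliqueW
  have ha := h.ends a (Or.inl hwP.head_mem)
  have hb := h.ends b (Or.inl hwP.last_mem)
  have ha' := h.ends a' (Or.inr hwW.head_mem)
  have hb' := h.ends b' (Or.inr hwW.last_mem)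
  have hK : Cyc A (Q ++ (P ++ (x :: W))) :=
    Cyc.mk (h.wkQ.append ha.2.2.1 (hwP.append hb.1 (hwW.cons ha'.2.1))) hb'.2.2.2.1 hn
  have hzK : z ∉ Q ++ (P ++ (x :: W)) := by simp [hzQ, hzP, hzW, hzx]
  have hzhigh : Fintype.card V ≤ deg A z := by
    have h0 := arcs_eq_zero.1 (hz0 v hv)
    have := hore z v (fun hh => hzW (hh ▸ hv)) h0.1 h0.2
    have := h.degs u hu v hv
    omega
  have hns : ¬ StrongOff A {z} := fun hs => by
    have := h.not_cyc hK hzK hs hzhigh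
    simp at this
    omega
  refine hns (strongOff_of_cyc hsc hK hzK ?_ ?_)
  · intro d hdK hdz hdA
    by_contra! hno
    have hdQ : d ∉ Q := fun hh => hdK (by simp [hh])
    have hdP : d ∉ P := fun hh => hdK (by simp [hh])
    have hdW : d ∉ W := fun hh => hdK (by simp [hh])
    have hdx : d ≠ x := fun hh => hdK (by simp [hh])
    have hbd : A b' d := by
      have h1 := (h.off d hdQ hdP hdW hdx u hu b' hwW.last_mem).1
      have h2 := hno u (by simp [hu])
      have h3 := hno b' (by simp [hwW.last_mem])
      rw [arcs, arcs, ar_eq_zero.2 h2, ar_eq_zero.2 h3] at h1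
      have := ar_le A u d
      have := ar_le A b' d
      exact ar_eq_one.1 (by omega)
    have hc : Cyc A (Q ++ (W ++ (d :: z :: P))) :=
      Cyc.mk (h.wkQ.append ha'.2.2.1 (hwW.append hbd
        ((hwP.cons (arcs_eq_two.1 (hz2 a hwP.head_mem)).1).cons hdA))) hb.2.2.2.1 (by
        simp only [List.nodup_append, List.nodup_cons, List.mem_append, List.mem_cons] at hn ⊢
        grind)
    have := h.not_cyc hc (g := x) (by grind) h.strong h.high
    simp at this
    omega
  · intro d hdK hdz hdA
    by_contra! hno
    have hdQ : d ∉ Q := fun hh => hdK (by simp [hh])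
    have hdP : d ∉ P := fun hh => hdK (by simp [hh])
    have hdW : d ∉ W := fun hh => hdK (by simp [hh])
    have hdx : d ≠ x := fun hh => hdK (by simp [hh])
    have hbd : A d a' := by
      have h1 := (h.off d hdQ hdP hdW hdx u hu a' hwW.head_mem).1
      have h2 := hno u (by simp [hu])
      have h3 := hno a' (by simp [hwW.head_mem])
      rw [arcs, arcs, ar_eq_zero.2 h2, ar_eq_zero.2 h3] at h1
      have := ar_le A d u
      have := ar_le A d a'
      exact ar_eq_one.1 (by omega)
    have hc : Cyc A (Q ++ (P ++ (z :: d :: W))) :=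
      Cyc.mk (h.wkQ.append ha.2.2.1 (hwP.append (arcs_eq_two.1 (hz2 b hwP.last_mem)).2
        ((hwW.cons hbd).cons hdA))) hb'.2.2.2.1 (by
        simp only [List.nodup_append, List.nodup_cons, List.mem_append, List.mem_cons] at hn ⊢
        grind)
    have := h.not_cyc hc (g := x) (by grind) h.strong h.high
    simp at this
    omega

theorem Tight.strongOff [Fintype V] (hsc : StronglyConnected A)
    (hore : Ore A) (h : Tight A x m Q P W q q') {u : V} (hu : u ∈ P)
    (hd : Fintype.card V ≤ deg A u) : StrongOff A {u} := by
  have hn := h.nodup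
  obtain ⟨v, hv⟩ := List.exists_mem_of_ne_nil _ h.neW
  have hxv := h.ends v (Or.inr hv)
  refine strongOff_of_cyc hsc h.cyc_two (by grind) ?_ ?_
  · intro b hb hbu hbA
    by_cases hbP : b ∈ P
    · exact ⟨q, by simp [h.wkQ.head_mem], (h.ends b (Or.inl hbP)).2.2.2.1⟩
    by_cases hbx : b = x
    · exact ⟨v, by simp [hv], hbx ▸ hxv.2.1⟩
    have hbQ : b ∉ Q := fun hh => hb (by simp [hh])
    have hbW : b ∉ W := fun hh => hb (by simp [hh])
    obtain ⟨h1, h2, h3⟩ := h.off b hbQ hbP hbW hbx u hu v hv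
    have h4 := h.arcs_le_one hsc hore hu hd hbQ hbP hbW hbx
    refine ⟨v, by simp [hv], ?_⟩
    by_contra hno
    have h5 := ar_eq_zero.2 hno
    have h6 := ar_eq_zero.2 (fun hh => h3 ⟨hh, hbA⟩)
    rw [arcs, arcs] at h1
    rw [arcs] at h4
    omega
  · intro b hb hbu hbA
    by_cases hbP : b ∈ P
    · exact ⟨q', by simp [h.wkQ.last_mem], (h.ends b (Or.inl hbP)).2.2.1⟩
    by_cases hbx : b = x
    · exact ⟨v, by simp [hv], hbx ▸ hxv.1⟩
    have hbQ : b ∉ Q := fun hh => hb (by simp [hh])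
    have hbW : b ∉ W := fun hh => hb (by simp [hh])
    obtain ⟨h1, h2, h3⟩ := h.off b hbQ hbP hbW hbx u hu v hv
    have h4 := h.arcs_le_one hsc hore hu hd hbQ hbP hbW hbx
    refine ⟨v, by simp [hv], ?_⟩
    by_contra hno
    have h5 := ar_eq_zero.2 hno
    have h6 := ar_eq_zero.2 (fun hh => h2 ⟨hbA, hh⟩)
    rw [arcs, arcs] at h1
    rw [arcs] at h4
    omega

theorem Tight.deg_add_le [Fintype V] (hirr : ∀ v, ¬ A v v) (hsc : StronglyConnected A)
    (hore : Ore A) (h : Tight A x m Q P W q q') {u : V} (hu : u ∈ P)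
    (hd : Fintype.card V ≤ deg A u) : deg A u + W.length ≤ Fintype.card V + P.length := by
  have hn := h.nodup
  set Z : Finset V := univ.filter fun z => z ∉ Q ++ (P ++ (x :: W)) with hZ
  have huniv : (univ : Finset V) =
      Q.toFinset ∪ (P.toFinset ∪ (insert x W.toFinset ∪ Z)) := by
    ext y
    simp [hZ]
    tauto
  have hd1 : Disjoint (insert x W.toFinset) Z := by
    rw [Finset.disjoint_left]
    simp only [hZ, Finset.mem_filter, Finset.mem_insert, List.mem_toFinset,
      List.nodup_append, List.nodup_cons, List.mem_append, List.mem_cons] at hn ⊢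
    grind
  have hd2 : Disjoint P.toFinset (insert x W.toFinset ∪ Z) := by
    rw [Finset.disjoint_left]
    simp only [hZ, Finset.mem_filter, Finset.mem_union, Finset.mem_insert, List.mem_toFinset,
      List.nodup_append, List.nodup_cons, List.mem_append, List.mem_cons] at hn ⊢
    grind
  have hd3 : Disjoint Q.toFinset (P.toFinset ∪ (insert x W.toFinset ∪ Z)) := by
    rw [Finset.disjoint_left]
    simp only [hZ, Finset.mem_filter, Finset.mem_union, Finset.mem_insert, List.mem_toFinset,
      List.nodup_append, List.nodup_cons, List.mem_append, List.mem_cons] at hn ⊢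
    grind
  have hxW : x ∉ W.toFinset := by rw [List.mem_toFinset]; grind
  have hcard : Fintype.card V = Q.length + (P.length + ((W.length + 1) + Z.card)) := by
    rw [← card_univ, huniv, card_union_of_disjoint hd3, card_union_of_disjoint hd2,
      card_union_of_disjoint hd1, card_insert_of_notMem hxW,
      List.toFinset_card_of_nodup (l := Q) (by grind),
      List.toFinset_card_of_nodup (l := P) (by grind),
      List.toFinset_card_of_nodup (l := W) (by grind)]
  have hdeg : deg A u = ∑ y ∈ Q.toFinset, arcs A u y + (∑ y ∈ P.toFinset, arcs A u y +
      ((arcs A u x + ∑ y ∈ W.toFinset, arcs A u y) + ∑ y ∈ Z, arcs A u y)) := by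
    rw [deg_eq_sum, huniv, sum_union hd3, sum_union hd2, sum_union hd1, sum_insert hxW]
  have e1 := (h.ends u (Or.inl hu)).2.2.2.2
  have e2 : ∑ y ∈ W.toFinset, arcs A u y = 0 :=
    sum_eq_zero fun y hy => h.zero u hu y (by simpa using hy)
  have e3 : ∑ y ∈ Z, arcs A u y ≤ Z.card := by
    have : ∑ y ∈ Z, arcs A u y ≤ ∑ y ∈ Z, 1 := sum_le_sum fun y hy => by
      rw [arcs_comm]
      simp [hZ] at hy
      exact h.arcs_le_one hsc hore hu hd (by tauto) (by tauto) (by tauto) (by tauto)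
    simpa using this
  have e4 : ∑ y ∈ P.toFinset, arcs A u y + 2 ≤ 2 * P.length := by
    have huP : u ∈ P.toFinset := by simpa using hu
    rw [← add_sum_erase _ _ huP]
    have h1 : ∑ y ∈ P.toFinset.erase u, arcs A u y ≤ ∑ y ∈ P.toFinset.erase u, 2 :=
      sum_le_sum fun y _ => arcs_le A u y
    have h2 := card_erase_add_one huP
    rw [List.toFinset_card_of_nodup (l := P) (by grind)] at h2
    rw [arcs_eq_zero.2 ⟨hirr u, hirr u⟩]
    simp only [sum_const, smul_eq_mul] at h1
    omega
  have e5 := arcs_le A u x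
  omega

theorem Tight.length_eq_one [Fintype V] (hirr : ∀ v, ¬ A v v) (hsc : StronglyConnected A)
    (hore : Ore A) (h : Tight A x m Q P W q q') {u : V} (hu : u ∈ P)
    (hd : Fintype.card V ≤ deg A u) : P.length = 1 ∧ W.length = 1 := by
  have h1 := h.deg_add_le hirr hsc hore hu hd
  have h2 := List.length_pos_iff.2 h.neP
  have h3 := List.length_pos_iff.2 h.neW
  have hn := h.nodup
  suffices P.length < 2 by omega
  by_contra! hlt
  have h4 := List.length_erase_of_mem hu
  have hne : P.erase u ≠ [] := by
    intro hh; rw [hh] at h4; simp at h4; omega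
  have hPn : P.Nodup := by grind
  have hsub : ∀ y, y ∈ P.erase u ↔ y ≠ u ∧ y ∈ P := fun y => hPn.mem_erase_iff
  have hPe := hPn.erase u
  obtain ⟨a, b, hwP⟩ := wk_of_clique hne hPe
    (fun a ha b hb => h.cliqueP a ((hsub a).1 ha).2 b ((hsub b).1 hb).2)
  obtain ⟨a', b', hwW⟩ := wk_of_clique h.neW (by grind) h.cliqueW
  have ha := h.ends a (Or.inl ((hsub _).1 hwP.head_mem).2)
  have hb := h.ends b (Or.inl ((hsub _).1 hwP.last_mem).2)
  have ha' := h.ends a' (Or.inr hwW.head_mem)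
  have hb' := h.ends b' (Or.inr hwW.last_mem)
  have hK : Cyc A (Q ++ (P.erase u ++ (x :: W))) :=
    Cyc.mk (h.wkQ.append ha.2.2.1 (hwP.append hb.1 (hwW.cons ha'.2.1))) hb'.2.2.2.1 (by
        simp only [List.nodup_append, List.nodup_cons, List.mem_append, List.mem_cons] at hn ⊢
        grind)
  have := h.not_cyc hK (g := u) (by grind) (h.strongOff hsc hore hu hd) hd
  simp only [List.length_append, List.length_cons, h4] at this
  omega

end

section

theorem exists_first_of_mem {p : V → Prop} : ∀ {l : List V}, (∃ a ∈ l, p a) →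
    ∃ l₁ a l₂, l = l₁ ++ a :: l₂ ∧ p a ∧ ∀ b ∈ l₁, ¬ p b := by
  intro l
  induction l with
  | nil => simp
  | cons c l ih =>
    rintro ⟨a, ha, hpa⟩
    by_cases hc : p c
    · exact ⟨[], c, l, rfl, hc, by simp⟩
    · obtain ⟨l₁, b, l₂, rfl, h1, h2⟩ := ih ⟨a, by
        rcases List.mem_cons.1 ha with rfl | ha
        · exact absurd hpa hc
        · exact ha, hpa⟩
      exact ⟨c :: l₁, b, l₂, rfl, h1, by simpa [hc] using h2⟩

theorem exists_last_of_mem {p : V → Prop} {l : List V} (h : ∃ a ∈ l, p a) :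
    ∃ l₁ a l₂, l = l₁ ++ a :: l₂ ∧ p a ∧ ∀ b ∈ l₂, ¬ p b := by
  obtain ⟨l₁, a, l₂, h1, h2, h3⟩ := exists_first_of_mem (l := l.reverse) (p := p) (by simpa using h)
  exact ⟨l₂.reverse, a, l₁.reverse, by rw [← List.reverse_reverse l, h1]; simp, h2,
    by simpa using h3⟩

theorem nodup_rotate_insert {L₁ L₂ Q X : List V} {r s : V} (h : ((L₁ ++ r :: L₂) ++ s :: Q).Nodup)
    (hX : X.Nodup) (hXL : ∀ y ∈ X, y ∉ (L₁ ++ r :: L₂) ++ s :: Q) :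
    ((s :: Q ++ (L₁ ++ [r])) ++ (X ++ L₂)).Nodup := by
  simp only [List.nodup_append, List.nodup_cons, List.mem_append, List.mem_cons,
    List.not_mem_nil] at h hXL ⊢
  grind

variable {x : V} {m : ℕ} {Q : List V} {q q' u v : V}

set_option maxHeartbeats 1000000 in
theorem Tight.false_of_dominated [Fintype V] (hirr : ∀ v, ¬ A v v) (hsc : StronglyConnected A)
    (hore : Ore A) (h : Tight A x m Q [u] [v] q q') (hdu : Fintype.card V ≤ deg A u)
    (hdv : Fintype.card V ≤ deg A v) {y₀ : V} (hQ : y₀ ∉ Q) (hu : y₀ ≠ u) (hv : y₀ ≠ v)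
    (hx : y₀ ≠ x) (huy : A u y₀) : False := by
  have hn := h.nodup
  simp only [List.nodup_append, List.nodup_cons, List.mem_append, List.mem_cons,
    List.not_mem_nil] at hn
  have hpu := h.ends u (by simp)
  have hpv := h.ends v (by simp)
  have hlt := h.lt
  have huoff := h.strongOff hsc hore (u := u) (by simp) hdu
  have hz0 := arcs_eq_zero.1 (h.zero u (by simp) v (by simp))
  have hcx : ∀ c, Cyc A c → x ∉ c → c.length ≤ Q.length + 1 := by
    intro c hc hxc
    have := h.not_cyc hc hxc h.strong h.high
    simp at this
    omega
  have hmaxx : MaxLen A {x} (Q.length + 1) := fun c hc hcx' => hcx c hc fun hh => by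
    simpa using hcx' x hh
  have hcu : ∀ c, Cyc A c → u ∉ c → c.length ≤ Q.length + 1 := by
    intro c hc hxc
    have := h.not_cyc hc hxc huoff hdu
    simp at this
    omega
  -- the vertices dominated by the two ends
  have hoff : ∀ y, y ∉ Q → y ≠ u → y ≠ v → y ≠ x →
      (A u y ∧ A v y ∧ ¬ A y u ∧ ¬ A y v) ∨ (A y u ∧ A y v ∧ ¬ A u y ∧ ¬ A v y) := by
    intro y h1 h2 h3 h4
    obtain ⟨g1, g2, g3⟩ := h.off y h1 (by simpa using h2) (by simpa using h3) h4 u (by simp) v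
      (by simp)
    have g4 := h.arcs_le_one hsc hore (u := u) (by simp) hdu h1 (by simpa using h2)
      (by simpa using h3) h4
    have g5 := h.swap.arcs_le_one hsc hore (u := v) (by simp) hdv h1 (by simpa using h3)
      (by simpa using h2) h4
    have k1 := ar_eq_one (A := A) (a := y) (b := u)
    have k2 := ar_eq_one (A := A) (a := u) (b := y)
    have k3 := ar_eq_one (A := A) (a := y) (b := v)
    have k4 := ar_eq_one (A := A) (a := v) (b := y)
    simp only [arcs] at g1 g4 g5
    by_cases e1 : A y u <;> by_cases e2 : A u y <;> by_cases e3 : A y v <;> by_cases e4 : A v y <;>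
      simp only [e1, e2, e3, e4, iff_true, iff_false] at k1 k2 k3 k4 g2 g3 ⊢ <;>
      first | omega | tauto
  let Zp : V → Prop := fun y => y ∉ Q ∧ y ≠ u ∧ y ≠ v ∧ y ≠ x ∧ A u y
  have hZp : ∀ y, Zp y → A v y ∧ ¬ A y u ∧ ¬ A y v := fun y hy => by
    have := hoff y hy.1 hy.2.1 hy.2.2.1 hy.2.2.2.1
    have := hy.2.2.2.2
    tauto
  have hZclosed : ∀ a b, Zp a → A a b → b ∉ Q → b ≠ x → Zp b := by
    intro a b ha hab hbQ hbx
    obtain ⟨g1, g2, g3⟩ := hZp a ha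
    have hbu : b ≠ u := by rintro rfl; exact g2 hab
    have hbv : b ≠ v := by rintro rfl; exact g3 hab
    refine ⟨hbQ, hbu, hbv, hbx, ?_⟩
    by_contra hub
    have hbv' : A b v := by have := hoff b hbQ hbu hbv hbx; tauto
    obtain ⟨a1, a2, a3, a4, a5⟩ := ha
    have hne : a ≠ b := by rintro rfl; exact hirr _ hab
    have hc : Cyc A (Q ++ [u, a, b, v]) :=
      Cyc.mk (h.wkQ.append hpu.2.2.1 ((((Wk.single v).cons hbv').cons hab).cons a5)) hpv.2.2.2.1
        (by
          simp only [List.nodup_append, List.nodup_cons, List.mem_cons, List.not_mem_nil]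
          grind)
    have := hcx _ hc (by simp; grind)
    simp at this
  have hy₀ : Zp y₀ := ⟨hQ, hu, hv, hx, huy⟩
  obtain ⟨Q1, s, Q2, hQeq, ⟨z, hz, hzs⟩, hfirst⟩ :
      ∃ Q1 s Q2, Q = Q1 ++ s :: Q2 ∧ (∃ z, Zp z ∧ A z s) ∧ ∀ b ∈ Q1, ¬ ∃ z, Zp z ∧ A z b := by
    apply exists_first_of_mem
    obtain ⟨a, ha, b, hb, hab⟩ := exists_first_exit (S := {y | Zp y})
      (h.strong y₀ u (by simpa using hx) (by
        have : u ≠ x := by grind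
        simpa using this)) hy₀ (fun hh => hh.2.1 rfl)
    refine ⟨b, ?_, a, ha, hab.1⟩
    by_contra hbQ
    exact hb (hZclosed a b ha hab.1 hbQ (by simpa using hab.2.2))
  obtain ⟨hz1, hz2, hz3⟩ := hZp z hz
  obtain ⟨z1, z2, z3, z4, z5⟩ := hz
  obtain ⟨L1, r, L2, hL, hr, hlast⟩ : ∃ L1 r L2, v :: Q1 = L1 ++ r :: L2 ∧
      (A r z ∨ ∃ y, y ∉ Q ∧ y ≠ v ∧ y ≠ x ∧ A r y ∧ A y z) ∧
      ∀ b ∈ L2, ¬ (A b z ∨ ∃ y, y ∉ Q ∧ y ≠ v ∧ y ≠ x ∧ A b y ∧ A y z) :=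
    exists_last_of_mem (p := fun r => A r z ∨ ∃ y, y ∉ Q ∧ y ≠ v ∧ y ≠ x ∧ A r y ∧ A y z)
      ⟨v, by simp, Or.inl hz1⟩
  have hL2 : ∀ y ∈ L2, y ∈ Q1 := by
    intro y hy
    rcases L1 with _ | ⟨a, L1⟩
    · simp at hL; rw [hL.2]; exact hy
    · simp at hL; rw [hL.2]; simp [hy]
  -- the cycle `v :: Q`, rotated and split
  have hvQ : v :: Q = (L1 ++ r :: L2) ++ s :: Q2 := by rw [← hL, hQeq]; simp
  have hwk : Wk A v ((L1 ++ r :: L2) ++ s :: Q2) q' := hvQ ▸ h.wkQ.cons hpv.2.2.2.1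
  have hnd : ((L1 ++ r :: L2) ++ s :: Q2).Nodup := by
    rw [← hvQ, List.nodup_cons]; grind
  have hmem : ∀ y, y ∈ (L1 ++ r :: L2) ++ s :: Q2 ↔ y = v ∨ y ∈ Q := fun y => by rw [← hvQ]; simp
  have hlen : (L1 ++ r :: L2).length + (s :: Q2).length = Q.length + 1 := by
    rw [← List.length_append, ← hvQ]; simp
  obtain ⟨d, hwL, hds, hw2⟩ := hwk.split (by simp)
  have hwQ := hw2.append hpv.2.2.1 hwL.initial
  obtain ⟨P', p, hwP, hrp, hPn, hPav⟩ : ∃ P' p, Wk A p P' z ∧ A r p ∧ P'.Nodup ∧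
      ∀ y ∈ P', y ∉ Q ∧ y ≠ v ∧ y ≠ x := by
    rcases hr with hr | ⟨y, y1, y2, y3, y4, y5⟩
    · exact ⟨[z], z, Wk.single z, hr, by simp, by simp; grind⟩
    · refine ⟨[y, z], y, (Wk.single z).cons y5, y4, ?_, by simp; grind⟩
      have : y ≠ z := by rintro rfl; exact hirr _ y5
      simpa using this
  have hPav' : ∀ y ∈ P', y ∉ (L1 ++ r :: L2) ++ s :: Q2 := fun y hy => by
    rw [hmem]; have := hPav y hy; tauto
  have hxL : x ∉ (L1 ++ r :: L2) ++ s :: Q2 := by rw [hmem]; grind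
  have hL2ne : L2 ≠ [] := by
    rintro rfl
    have hc : Cyc A ((s :: Q2 ++ (L1 ++ [r])) ++ P') := Cyc.mk (hwQ.append hrp hwP) hzs (by
      simpa using nodup_rotate_insert hnd hPn hPav')
    have := hcx _ hc (by
      simp only [List.mem_append, List.mem_cons, List.not_mem_nil] at hxL ⊢
      grind)
    have hpos := List.length_pos_iff.2 hwP.ne_nil
    simp only [List.length_append, List.length_cons, List.length_nil] at this hlen
    omega
  obtain ⟨e, hre, hwe⟩ := hwL.tail hL2ne
  have hmemQ : ∀ y, y ∉ s :: Q2 ++ (L1 ++ [r]) → y ∉ L2 → y ∉ Q ∧ y ≠ v := by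
    intro y h1 h2
    rw [and_comm, ← not_or, ← hmem]
    simp only [List.mem_append, List.mem_cons, List.not_mem_nil, or_false, not_or] at h1 ⊢
    exact ⟨⟨h1.2.1, h1.2.2, h2⟩, h1.1⟩
  have hgap : Gap A {x} (s :: Q2 ++ (L1 ++ [r])) L2 s r e d := by
    refine ⟨hwQ, hwe, hre, hds, ?_, ?_⟩
    · exact nodup_rotate_insert (X := []) hnd List.nodup_nil (by simp)
    · simp only [List.mem_append, List.mem_cons, List.not_mem_nil, Finset.mem_singleton] at hxL ⊢
      grind
  have hbyp : Bypass A {x} (s :: Q2 ++ (L1 ++ [r])) L2 P' s r p z := by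
    refine ⟨hwP, hrp, hzs, hPn, fun y hy => ?_⟩
    have h1 := hPav' y hy
    have h2 := hPav y hy
    simp only [List.mem_append, List.mem_cons, List.not_mem_nil, Finset.mem_singleton] at h1 ⊢
    tauto
  have hzw : ∀ y ∈ L2, arcs A z y = 0 := fun y hy => arcs_eq_zero.2
    ⟨fun hh => hfirst y (hL2 y hy) ⟨z, ⟨z1, z2, z3, z4, z5⟩, hh⟩, fun hh => hlast y hy (Or.inl hh)⟩
  obtain ⟨-, hzx, hdx, hrz, -⟩ := hgap.tight hirr hbyp hmaxx (by
    simp only [List.length_append, List.length_cons, List.length_nil] at hlen ⊢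
    omega) hore
    hwP.last_mem hzw (by
      intro w hw y g1 g2 g3 g4
      obtain ⟨g5, g6⟩ := hmemQ y g1 g2
      refine arcs_add_arcs_le ?_ ?_
      · rintro ⟨k1, k2⟩
        exact hfirst w (hL2 w hw) ⟨y, hZclosed z y ⟨z1, z2, z3, z4, z5⟩ k1 g5 g3, k2⟩
      · rintro ⟨k1, k2⟩
        exact hlast w hw (Or.inr ⟨y, g5, g6, g3, k1, k2⟩)) hwe.head_mem
  have hzL := hPav' z hwP.last_mem
  have huL : u ∉ (L1 ++ r :: L2) ++ s :: Q2 := by rw [hmem]; grind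
  have hc : Cyc A ((s :: Q2 ++ (L1 ++ [r])) ++ (z :: x :: L2)) :=
    Cyc.mk (hwQ.append hrz.1 ((hwe.cons hdx.2).cons hzx.1)) hds (by
      refine nodup_rotate_insert (X := [z, x]) hnd (by simpa using z4) ?_
      rintro y (_ | ⟨_, _ | ⟨_, h'⟩⟩)
      · exact hzL
      · exact hxL
      · cases h')
  have := hcu _ hc (by
    simp only [List.mem_append, List.mem_cons, List.not_mem_nil] at huL ⊢
    grind)
  simp only [List.length_append, List.length_cons, List.length_nil] at this hlen
  omega

theorem stronglyConnected_flip (hsc : StronglyConnected A) : StronglyConnected (flip A) :=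
  fun u v => by
    have := Relation.reflTransGen_swap.2 (hsc v u)
    exact this

/-- A digraph satisfying the degree condition with a vertex of large degree which is not a cut
vertex. -/
theorem pancyclic_or_balanced_of_strongOff [Fintype V] (hirr : ∀ v, ¬ A v v)
    (hsc : StronglyConnected A) (hore : Ore A) (hV : 3 ≤ Fintype.card V) {x₀ : V}
    (hx₀ : StrongOff A {x₀}) (hd₀ : Fintype.card V ≤ deg A x₀) :
    Pancyclic A ∨ IsBalancedComplete A := by
  obtain ⟨c, ⟨hc, x, hx, hd, hxc⟩, hmax⟩ := exists_longest (A := A)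
    (fun c => ∃ g, StrongOff A {g} ∧ Fintype.card V ≤ deg A g ∧ g ∉ c) (by
      have : 1 < ((univ : Finset V).erase x₀).card := by
        rw [Finset.card_erase_of_mem (mem_univ _), Finset.card_univ]; omega
      obtain ⟨a, ha, b, hb, hab⟩ := Finset.one_lt_card.1 this
      obtain ⟨c, hc, hcx⟩ := exists_cyc_off hx₀ hab (by simpa using ha) (by simpa using hb)
      exact ⟨c, hc, x₀, hx₀, hd₀, fun h => by simpa using hcx _ h⟩)
  have hmax' : ∀ g, StrongOff A {g} → Fintype.card V ≤ deg A g → MaxLen A {g} c.length :=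
    fun g h1 h2 c' hc' h3 => hmax c' hc' ⟨g, h1, h2, fun h => by simpa using h3 _ h⟩
  by_cases hall : ∀ y, y ∈ c ∨ y = x
  · left
    refine pancyclic_of_missed hirr hc ?_ hxc hd
    rw [← List.toFinset_card_of_nodup hc.1, ← Finset.card_univ,
      ← Finset.card_insert_of_notMem (by simpa using hxc)]
    congr 1
    ext y
    simpa [or_comm] using hall y
  push Not at hall
  obtain ⟨y, hyc, hyx⟩ := hall
  obtain ⟨Q, W, P, q, q', w, w', p, p', hgap⟩ := exists_minGap hx (hmax' x hx hd) hc
    (fun z hz h => hxc (by rw [Finset.mem_singleton] at h; exact h ▸ hz)) rfl hyc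
    (by simpa using hyx)
  have hT := hgap.toTight hirr hore hx hd hmax'
  clear hgap
  have hlen : P.length = 1 ∧ W.length = 1 := by
    obtain ⟨u, hu⟩ := List.exists_mem_of_ne_nil _ hT.neP
    obtain ⟨v, hv⟩ := List.exists_mem_of_ne_nil _ hT.neW
    have := hT.degs u hu v hv
    rcases le_total (Fintype.card V) (deg A u) with h | h
    · exact hT.length_eq_one hirr hsc hore hu h
    · exact (hT.swap.length_eq_one hirr hsc hore hv (by omega)).symm
  obtain ⟨⟨u, rfl⟩, ⟨v, rfl⟩⟩ := hlen.imp List.length_eq_one_iff.1 List.length_eq_one_iff.1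
  have hdeg := hT.degs u (by simp) v (by simp)
  have hdu : deg A u = Fintype.card V ∧ deg A v = Fintype.card V := by
    have h1 := hT.deg_add_le hirr hsc hore (u := u) (by simp)
    have h2 := hT.swap.deg_add_le hirr hsc hore (u := v) (by simp)
    simp only [List.length_cons, List.length_nil] at h1 h2
    omega
  have hn := hT.nodup
  simp only [List.nodup_append, List.nodup_cons, List.mem_append, List.mem_cons,
    List.not_mem_nil] at hn
  by_cases hZ : ∃ y, y ∉ Q ∧ y ≠ u ∧ y ≠ v ∧ y ≠ x
  · exfalso
    obtain ⟨y, hQ, hu, hv, hx⟩ := hZ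
    by_cases h1 : A u y
    · exact hT.false_of_dominated hirr hsc hore hdu.1.ge hdu.2.ge hQ hu hv hx h1
    · have h2 : A y u := by
        by_contra h2
        have h0 := arcs_eq_zero (A := A) (a := y) (b := u)
        have h3 := hT.off y hQ (by simpa using hu) (by simpa using hv) hx u (by simp) v (by simp)
        have h4 := arcs_eq_two (A := A) (a := y) (b := v)
        have h5 := hT.swap.arcs_le_one hsc hore (u := v) (by simp) hdu.2.ge hQ (by simpa using hv)
          (by simpa using hu) hx
        rw [h0.2 ⟨h2, h1⟩] at h3
        omega
      refine Tight.false_of_dominated (A := flip A) hirr (stronglyConnected_flip hsc) hore.flip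
        hT.flip ?_ ?_ (by simpa using hQ) hu hv hx h2
      · rw [deg_flip]; exact hdu.1.ge
      · rw [deg_flip]; exact hdu.2.ge
  · push Not at hZ
    have hcyc := hT.cyc_two
    have hux : u ≠ x := by grind
    have hxc : x ∉ Q ++ [v] := by simp; grind
    have huc : u ∉ Q ++ [v] := by simp; grind
    refine pancyclic_or_balanced_of_two_missed hirr hsc hore hcyc ?_ hux huc hxc hdu.1.ge hd
    rw [← List.toFinset_card_of_nodup hcyc.1, ← Finset.card_univ]
    have : (univ : Finset V) = insert u (insert x (Q ++ [v]).toFinset) := by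
      ext y
      simp
      grind
    rw [this, Finset.card_insert_of_notMem, Finset.card_insert_of_notMem]
    · rw [List.mem_toFinset]; exact hxc
    · simp only [Finset.mem_insert, List.mem_toFinset, not_or]
      exact ⟨hux, huc⟩

end

/-- `S` is closed under predecessors in the digraph with the vertex `v` deleted, and witnesses that
this digraph is not strong. -/
structure IsCut (A : V → V → Prop) (v : V) (S : Set V) : Prop where
  notMem : v ∉ S
  nonempty : ∃ a, a ∈ S
  nonempty_compl : ∃ b, b ∉ S ∧ b ≠ v
  pred : ∀ a b, A a b → b ∈ S → a ∈ S ∨ a = v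

theorem exists_isCut {v : V} (h : ¬ StrongOff A {v}) : ∃ S, IsCut A v S := by
  unfold StrongOff at h
  push Not at h
  obtain ⟨u, w, hu, hw, huw⟩ := h
  rw [Finset.mem_singleton] at hu hw
  refine ⟨{y | y ≠ v ∧ Relation.ReflTransGen (offArc A {v}) y w}, fun h => h.1 rfl, ⟨w, hw, .refl⟩,
    ⟨u, fun h => huw h.2, hu⟩, fun a b hab hb => ?_⟩
  by_cases hav : a = v
  · exact Or.inr hav
  · exact Or.inl ⟨hav, .head ⟨hab, by simpa using hav, by simpa using hb.1⟩ hb.2⟩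

theorem IsCut.flip {v : V} {S : Set V} (h : IsCut A v S) :
    IsCut (flip A) v {b | b ∉ S ∧ b ≠ v} where
  notMem := fun hv => hv.2 rfl
  nonempty := h.nonempty_compl
  nonempty_compl := by
    obtain ⟨a, ha⟩ := h.nonempty
    exact ⟨a, fun hh => hh.1 ha, by rintro rfl; exact h.notMem ha⟩
  pred := fun a b hab hb => by
    by_cases hav : a = v
    · exact Or.inr hav
    · refine Or.inl ⟨fun ha => ?_, hav⟩
      rcases h.pred b a hab ha with h1 | h1
      · exact hb.1 h1
      · exact hb.2 h1

theorem eq_empty_of_pred_closed (hsc : StronglyConnected A) {S : Set V}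
    (hS : ∀ a b, A a b → b ∈ S → a ∈ S) {x : V} (hx : x ∉ S) (a : V) : a ∉ S := by
  intro ha
  have := hsc x a
  induction this using Relation.ReflTransGen.head_induction_on with
  | refl => exact hx ha
  | head h1 h2 ih => exact ih (fun hh => hx (hS _ _ h1 hh))

theorem IsCut.mem_or_mem [Fintype V] (hirr : ∀ v, ¬ A v v) (hsc : StronglyConnected A)
    (hore : Ore A) {x y : V} {S T : Set V} (hS : IsCut A x S) (hT : IsCut A y T) (hxy : x ≠ y) :
    y ∈ S ∨ x ∈ T := by
  by_contra! hcon
  obtain ⟨hyS, hxT⟩ := hcon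
  have hdisj : ∀ p, p ∈ S → p ∉ T := fun p h1 h2 =>
    eq_empty_of_pred_closed hsc (S := S ∩ T) (x := x) (by
      rintro a b hab ⟨hb1, hb2⟩
      have g1 := hS.pred a b hab hb1
      have g2 := hT.pred a b hab hb2
      refine ⟨g1.resolve_right ?_, g2.resolve_right ?_⟩
      · rintro rfl; tauto
      · rintro rfl; have := g1.resolve_left hyS; exact hxy this.symm) (fun h => hS.notMem h.1) p
      ⟨h1, h2⟩
  obtain ⟨a, ha⟩ := hS.nonempty
  obtain ⟨b, hb⟩ := hT.nonempty
  have hST : ∀ p q, p ∈ S → q ∈ T → ¬ A p q := fun p q hp hq hpq => by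
    rcases hT.pred p q hpq hq with h | rfl
    · exact hdisj p hp h
    · exact hyS hp
  have hTS : ∀ p q, p ∈ S → q ∈ T → ¬ A q p := fun p q hp hq hpq => by
    rcases hS.pred q p hpq hp with h | rfl
    · exact hdisj q h hq
    · exact hxT hq
  have hab : a ≠ b := by rintro rfl; exact hdisj a ha hb
  have hxb : ¬ A x b := fun h => by have := hT.pred x b h hb; tauto
  have hya : ¬ A y a := fun h => by have := hS.pred y a h ha; have := hxy.symm; tauto
  have hpt : ∀ w, arcs A a w + arcs A b w + ((if w = a then 2 else 0) + (if w = b then 2 else 0)) ≤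
      2 + ((if w = x then 1 else 0) + (if w = y then 1 else 0)) := by
    intro w
    have hle1 := arcs_le A a w
    have hle2 := arcs_le A b w
    by_cases hwa : w = a
    · subst hwa
      have h1 : arcs A w w = 0 := arcs_eq_zero.2 ⟨hirr w, hirr w⟩
      have h2 : arcs A b w = 0 := arcs_eq_zero.2 ⟨hTS _ _ ha hb, hST _ _ ha hb⟩
      simp only [h1, h2, if_true, if_neg hab]
      omega
    by_cases hwb : w = b
    · subst hwb
      have h1 : arcs A w w = 0 := arcs_eq_zero.2 ⟨hirr w, hirr w⟩
      have h2 : arcs A a w = 0 := arcs_eq_zero.2 ⟨hST _ _ ha hb, hTS _ _ ha hb⟩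
      simp only [h1, h2, if_true, if_neg hwa]
      omega
    rw [if_neg hwa, if_neg hwb]
    have e1 : ¬ A w a → arcs A a w ≤ 1 := fun h => by
      by_contra! h'
      exact h ((arcs_eq_two (A := A)).1 (by omega : arcs A a w = 2)).2
    have e2 : ¬ A w b → arcs A b w ≤ 1 := fun h => by
      by_contra! h'
      exact h ((arcs_eq_two (A := A)).1 (by omega : arcs A b w = 2)).2
    by_cases hwx : w = x
    · subst hwx
      have := e2 hxb
      simp only [if_true]; omega
    by_cases hwy : w = y
    · subst hwy
      have := e1 hya
      simp only [if_true]; omega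
    by_cases hwS : w ∈ S
    · have h2 : arcs A b w = 0 := arcs_eq_zero.2 ⟨hTS _ _ hwS hb, hST _ _ hwS hb⟩
      omega
    by_cases hwT : w ∈ T
    · have h2 : arcs A a w = 0 := arcs_eq_zero.2 ⟨hST _ _ ha hwT, hTS _ _ ha hwT⟩
      omega
    have := e1 (fun h => by have := hS.pred w a h ha; tauto)
    have := e2 (fun h => by have := hT.pred w b h hb; tauto)
    omega
  have hsum := Finset.sum_le_sum (s := univ) fun w _ => hpt w
  have := hore a b hab (hST _ _ ha hb) (hTS _ _ ha hb)
  rw [deg_eq_sum, deg_eq_sum] at this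
  simp only [Finset.sum_add_distrib, Finset.sum_ite_eq', mem_univ, if_true, Finset.sum_const,
    smul_eq_mul, Finset.card_univ] at hsum
  omega

theorem IsCut.mem_iff [Fintype V] (hirr : ∀ v, ¬ A v v) (hsc : StronglyConnected A)
    (hore : Ore A) {x y : V} {S T : Set V} (hS : IsCut A x S) (hT : IsCut A y T) (hxy : x ≠ y) :
    y ∈ S ↔ x ∉ T := by
  have h1 := hS.mem_or_mem hirr hsc hore hT hxy
  have h2 := IsCut.mem_or_mem (A := _root_.flip A) hirr (stronglyConnected_flip hsc) hore.flip
    hS.flip hT.flip hxy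
  simp only [Set.mem_ofPred_eq] at h2
  tauto

theorem IsCut.not_mem_of_cyclic [Fintype V] (hirr : ∀ v, ¬ A v v)
    (hore : Ore A) {x y z : V} {S T R : Set V} (hS : IsCut A x S) (hT : IsCut A y T)
    (hR : IsCut A z R) (hxy : x ≠ y) (hyz : y ≠ z) (hzx : z ≠ x) (hyS : y ∈ S) (hzS : z ∉ S)
    (hzT : z ∈ T) (hxT : x ∉ T) (hxR : x ∈ R) (hyR : y ∉ R) {p : V} (hpx : p ≠ x)
    (hpz : p ≠ z) (hpT : p ∈ T) : p ∈ R := by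
  by_contra hpR
  have hpy : p ≠ y := by rintro rfl; exact hT.notMem hpT
  have h1 : ¬ A x p := fun h => by have := hT.pred x p h hpT; tauto
  have h2 : ¬ A p x := fun h => by have := hR.pred p x h hxR; tauto
  have hyx : ¬ A y x := fun h => by have := hR.pred y x h hxR; tauto
  have hxz : ¬ A x z := fun h => by have := hT.pred x z h hzT; tauto
  have hpt : ∀ w, arcs A w x + arcs A w p + ((if w = x then 2 else 0) + (if w = p then 2 else 0)) ≤
      2 + (if w = (if p ∈ S then y else z) then 1 else 0) := by
    intro w
    have hle1 := arcs_le A w x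
    have hle2 := arcs_le A w p
    by_cases hwx : w = x
    · subst hwx
      have h3 : arcs A w w = 0 := arcs_eq_zero.2 ⟨hirr w, hirr w⟩
      have h4 : arcs A w p = 0 := arcs_eq_zero.2 ⟨h1, h2⟩
      rw [h3, h4, if_pos rfl, if_neg hpx.symm]
      omega
    by_cases hwp : w = p
    · subst hwp
      have h3 : arcs A w w = 0 := arcs_eq_zero.2 ⟨hirr w, hirr w⟩
      have h4 : arcs A w x = 0 := arcs_eq_zero.2 ⟨h2, h1⟩
      rw [h3, h4, if_pos rfl, if_neg hpx]
      omega
    rw [if_neg hwx, if_neg hwp]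
    have e1 : ¬ (A w x ∧ A x w) → arcs A w x ≤ 1 := fun h => by
      by_contra! h'
      exact h ((arcs_eq_two (A := A)).1 (by omega : arcs A w x = 2))
    have e2 : ¬ (A w p ∧ A p w) → arcs A w p ≤ 1 := fun h => by
      by_contra! h'
      exact h ((arcs_eq_two (A := A)).1 (by omega : arcs A w p = 2))
    by_cases hwy : w = y
    · subst hwy
      have h3 := e1 (fun h => hyx h.1)
      by_cases hpS : p ∈ S
      · rw [if_pos hpS, if_pos rfl]; omega
      · have := e2 (fun h => by have := hS.pred p w h.2 hyS; tauto)
        omega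
    by_cases hwz : w = z
    · subst hwz
      have h3 := e1 (fun h => hxz h.2)
      by_cases hpS : p ∈ S
      · have := e2 (fun h => by have := hS.pred w p h.1 hpS; tauto)
        omega
      · rw [if_neg hpS, if_pos rfl]; omega
    have := arcs_add_arcs_le (A := A) (y := w) (z := x) (w := p)
      (by
        rintro ⟨g1, g2⟩
        have g3 := (hT.pred w p g2 hpT).resolve_right hwy
        have := hT.pred x w g1 g3
        tauto)
      (by
        rintro ⟨g1, g2⟩
        have g3 := (hR.pred w x g2 hxR).resolve_right hwz
        have := hR.pred p w g1 g3
        tauto)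
    omega
  have hsum := Finset.sum_le_sum (s := univ) fun w _ => hpt w
  have := hore x p hpx.symm h1 h2
  rw [deg_eq_sum, deg_eq_sum] at this
  simp only [Finset.sum_add_distrib, Finset.sum_ite_eq', mem_univ, if_true, Finset.sum_const,
    smul_eq_mul, Finset.card_univ, arcs_comm A _ x, arcs_comm A _ p] at hsum
  omega

theorem IsCut.not_cyclic [Fintype V] (hirr : ∀ v, ¬ A v v) (hsc : StronglyConnected A)
    (hore : Ore A) (hV : 4 ≤ Fintype.card V) {x y z : V} {S T R : Set V} (hS : IsCut A x S)
    (hT : IsCut A y T) (hR : IsCut A z R) (hxy : x ≠ y) (hyz : y ≠ z) (hzx : z ≠ x)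
    (hyS : y ∈ S) (hzT : z ∈ T) : x ∉ R := by
  intro hxR
  have hzS : z ∉ S := (hR.mem_iff hirr hsc hore hS hzx).1 hxR
  have hxT : x ∉ T := (hS.mem_iff hirr hsc hore hT hxy).1 hyS
  have hyR : y ∉ R := (hT.mem_iff hirr hsc hore hR hyz).1 hzT
  obtain ⟨p, hp⟩ : ∃ p, p ∉ ({x, y, z} : Finset V) := by
    by_contra! h
    have h1 := Finset.card_le_three (a := x) (b := y) (c := z)
    rw [Finset.eq_univ_of_forall h, Finset.card_univ] at h1
    omega
  simp only [Finset.mem_insert, Finset.mem_singleton, not_or] at hp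
  obtain ⟨hpx, hpy, hpz⟩ := hp
  have g1 := hS.not_mem_of_cyclic hirr hore hT hR hxy hyz hzx hyS hzS hzT hxT hxR hyR
    hpx hpz
  have g2 := hT.not_mem_of_cyclic hirr hore hR hS hyz hzx hxy hzT hxT hxR hyR hyS hzS
    hpy hpx
  have g3 := hR.not_mem_of_cyclic hirr hore hS hT hzx hxy hyz hxR hyR hyS hzS hzT hxT
    hpz hpy
  have k1 := eq_empty_of_pred_closed hsc (S := S ∩ T ∩ R) (x := x) (by
      rintro a b hab ⟨⟨hb1, hb2⟩, hb3⟩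
      have g1 := hS.pred a b hab hb1
      have g2 := hT.pred a b hab hb2
      have g3 := hR.pred a b hab hb3
      refine ⟨⟨g1.resolve_right ?_, g2.resolve_right ?_⟩, g3.resolve_right ?_⟩
      · rintro rfl; tauto
      · rintro rfl; tauto
      · rintro rfl; tauto) (fun h => hxT h.1.2) p
  have k2 := eq_empty_of_pred_closed (A := _root_.flip A) (stronglyConnected_flip hsc)
    (S := {p | p ∉ S ∧ p ∉ T ∧ p ∉ R}) (x := x) (by
      rintro a b hab ⟨hb1, hb2, hb3⟩
      refine ⟨fun h => ?_, fun h => ?_, fun h => ?_⟩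
      · have := hS.pred b a hab h
        rcases this.resolve_left hb1 with rfl
        exact hb3 hxR
      · have := hT.pred b a hab h
        rcases this.resolve_left hb2 with rfl
        exact hb1 hyS
      · have := hR.pred b a hab h
        rcases this.resolve_left hb3 with rfl
        exact hb2 hzT) (fun h => h.2.2 hxR) p
  by_cases q1 : p ∈ S <;> by_cases q2 : p ∈ T <;> by_cases q3 : p ∈ R
  all_goals first | exact k1 ⟨⟨q1, q2⟩, q3⟩ | exact k2 ⟨q1, q2, q3⟩ | tauto

/-- The vertices joined to `v` by arcs in both directions. -/
noncomputable def twin [Fintype V] (A : V → V → Prop) (v : V) : Finset V :=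
  univ.filter fun w => A v w ∧ A w v

/-- The vertices other than `v` which are not adjacent to `v`. -/
noncomputable def nonAdj [Fintype V] (A : V → V → Prop) (v : V) : Finset V :=
  univ.filter fun w => w ≠ v ∧ ¬ A v w ∧ ¬ A w v

theorem mem_twin [Fintype V] {v w : V} : w ∈ twin A v ↔ A v w ∧ A w v := by simp [twin]

theorem mem_nonAdj [Fintype V] {v w : V} :
    w ∈ nonAdj A v ↔ w ≠ v ∧ ¬ A v w ∧ ¬ A w v := by simp [nonAdj]

theorem deg_add_card_nonAdj [Fintype V] (hirr : ∀ v, ¬ A v v) (v : V) :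
    deg A v + (nonAdj A v).card + 1 = Fintype.card V + (twin A v).card := by
  have hpt : ∀ w, arcs A v w + (if w ≠ v ∧ ¬ A v w ∧ ¬ A w v then 1 else 0) +
      (if w = v then 1 else 0) = 1 + (if A v w ∧ A w v then 1 else 0) := by
    intro w
    by_cases hwv : w = v
    · subst hwv
      simp [arcs, ar, hirr]
    · by_cases h1 : A v w <;> by_cases h2 : A w v <;> simp [arcs, ar, hwv, h1, h2]
  have hsum := Finset.sum_congr (s₁ := univ) rfl fun w _ => hpt w
  rw [Finset.sum_add_distrib, Finset.sum_add_distrib, Finset.sum_add_distrib, ← deg_eq_sum,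
    Finset.sum_ite_eq', if_pos (mem_univ _), ← Finset.card_filter, ← Finset.card_filter,
    Finset.sum_const, Finset.card_univ, smul_eq_mul, mul_one] at hsum
  exact hsum

/-- If every vertex of large degree is a cut vertex, then some vertex which is not a cut vertex is
joined to each other vertex by exactly one arc. -/
theorem exists_removable [Fintype V] (hirr : ∀ v, ¬ A v v) (hsc : StronglyConnected A)
    (hore : Ore A) (hV : 4 ≤ Fintype.card V)
    (hcut : ∀ v, Fintype.card V ≤ deg A v → ¬ StrongOff A {v})
    (hhigh : ∃ v, Fintype.card V ≤ deg A v) :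
    ∃ g, StrongOff A {g} ∧ ∀ w, w ≠ g → (A g w ↔ ¬ A w g) := by
  have hS : ∀ v, ∃ S, ¬ StrongOff A {v} → IsCut A v S := fun v => by
    by_cases h : StrongOff A {v}
    · exact ⟨∅, fun h' => absurd h h'⟩
    · obtain ⟨S, hS⟩ := exists_isCut h
      exact ⟨S, fun _ => hS⟩
  choose S hS using hS
  set C : Finset V := univ.filter fun v => ¬ StrongOff A {v} with hC
  replace hS : ∀ v ∈ C, IsCut A v (S v) := fun v hv => hS v (by simpa [hC] using hv)
  have htour : ∀ x ∈ C, ∀ y ∈ C, x ≠ y → (y ∈ S x ↔ x ∉ S y) := fun x hx y hy hxy =>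
    (hS x hx).mem_iff hirr hsc hore (hS y hy) hxy
  have htrans : ∀ x ∈ C, ∀ y ∈ C, ∀ z ∈ C, y ∈ S x → z ∈ S y → z ∈ S x := by
    intro x hx y hy z hz hyx hzy
    have hxy : x ≠ y := by rintro rfl; exact (hS x hx).notMem hyx
    have hyz : y ≠ z := by rintro rfl; exact (hS y hy).notMem hzy
    have hzx : z ≠ x := by rintro rfl; exact (htour z hx y hy hxy).1 hyx hzy
    rw [htour x hx z hz hzx.symm]
    exact (hS x hx).not_cyclic hirr hsc hore hV (hS y hy) (hS z hz) hxy hyz hzx hyx hzy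
  set H : Finset V := univ.filter fun v => Fintype.card V ≤ deg A v with hH
  have hHC : H ⊆ C := fun v hv => by
    simp only [hH, hC, Finset.mem_filter, mem_univ, true_and] at hv ⊢
    exact hcut v hv
  -- a cut vertex `M` such that `S M` contains no cut vertex
  obtain ⟨M, hMC, hM⟩ : ∃ M ∈ C, ∀ y ∈ C, y ∉ S M := by
    obtain ⟨v, hv⟩ := hhigh
    obtain ⟨M, hMC, hM⟩ := Finset.exists_max_image C (fun v => (C.filter fun k => v ∈ S k).card)
      ⟨v, hHC (by simpa [hH] using hv)⟩
    refine ⟨M, hMC, fun y hy hyM => (hM y hy).not_gt (Finset.card_lt_card ?_)⟩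
    refine (Finset.ssubset_iff_of_subset fun k hk => ?_).2 ⟨M, ?_, ?_⟩
    · simp only [Finset.mem_filter] at hk ⊢
      exact ⟨hk.1, htrans k hk.1 M hMC y hy hk.2 hyM⟩
    · simpa using ⟨hMC, hyM⟩
    · simpa using fun _ => (hS M hMC).notMem
  -- each cut vertex has few twins which are cut vertices
  have hbefore : ∀ h ∈ C, ((twin A h ∩ H).filter fun y => y ∈ S h).card ≤ 1 := by
    intro h hh
    have key : ∀ y₁ ∈ C, ∀ y₂ ∈ C, y₁ ∈ S h → A h y₂ → h ≠ y₁ → y₂ ∉ S y₁ := by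
      intro y₁ h₁ y₂ h₂ g1 g2 hne g3
      rcases (hS y₁ h₁).pred h y₂ g2 g3 with g4 | g4
      · exact (htour h hh y₁ h₁ hne).1 g1 g4
      · exact hne g4
    rw [Finset.card_le_one]
    intro y₁ hy₁ y₂ hy₂
    simp only [Finset.mem_filter, Finset.mem_inter, mem_twin] at hy₁ hy₂
    by_contra hne
    have n1 : h ≠ y₁ := by rintro rfl; exact (hS h hh).notMem hy₁.2
    have n2 : h ≠ y₂ := by rintro rfl; exact (hS h hh).notMem hy₂.2
    have k1 := key y₁ (hHC hy₁.1.2) y₂ (hHC hy₂.1.2) hy₁.2 hy₂.1.1.1 n1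
    have k2 := key y₂ (hHC hy₂.1.2) y₁ (hHC hy₁.1.2) hy₂.2 hy₁.1.1.1 n2
    exact k1 ((htour _ (hHC hy₁.1.2) _ (hHC hy₂.1.2) hne).2 k2)
  have hafter : ∀ h ∈ C, ((twin A h ∩ H).filter fun y => y ∉ S h).card ≤ 1 := by
    intro h hh
    have key : ∀ y₁ ∈ C, ∀ y₂ ∈ C, y₂ ∉ S h → A y₁ h → h ≠ y₂ → y₁ ≠ y₂ → y₁ ∈ S y₂ := by
      intro y₁ h₁ y₂ h₂ g1 g2 hne hne'
      have g3 : h ∈ S y₂ := (htour y₂ h₂ h hh hne.symm).2 g1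
      exact ((hS y₂ h₂).pred y₁ h g2 g3).resolve_right hne'
    rw [Finset.card_le_one]
    intro y₁ hy₁ y₂ hy₂
    simp only [Finset.mem_filter, Finset.mem_inter, mem_twin] at hy₁ hy₂
    by_contra hne
    have n1 : h ≠ y₁ := by rintro rfl; exact hirr _ hy₁.1.1.1
    have n2 : h ≠ y₂ := by rintro rfl; exact hirr _ hy₂.1.1.1
    have k1 := key y₁ (hHC hy₁.1.2) y₂ (hHC hy₂.1.2) hy₂.2 hy₁.1.1.2 n2 hne
    have k2 := key y₂ (hHC hy₂.1.2) y₁ (hHC hy₁.1.2) hy₁.2 hy₂.1.1.2 n1 (Ne.symm hne)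
    exact (htour _ (hHC hy₁.1.2) _ (hHC hy₂.1.2) hne).1 k2 k1
  have htwo : ∀ h ∈ C, (twin A h ∩ H).card ≤ 2 := fun h hh => by
    rw [← Finset.card_filter_add_card_filter_not (s := twin A h ∩ H) (fun y => y ∈ S h)]
    have := hbefore h hh
    have := hafter h hh
    omega
  have htwoM : (twin A M ∩ H).card ≤ 1 := by
    have := hafter M hMC
    rwa [Finset.filter_true_of_mem] at this
    intro y hy
    exact hM y (hHC (Finset.mem_inter.1 hy).2)
  -- counting pairs of vertices of large and small degree
  have hlow : ∀ l ∉ H, deg A l + 1 ≤ Fintype.card V := fun l hl => by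
    simp only [hH, Finset.mem_filter, mem_univ, true_and] at hl
    omega
  set X : Finset V := H.filter fun h => ∃ l, l ∉ H ∧ l ∈ nonAdj A h with hX
  have hsymN : ∀ a b, a ∈ nonAdj A b ↔ b ∈ nonAdj A a := fun a b => by
    simp only [mem_nonAdj, ne_comm (a := a)]; tauto
  have hsymT : ∀ a b, a ∈ twin A b ↔ b ∈ twin A a := fun a b => by
    simp only [mem_twin]; tauto
  have hNX : ∀ l, l ∉ H → nonAdj A l ⊆ X := by
    intro l hl h hh
    have h1 := mem_nonAdj.1 hh
    have h2 := hore l h h1.1.symm h1.2.1 h1.2.2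
    have h3 := hlow l hl
    simp only [hX, Finset.mem_filter]
    refine ⟨?_, l, hl, (hsymN _ _).1 hh⟩
    by_contra h4
    have := hlow h h4
    omega
  have hXtwin : ∀ h ∈ X, (nonAdj A h).card + 2 ≤ (twin A h).card := by
    intro h hh
    simp only [hX, Finset.mem_filter] at hh
    obtain ⟨-, l, hl, hhl⟩ := hh
    have h1 := mem_nonAdj.1 hhl
    have h2 := hore h l h1.1.symm h1.2.1 h1.2.2
    have h3 := hlow l hl
    have h4 := deg_add_card_nonAdj hirr h
    omega
  have hXC : X ⊆ C := (Finset.filter_subset _ _).trans hHC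
  have hle1 : ∀ h ∈ X, (nonAdj A h \ H).card ≤ (twin A h \ H).card := by
    intro h hh
    have h1 := hXtwin h hh
    have h2 := htwo h (hXC hh)
    have h3 := Finset.card_sdiff_add_card_inter (twin A h) H
    have h4 := Finset.card_le_card (Finset.sdiff_subset : nonAdj A h \ H ⊆ nonAdj A h)
    omega
  have hle2 : ∀ l ∈ univ \ H, (twin A l ∩ X).card ≤ (nonAdj A l).card := by
    intro l hl
    simp only [Finset.mem_sdiff, mem_univ, true_and] at hl
    have h1 := Finset.card_le_card (Finset.inter_subset_left : twin A l ∩ X ⊆ twin A l)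
    have h2 := deg_add_card_nonAdj hirr l
    have h3 := hlow l hl
    omega
  have hdc : ∀ f : V → Finset V, (∀ a b, a ∈ f b ↔ b ∈ f a) →
      ∑ h ∈ X, (f h \ H).card = ∑ l ∈ univ \ H, (f l ∩ X).card := by
    intro f hf
    have := Finset.sum_card_bipartiteAbove_eq_sum_card_bipartiteBelow (s := X) (t := univ \ H)
      (fun a b => b ∈ f a)
    convert this using 2 with a ha a ha
    · congr 1; ext b; simp [Finset.bipartiteAbove, and_comm]
    · congr 1; ext b; simp [Finset.bipartiteBelow, and_comm, hf]
  have hd1 := hdc _ hsymN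
  have hd2 := hdc _ hsymT
  have hd3 : ∑ l ∈ univ \ H, (nonAdj A l ∩ X).card = ∑ l ∈ univ \ H, (nonAdj A l).card :=
    Finset.sum_congr rfl fun l hl => by
      rw [Finset.inter_eq_left.2 (hNX l (by simpa using hl))]
  have hs1 := Finset.sum_le_sum hle1
  have hs2 := Finset.sum_le_sum hle2
  have heq1 := (Finset.sum_eq_sum_iff_of_le hle1).1 (by omega)
  have heq2 := (Finset.sum_eq_sum_iff_of_le hle2).1 (by omega)
  -- a vertex of `S M`
  obtain ⟨g, hg⟩ := (hS M hMC).nonempty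
  have hgC : g ∉ C := fun h => hM g h hg
  have hgH : g ∉ H := fun h => hgC (hHC h)
  have hgX : twin A g ∩ X = ∅ := by
    rw [Finset.eq_empty_iff_forall_notMem]
    intro w hw
    simp only [Finset.mem_inter, mem_twin] at hw
    rcases (hS M hMC).pred w g hw.1.2 hg with h | rfl
    · exact hM w (hXC hw.2) h
    · have h1 := hXtwin w hw.2
      have h2 := heq1 w hw.2
      have h3 := Finset.card_sdiff_add_card_inter (twin A w) H
      have h4 := Finset.card_le_card (Finset.sdiff_subset : nonAdj A w \ H ⊆ nonAdj A w)
      omega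
  have hgN := heq2 g (by simpa using hgH)
  rw [hgX, Finset.card_empty] at hgN
  have hgT : (twin A g).card = 0 := by
    have h2 := deg_add_card_nonAdj hirr g
    have h3 := hlow g hgH
    omega
  rw [Finset.card_eq_zero] at hgT
  replace hgN := Finset.card_eq_zero.1 hgN.symm
  refine ⟨g, by simpa [hC] using hgC, fun w hw => ?_⟩
  have h1 : w ∉ twin A g := by rw [hgT]; simp
  have h2 : w ∉ nonAdj A g := by rw [hgN]; simp
  rw [mem_twin] at h1
  rw [mem_nonAdj] at h2
  tauto

theorem exists_alternating_wk (j : ℕ) : ∀ X Y : Finset V, Disjoint X Y →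
    (∀ x ∈ X, ∀ y ∈ Y, A x y ∧ A y x) → j + 1 ≤ X.card → j + 1 ≤ Y.card → ∀ a ∈ X, ∀ b ∈ Y,
    ∃ l, Wk A b l a ∧ l.Nodup ∧ l.length = 2 * (j + 1) ∧ ∀ y ∈ l, y ∈ X ∨ y ∈ Y := by
  induction j with
  | zero =>
    intro X Y hd hXY _ _ a ha b hb
    refine ⟨[b, a], (Wk.single a).cons (hXY a ha b hb).2, ?_, rfl, ?_⟩
    · simp only [List.nodup_cons, List.mem_singleton, List.not_mem_nil, not_false_eq_true,
        List.nodup_nil, and_true]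
      rintro rfl
      exact Finset.disjoint_left.1 hd ha hb
    · simp only [List.mem_cons, List.not_mem_nil, or_false, forall_eq_or_imp, forall_eq]
      exact ⟨Or.inr hb, Or.inl ha⟩
  | succ j ih =>
    intro X Y hd hXY hX hY a ha b hb
    obtain ⟨x, hx, hxa⟩ := Finset.exists_mem_ne (by omega : 1 < X.card) a
    obtain ⟨y, hy, hyb⟩ := Finset.exists_mem_ne (by omega : 1 < Y.card) b
    obtain ⟨l, h1, h2, h3, h4⟩ := ih (X.erase x) (Y.erase b)
      (hd.mono (Finset.erase_subset _ _) (Finset.erase_subset _ _))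
      (fun x hx y hy => hXY x (Finset.mem_of_mem_erase hx) y (Finset.mem_of_mem_erase hy))
      (by rw [Finset.card_erase_of_mem hx]; omega) (by rw [Finset.card_erase_of_mem hb]; omega)
      a (Finset.mem_erase.2 ⟨hxa.symm, ha⟩) y (Finset.mem_erase.2 ⟨hyb, hy⟩)
    have hxY := Finset.disjoint_left.1 hd hx
    have hbX := Finset.disjoint_right.1 hd hb
    refine ⟨b :: x :: l, (h1.cons (hXY x hx y hy).1).cons (hXY x hx b hb).2, ?_, ?_, ?_⟩
    · simp only [List.nodup_cons, List.mem_cons, not_or]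
      refine ⟨⟨by rintro rfl; exact hxY hb, fun h => ?_⟩, fun h => ?_, h2⟩
      · rcases h4 _ h with h | h
        · exact hbX (Finset.mem_of_mem_erase h)
        · exact Finset.notMem_erase _ _ h
      · rcases h4 _ h with h | h
        · exact Finset.notMem_erase _ _ h
        · exact hxY (Finset.mem_of_mem_erase h)
    · simp only [List.length_cons, h3]; ring
    · intro z hz
      rcases List.mem_cons.1 hz with rfl | hz
      · exact Or.inr hb
      rcases List.mem_cons.1 hz with rfl | hz
      · exact Or.inl hx
      exact (h4 z hz).imp Finset.mem_of_mem_erase Finset.mem_of_mem_erase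

theorem pancyclic_of_bipartite_add_vertex [Fintype V] {X Y : Finset V} (hd : Disjoint X Y)
    (hXY : ∀ x ∈ X, ∀ y ∈ Y, A x y ∧ A y x) {k : ℕ} (hX : X.card = k) (hY : Y.card = k)
    (hV : Fintype.card V = 2 * k + 1) {a b g : V} (ha : a ∈ X) (hb : b ∈ Y) (hag : A a g)
    (hgb : A g b) (hgX : g ∉ X) (hgY : g ∉ Y) : Pancyclic A := by
  intro l hl hl'
  obtain ⟨j, hj⟩ : ∃ j, l = 2 * (j + 1) ∨ l = 2 * (j + 1) + 1 := ⟨l / 2 - 1, by omega⟩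
  obtain ⟨c, h1, h2, h3, h4⟩ := exists_alternating_wk j X Y hd hXY (by omega) (by omega) a ha b hb
  rcases hj with rfl | rfl
  · have : Cyc A c := Cyc.mk h1 (hXY a ha b hb).1 h2
    exact h3 ▸ this.hasCycle
  · have : Cyc A (g :: c) := Cyc.mk (h1.cons hgb) hag
      (List.nodup_cons.2 ⟨fun h => (h4 g h).elim hgX hgY, h2⟩)
    have := this.hasCycle
    rwa [List.length_cons, h3] at this

theorem pancyclic_of_isBalancedComplete_erase [Fintype V] (hsc : StronglyConnected A) {g : V}
    (hg : ∀ w, w ≠ g → (A g w ↔ ¬ A w g)) (hV : 3 ≤ Fintype.card V)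
    (h : IsBalancedComplete fun a b : {v // v ≠ g} => A a b) : Pancyclic A := by
  obtain ⟨he, X, Y, hX, hY, hd, hu, hA⟩ := h
  have hcard : Fintype.card {v // v ≠ g} + 1 = Fintype.card V := by
    have := Fintype.card_subtype_compl (fun v => v = g)
    rw [Fintype.card_subtype_eq] at this
    have h2 : Fintype.card {v // v ≠ g} = Fintype.card {v // ¬ v = g} := rfl
    omega
  obtain ⟨k, hk⟩ := he
  have hk' : Fintype.card {v // v ≠ g} / 2 = k := by omega
  rw [hk'] at hX hY
  have hmain : ∀ X Y : Set {v // v ≠ g}, X.ncard = k → Y.ncard = k → Disjoint X Y →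
      (∀ u v : {v // v ≠ g}, A u v ↔ (u ∈ X ∧ v ∈ Y) ∨ (u ∈ Y ∧ v ∈ X)) →
      ∀ a ∈ X, ∀ b ∈ Y, A a g → A g b → Pancyclic A := by
    intro X Y hX hY hd hA a ha b hb hag hgb
    refine pancyclic_of_bipartite_add_vertex (X := X.toFinset.map (Embedding.subtype _))
      (Y := Y.toFinset.map (Embedding.subtype _)) (k := k) (a := a) (b := b) (g := g) ?_ ?_ ?_ ?_
      (by omega) ?_ ?_ hag hgb ?_ ?_
    · rw [Finset.disjoint_map]
      simpa using hd
    · intro x hx y hy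
      simp only [Finset.mem_map, Set.mem_toFinset, Embedding.subtype_apply] at hx hy
      obtain ⟨x, hx, rfl⟩ := hx
      obtain ⟨y, hy, rfl⟩ := hy
      exact ⟨(hA x y).2 (Or.inl ⟨hx, hy⟩), (hA y x).2 (Or.inr ⟨hy, hx⟩)⟩
    · rw [Finset.card_map, ← hX, Set.ncard_eq_toFinset_card']
    · rw [Finset.card_map, ← hY, Set.ncard_eq_toFinset_card']
    · exact Finset.mem_map_of_mem _ (Set.mem_toFinset.2 ha)
    · exact Finset.mem_map_of_mem _ (Set.mem_toFinset.2 hb)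
    · simp
    · simp
  have hXne : X.Nonempty := by rw [← Set.ncard_pos]; omega
  have hYne : Y.Nonempty := by rw [← Set.ncard_pos]; omega
  obtain ⟨w, hw⟩ := hXne
  obtain ⟨i, hig⟩ : ∃ i : {v // v ≠ g}, A i g := by
    obtain ⟨a, ha, b, hb, hab⟩ := exists_first_exit (S := {v | v ≠ g}) (hsc w g) w.2
      (fun h => h rfl)
    obtain rfl : b = g := by_contra hb
    exact ⟨⟨a, ha⟩, hab⟩
  obtain ⟨o, hgo⟩ : ∃ o : {v // v ≠ g}, A g o := by
    obtain ⟨a, ha, b, hb, hab⟩ := exists_first_exit (S := {g}) (hsc g w) rfl w.2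
    obtain rfl : a = g := ha
    exact ⟨⟨b, hb⟩, hab⟩
  have hsides : ∀ v, v ∈ X ∨ v ∈ Y := fun v => by
    have : v ∈ X ∪ Y := by rw [hu]; trivial
    exact this
  have hgA : ∀ v : {v // v ≠ g}, A v g ∨ A g v := fun v => by
    have := hg v v.2
    tauto
  have hA' : ∀ u v : {v // v ≠ g}, A u v ↔ (u ∈ Y ∧ v ∈ X) ∨ (u ∈ X ∧ v ∈ Y) := fun u v =>
    (hA u v).trans or_comm
  obtain ⟨w', hw'⟩ := hYne
  rcases hsides i with hi | hi <;> rcases hsides o with ho | ho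
  · rcases hgA w' with h | h
    · exact hmain Y X hY hX hd.symm hA' _ hw' _ ho h hgo
    · exact hmain X Y hX hY hd hA _ hi _ hw' hig h
  · exact hmain X Y hX hY hd hA _ hi _ ho hig hgo
  · exact hmain Y X hY hX hd.symm hA' _ hi _ ho hig hgo
  · rcases hgA w with h | h
    · exact hmain X Y hX hY hd hA _ hw _ ho h hgo
    · exact hmain Y X hY hX hd.symm hA' _ hi _ hw hig h

theorem deg_erase [Fintype V] {g : V} (hg : ∀ w, w ≠ g → (A g w ↔ ¬ A w g)) (v : {v // v ≠ g}) :
    deg (fun a b : {v // v ≠ g} => A a b) v + 1 = deg A v := by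
  rw [deg_eq_sum, deg_eq_sum, Fintype.sum_eq_add_sum_subtype_ne _ g, add_comm]
  congr 1
  have := hg v v.2
  by_cases h : A v g <;> simp_all [arcs, ar]

theorem stronglyConnected_erase {g : V} (h : StrongOff A {g}) :
    StronglyConnected fun a b : {v // v ≠ g} => A a b := by
  intro u v
  have key : ∀ w, Relation.ReflTransGen (offArc A {g}) u w → ∀ hw : w ≠ g,
      Relation.ReflTransGen (fun a b : {v // v ≠ g} => A a b) u ⟨w, hw⟩ := by
    intro w hw
    induction hw with
    | refl => exact fun _ => .refl
    | tail _ h2 ih =>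
      intro hw
      have h3 := h2.2.1
      rw [Finset.mem_singleton] at h3
      exact (ih h3).tail h2.1
  exact key v (h u v (by simpa using u.2) (by simpa using v.2)) v.2

theorem pancyclic_or_tournament_or_balanced (n : ℕ) : ∀ (V : Type*) [Fintype V]
    (A : V → V → Prop), Fintype.card V = n → 3 ≤ n → (∀ v, ¬ A v v) → StronglyConnected A →
    Ore A → Pancyclic A ∨ (∀ u v : V, u ≠ v → (A u v ↔ ¬ A v u)) ∨ IsBalancedComplete A := by
  induction n with
  | zero => intros; omega
  | succ n ih =>
    intro V _ A hcard hn hirr hsc hore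
    by_cases hcomp : ∀ u v, u ≠ v → A u v ∨ A v u
    · by_cases htwo : ∃ u v, A u v ∧ A v u
      · obtain ⟨u, v, h1, h2⟩ := htwo
        exact Or.inl (pancyclic_of_semicomplete hirr hsc hcomp h1 h2)
      · push Not at htwo
        refine Or.inr (Or.inl fun u v huv => ⟨htwo u v, fun h => (hcomp u v huv).resolve_right h⟩)
    push Not at hcomp
    obtain ⟨u, v, huv, h1, h2⟩ := hcomp
    have hdeg := hore u v huv h1 h2
    have hhigh : ∃ v, Fintype.card V ≤ deg A v := by
      by_contra! h
      have := h u
      have := h v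
      omega
    have hsmall : ∀ u v, u ≠ v → ¬ A u v → ¬ A v u → deg A u + 4 ≤ 2 * Fintype.card V := by
      intro u v huv h1 h2
      have k1 := deg_add_card_nonAdj hirr u
      have k2 : (nonAdj A u).Nonempty := ⟨v, mem_nonAdj.2 ⟨huv.symm, h1, h2⟩⟩
      have k3 : (twin A u).card ≤ (univ \ {u, v}).card := by
        refine Finset.card_le_card fun w hw => ?_
        rw [mem_twin] at hw
        simp only [Finset.mem_sdiff, mem_univ, true_and, Finset.mem_insert, Finset.mem_singleton,
          not_or]
        exact ⟨by rintro rfl; exact h1.elim (absurd hw.1 (hirr _)), by rintro rfl; exact h1 hw.1⟩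
      have k4 := Finset.card_pair huv
      rw [Finset.card_sdiff_of_subset (Finset.subset_univ _), Finset.card_univ, k4] at k3
      have k5 := k2.card_pos
      have k6 : ({u, v} : Finset V).card ≤ Fintype.card V := Finset.card_le_univ _
      omega
    have hn4 : 4 ≤ Fintype.card V := by
      have := hsmall u v huv h1 h2
      have := hsmall v u huv.symm h2 h1
      omega
    by_cases hx : ∃ x, StrongOff A {x} ∧ Fintype.card V ≤ deg A x
    · obtain ⟨x, hx, hd⟩ := hx
      exact (pancyclic_or_balanced_of_strongOff hirr hsc hore (by omega) hx hd).imp_right Or.inr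
    push Not at hx
    obtain ⟨g, hg, hga⟩ := exists_removable hirr hsc hore hn4
      (fun v hv h => (hx v h).not_ge hv) hhigh
    have hcard' : Fintype.card {v // v ≠ g} = n := by
      have := Fintype.card_subtype_compl (fun v => v = g)
      rw [Fintype.card_subtype_eq] at this
      have h2 : Fintype.card {v // v ≠ g} = Fintype.card {v // ¬ v = g} := rfl
      omega
    rcases ih {v // v ≠ g} (fun a b => A a b) hcard' (by omega) (fun v => hirr v)
      (stronglyConnected_erase hg) (fun a b hab k1 k2 => by
        have h3 := hore a b (fun h => hab (Subtype.ext h)) k1 k2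
        rw [← deg_erase hga a, ← deg_erase hga b] at h3
        omega) with h | h | h
    · left
      intro l hl hl'
      rcases hl'.eq_or_lt with rfl | hl'
      · exact hasCycle_card hirr hsc hore hl
      · obtain ⟨f, hf, hfa⟩ := h l hl (by omega)
        exact ⟨fun i => f i, Subtype.val_injective.comp hf, hfa⟩
    · right; left
      intro a b hab
      by_cases ha : a = g
      · subst ha
        exact hga b hab.symm
      by_cases hb : b = g
      · subst hb
        have := hga a ha
        tauto
      exact h ⟨a, ha⟩ ⟨b, hb⟩ (fun h => hab (congrArg Subtype.val h))
    · exact Or.inl (pancyclic_of_isBalancedComplete_erase hsc hga (by omega) h)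

end

end Thomassen

/-- Thomassen: such a digraph is pancyclic, a tournament, or `K*_{n/2,n/2}`. -/
theorem stmt_9 {V : Type*} [Fintype V] (A : V → V → Prop) (n : ℕ)
    (hn : 3 ≤ n) (hcard : Fintype.card V = n)
    (hirr : ∀ v, ¬ A v v) (hsc : StronglyConnected A)
    (hdeg : ∀ u v : V, u ≠ v → ¬ A u v → ¬ A v u → 2 * n ≤ deg A u + deg A v) :
    Pancyclic A ∨
    (∀ u v : V, u ≠ v → (A u v ↔ ¬ A v u)) ∨
    (Even n ∧ ∃ X Y : Set V, X.ncard = n / 2 ∧ Y.ncard = n / 2 ∧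
      Disjoint X Y ∧ X ∪ Y = Set.univ ∧
      ∀ u v, A u v ↔ (u ∈ X ∧ v ∈ Y) ∨ (u ∈ Y ∧ v ∈ X)) := by
  subst hcard
  exact Thomassen.pancyclic_or_tournament_or_balanced _ V A rfl hn hirr hsc hdeg
end

section
/- Let D be a strongly connected balanced bipartite digraph of order 2a with a ≥ 3, and let k be an integer with max{1, a/4} < k ≤ a/2. Suppose for every dominating pair {u,v}: either d(u) ≥ 2a−k and d(v) ≥ a+k, or d(u) ≥ a+k and d(v) ≥ 2a−k. Then D is Hamiltonian. -/
open Finset Function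

variable {V : Type*}

section PermLemmas

open Equiv Classical

variable {V : Type*} [Fintype V]

/-- The number of ordered pairs of elements in a common cycle of `σ`. -/
noncomputable def sameCyclePairs (σ : Perm V) : ℕ :=
  #{p : V × V | σ.SameCycle p.1 p.2}

lemma sameCyclePairs_conj (σ τ : Perm V) :
    sameCyclePairs (τ * σ * τ⁻¹) = sameCyclePairs σ := by
  unfold sameCyclePairs
  refine card_bij' (fun p _ => (τ⁻¹ p.1, τ⁻¹ p.2)) (fun p _ => (τ p.1, τ p.2)) ?_ ?_ ?_ ?_ <;>
    simp [Perm.sameCycle_conj]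

/-- Composing with a transposition of two elements in distinct cycles joins these cycles. -/
lemma sameCycle_mul_swap_self {σ : Perm V} {u v : V} (h : ¬ σ.SameCycle u v) :
    (σ * swap u v).SameCycle u v := by
  have huv : u ≠ v := fun e => h (e ▸ Perm.SameCycle.refl σ u)
  have hex : ∃ n, 0 < n ∧ (σ ^ n) v = v :=
    ⟨orderOf σ, orderOf_pos σ, by simp [pow_orderOf_eq_one]⟩
  obtain ⟨hpos, hper⟩ := Nat.find_spec hex
  have key : ∀ n, n < Nat.find hex → ((σ * swap u v) ^ (n + 1)) u = (σ ^ (n + 1)) v := by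
    intro n
    induction n with
    | zero => simp
    | succ n ih =>
      intro hn
      have h1 : (σ ^ (n + 1)) v ≠ v := fun e => Nat.find_min hex hn ⟨n.succ_pos, e⟩
      have h2 : (σ ^ (n + 1)) v ≠ u := fun e =>
        h (Perm.SameCycle.symm ⟨((n + 1 : ℕ) : ℤ), by rw [zpow_natCast]; exact e⟩)
      rw [pow_succ', Perm.mul_apply, ih (by omega), pow_succ' σ (n + 1), Perm.mul_apply,
        Perm.mul_apply, swap_apply_of_ne_of_ne h2 h1]
  obtain ⟨m, hm⟩ : ∃ m, Nat.find hex = m + 1 := ⟨_, (Nat.succ_pred_eq_of_pos hpos).symm⟩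
  refine ⟨((m + 1 : ℕ) : ℤ), ?_⟩
  rw [zpow_natCast, key m (by omega), ← hm, hper]

lemma sameCycle_mul_swap_of_sameCycle {σ : Perm V} {u v x y : V} (h : ¬ σ.SameCycle u v)
    (hxy : σ.SameCycle x y) : (σ * swap u v).SameCycle x y := by
  have huv := sameCycle_mul_swap_self h
  have hstep : ∀ x, (σ * swap u v).SameCycle x (σ x) := by
    intro x
    by_cases hu : x = u
    · subst hu
      refine huv.trans ⟨1, ?_⟩
      simp
    by_cases hv : x = v
    · subst hv
      refine huv.symm.trans ⟨1, ?_⟩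
      simp
    · exact ⟨1, by simp [swap_apply_of_ne_of_ne hu hv]⟩
  have hpow : ∀ n : ℕ, (σ * swap u v).SameCycle x ((σ ^ n) x) := by
    intro n
    induction n with
    | zero => exact Perm.SameCycle.refl _ _
    | succ n ih =>
      rw [pow_succ', Perm.mul_apply]
      exact ih.trans (hstep _)
  obtain ⟨n, -, -, rfl⟩ := hxy.exists_pow_eq'
  exact hpow n

lemma sameCyclePairs_lt_mul_swap {σ : Perm V} {u v : V} (h : ¬ σ.SameCycle u v) :
    sameCyclePairs σ < sameCyclePairs (σ * swap u v) := by
  refine card_lt_card ⟨fun p hp => ?_, fun hsub => h ?_⟩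
  · simp only [mem_filter, mem_univ, true_and] at hp ⊢
    exact sameCycle_mul_swap_of_sameCycle h hp
  · simpa using hsub (show (u, v) ∈ _ by simpa using sameCycle_mul_swap_self h)

lemma isHamiltonian_of_sameCycle [Nonempty V] {A : V → V → Prop} {σ : Perm V}
    (hσ : ∀ v, A v (σ v)) (h : ∀ u v, σ.SameCycle u v) : IsHamiltonian A := by
  have hcyc : σ.IsCycleOn ((univ : Finset V) : Set V) :=
    ⟨by simp, fun u _ v _ => h u v⟩
  let v₀ : V := Classical.arbitrary V
  have : NeZero (Fintype.card V) := ⟨Fintype.card_ne_zero⟩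
  let f : ZMod (Fintype.card V) → V := fun i => (σ ^ i.val) v₀
  have heq : ∀ m n : ℕ, (σ ^ m) v₀ = (σ ^ n) v₀ ↔ m ≡ n [MOD Fintype.card V] := fun m n => by
    simpa using hcyc.pow_apply_eq_pow_apply (mem_univ v₀) (m := m) (n := n)
  have hinj : Injective f := fun i j hij => by
    have := (heq _ _).1 hij
    rw [← ZMod.natCast_eq_natCast_iff] at this
    simpa using this
  have hbij : Bijective f :=
    (Fintype.bijective_iff_injective_and_card f).2 ⟨hinj, ZMod.card _⟩
  refine ⟨Equiv.ofBijective f hbij, fun i => ?_⟩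
  have hsucc : f (i + 1) = σ (f i) := by
    have : (σ ^ (i + 1).val) v₀ = (σ ^ (i.val + 1)) v₀ := by
      rw [heq, ← ZMod.natCast_eq_natCast_iff]
      simp
    rw [pow_succ', Perm.mul_apply] at this
    exact this
  simp only [Equiv.ofBijective_apply, hsucc]
  exact hσ _

end PermLemmas

section Counting

open Classical

variable {V : Type*} {A : V → V → Prop}

/-- The number of arcs from `S` to `T`. -/
noncomputable def arcsFrom (A : V → V → Prop) (S T : Finset V) : ℕ :=
  ∑ u ∈ S, #{v ∈ T | A u v}

lemma arcsFrom_eq_sum_inNeighbors (S T : Finset V) :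
    arcsFrom A S T = ∑ v ∈ T, #{u ∈ S | A u v} :=
  sum_card_bipartiteAbove_eq_sum_card_bipartiteBelow A

lemma arcsFrom_le (S T : Finset V) : arcsFrom A S T ≤ #S * #T := by
  rw [← smul_eq_mul]
  exact sum_le_card_nsmul _ _ _ fun _ _ => card_filter_le _ _

lemma adj_of_arcsFrom_eq {S T : Finset V} (h : #S * #T ≤ arcsFrom A S T)
    {u v : V} (hu : u ∈ S) (hv : v ∈ T) : A u v := by
  by_contra hA
  have : arcsFrom A S T < ∑ _u ∈ S, #T := by
    refine sum_lt_sum (fun _ _ => card_filter_le _ _) ⟨u, hu, card_lt_card ?_⟩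
    exact ⟨filter_subset _ _, fun hs => hA (mem_filter.1 (hs hv)).2⟩
  rw [sum_const, smul_eq_mul] at this
  omega

/-- Few arcs leave `S` when `S` has many vertices with pairwise disjoint out-neighbourhoods. -/
lemma arcsFrom_add_le (S T : Finset V) (p : V → Prop)
    (h : ∀ u ∈ S, ∀ v ∈ S, p u → p v → u ≠ v → ∀ w, A u w → ¬ A v w) :
    arcsFrom A S T + #T * #{u ∈ S | p u} ≤ #S * #T + #T := by
  have h1 : ∑ u ∈ S with p u, #{v ∈ T | A u v} ≤ #T := by
    rw [← card_biUnion]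
    · exact card_le_card (biUnion_subset.2 fun _ _ => filter_subset _ _)
    · intro u hu v hv huv
      simp only [mem_coe, mem_filter] at hu hv
      refine Finset.disjoint_left.2 ?_
      intro w hw hw'
      exact h u hu.1 v hv.1 hu.2 hv.2 huv w (mem_filter.1 hw).2 (mem_filter.1 hw').2
  have h2 : ∑ u ∈ S with ¬ p u, #{v ∈ T | A u v} ≤ #{u ∈ S | ¬ p u} * #T := by
    rw [← smul_eq_mul]
    exact sum_le_card_nsmul _ _ _ fun _ _ => card_filter_le _ _
  have h3 := sum_filter_add_sum_filter_not S p fun u => #{v ∈ T | A u v}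
  have h4 := card_filter_add_card_filter_not (s := S) p
  unfold arcsFrom
  rw [← h3, ← h4]
  nlinarith

/-- If no two arcs `u → σ v`, `v → σ u` with `u ∈ P`, `v ∈ P'` coexist, then there are few arcs
between the two parts. -/
lemma arcsFrom_add_arcsFrom_le (σ : Equiv.Perm V) (P P' : Finset V)
    (h : ∀ u ∈ P, ∀ v ∈ P', A u (σ v) → ¬ A v (σ u)) :
    arcsFrom A P (P'.map σ.toEmbedding) + arcsFrom A P' (P.map σ.toEmbedding) ≤ #P * #P' := by
  have h1 : arcsFrom A P (P'.map σ.toEmbedding) = ∑ u ∈ P, #{v ∈ P' | A u (σ v)} := by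
    refine sum_congr rfl fun u _ => ?_
    rw [filter_map, card_map]
    rfl
  have h2 : arcsFrom A P' (P.map σ.toEmbedding) = ∑ u ∈ P, #{v ∈ P' | A v (σ u)} := by
    rw [arcsFrom_eq_sum_inNeighbors, sum_map]
    rfl
  rw [h1, h2, ← sum_add_distrib, ← smul_eq_mul]
  refine sum_le_card_nsmul _ _ _ fun u hu => ?_
  rw [← card_union_of_disjoint]
  · exact card_le_card (union_subset (filter_subset _ _) (filter_subset _ _))
  · rw [Finset.disjoint_left]
    intro v hv hv'
    simp only [mem_filter] at hv hv'
    exact h u hu v hv.1 hv.2 hv'.2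

lemma le_sum_add_card_filter_mul (S : Finset V) (d : V → ℕ) {l m : ℕ} (hlm : m ≤ l)
    (h : ∀ u ∈ S, m ≤ d u) :
    #S * l ≤ ∑ u ∈ S, d u + #{u ∈ S | d u < l} * (l - m) := by
  rw [card_filter, sum_mul, ← sum_add_distrib, ← smul_eq_mul, ← sum_const]
  refine sum_le_sum fun u hu => ?_
  have := h u hu
  split_ifs <;> omega

lemma extremal_of_counts {a k c p q e₁ e₂ D r : ℕ} (hk1 : 1 < k) (hk2 : a < 4 * k)
    (hk3 : 2 * k ≤ a) (hc : 0 < c) (hca : c + r = a) (hcr : c ≤ r)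
    (hD : D ≤ 2 * e₁ + 2 * e₂ + 2 * (c * r))
    (h1 : e₁ ≤ c * c) (h1' : e₁ + c * p ≤ c * c + c)
    (h2 : e₂ ≤ c * c) (h2' : e₂ + c * q ≤ c * c + c)
    (hlow : 2 * c * (a + k) ≤ D)
    (hlow' : 2 * c * (2 * a - k) ≤ D + (p + q) * (a - 2 * k)) :
    c = k ∧ r = k ∧ c * c ≤ e₁ ∧ c * c ≤ e₂ := by
  obtain ⟨b, rfl⟩ : ∃ b, a = 2 * k + b := ⟨a - 2 * k, by omega⟩
  have e1 : 2 * (2 * k + b) - k = 3 * k + 2 * b := by omega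
  have e2 : 2 * k + b - 2 * k = b := by omega
  rw [e1, e2] at hlow'
  have hck : k ≤ c := by
    by_contra! hlt
    have : c * c < c * k := Nat.mul_lt_mul_of_pos_left hlt hc
    have h3 : c * (c + r) = c * (2 * k + b) := by rw [hca]
    nlinarith
  have aux : ∀ e p : ℕ, e ≤ c * c → e + c * p ≤ c * c + c → 2 * e + p * b ≤ 2 * (c * c) + b := by
    intro e p h h'
    rcases p with _ | p
    · omega
    · have : p * b ≤ p * (2 * c) := Nat.mul_le_mul_left _ (by omega)
      nlinarith
  have a1 := aux e₁ p h1 h1'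
  have a2 := aux e₂ q h2 h2'
  have h3 : c * (c + r) = c * (2 * k + b) := by rw [hca]
  have hb : b = 0 := by
    by_contra hb
    have hb : 0 < b := Nat.pos_of_ne_zero hb
    have h4 : c * (k + b) ≤ c * c + b := by nlinarith
    have h5 : c * (2 * c) ≤ c * (2 * k + b) := Nat.mul_le_mul_left _ (by omega)
    have h6 : c * b ≤ 2 * b := by nlinarith
    have h7 : c ≤ 2 := Nat.le_of_mul_le_mul_right h6 hb
    have hc2 : c = 2 := by omega
    have hk2 : k = 2 := by omega
    subst hc2 hk2
    omega
  subst hb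
  have hck' : c = k := by omega
  subst hck'
  have : r = c := by omega
  subst this
  refine ⟨rfl, rfl, ?_, ?_⟩ <;> nlinarith

end Counting

section Bipartite

open Classical

variable {V : Type*} {A : V → V → Prop} {X Y : Finset V}

/-- Every arc of `A` joins the complementary finsets `X` and `Y`. -/
structure IsBip (A : V → V → Prop) (X Y : Finset V) : Prop where
  disj : Disjoint X Y
  cover : ∀ v, v ∈ X ∨ v ∈ Y
  left : ∀ {u v}, u ∈ X → A u v → v ∈ Y
  right : ∀ {u v}, u ∈ Y → A u v → v ∈ X

lemma IsBip.symm (h : IsBip A X Y) : IsBip A Y X :=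
  ⟨h.disj.symm, fun v => (h.cover v).symm, h.right, h.left⟩

lemma IsBip.left' (h : IsBip A X Y) {u v : V} (hu : u ∈ X) (hA : A v u) : v ∈ Y :=
  (h.cover v).resolve_left fun hv => Finset.disjoint_left.1 h.disj hu (h.left hv hA)

variable {a k : ℕ}

/-- The degree condition `(B_k)` on dominating pairs. -/
def DegCond (A : V → V → Prop) (a k : ℕ) : Prop :=
  ∀ u v : V, IsDominatingPair A u v →
    (2 * a - k ≤ deg A u ∧ a + k ≤ deg A v) ∨ (a + k ≤ deg A u ∧ 2 * a - k ≤ deg A v)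

lemma DegCond.le_deg (hdeg : DegCond A a k) (hk : 2 * k ≤ a) {u v w : V} (huv : u ≠ v)
    (hu : A u w) (hv : A v w) : a + k ≤ deg A u := by
  have := hdeg u v ⟨huv, w, hu, hv⟩
  omega

lemma DegCond.eq_of_deg_lt (hdeg : DegCond A a k) (hk : 2 * k ≤ a) {u v w : V}
    (hd : deg A u < a + k) (hu : A u w) (hv : A v w) : v = u := by
  by_contra hne
  have := hdeg.le_deg hk (Ne.symm hne) hu hv
  omega

lemma conj_swap_invariant {σ : Equiv.Perm V} {C : Finset V} (hC : ∀ v ∈ C, σ v ∈ C) {y z : V}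
    (hyz : y ∈ C ↔ z ∈ C) : ∀ v ∈ C, (Equiv.swap y z * σ * (Equiv.swap y z)⁻¹) v ∈ C := by
  have hmem : ∀ {w}, w ∈ C → Equiv.swap y z w ∈ C := by
    intro w hw
    rw [Equiv.swap_apply_def]
    split_ifs with h1 h2
    · exact hyz.1 (h1 ▸ hw)
    · exact hyz.2 (h2 ▸ hw)
    · exact hw
  intro v hv
  rw [Equiv.swap_inv, Equiv.Perm.mul_apply, Equiv.Perm.mul_apply]
  exact hmem (hC _ (hmem hv))

lemma IsBip.deg_eq (h : IsBip A X Y) {x : V} (hx : x ∈ X) :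
    deg A x = #{y ∈ Y | A x y} + #{y ∈ Y | A y x} := by
  have h1 : {v | A x v} = (({y ∈ Y | A x y} : Finset V) : Set V) := by
    ext v
    simpa using fun hv => h.left hx hv
  have h2 : {v | A v x} = (({y ∈ Y | A y x} : Finset V) : Set V) := by
    ext v
    simpa using fun hv => h.left' hx hv
  rw [deg, outDeg, inDeg, h1, h2, Set.ncard_coe_finset, Set.ncard_coe_finset]

lemma map_inter_eq (h : IsBip A X Y) {σ : Equiv.Perm V} (hσ : ∀ v, A v (σ v)) {C : Finset V}
    (hC : ∀ v ∈ C, σ v ∈ C) : (X ∩ C).map σ.toEmbedding = Y ∩ C := by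
  have key : ∀ {X Y : Finset V}, IsBip A X Y → (X ∩ C).map σ.toEmbedding ⊆ Y ∩ C := by
    intro X Y h v hv
    obtain ⟨u, hu, rfl⟩ := mem_map.1 hv
    rw [mem_inter] at hu ⊢
    exact ⟨h.left hu.1 (hσ u), hC u hu.2⟩
  refine eq_of_subset_of_card_le (key h) ?_
  simpa using card_le_card (key h.symm)

variable [Fintype V]

/-- Hall's condition for the out-neighbourhoods of the vertices in one side of the bipartition. -/
lemma card_le_card_biUnion_outNeighbors (h : IsBip A X Y) (hX : #X = a) (hY : #Y = a)
    (hk0 : 1 < k) (hk : 2 * k ≤ a) (hdeg : DegCond A a k) (hout : ∀ u, ∃ v, A u v)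
    (S : Finset V) (hS : S ⊆ X) : #S ≤ #(S.biUnion fun u => {v | A u v}) := by
  induction S using Finset.strongInduction with
  | H S ih =>
    choose g hg using hout
    set N : Finset V → Finset V := fun S => S.biUnion fun u => {v | A u v} with hN
    have memN : ∀ {S v}, v ∈ N S ↔ ∃ u ∈ S, A u v := by simp [hN]
    change #S ≤ #(N S)
    by_cases hgood : ∃ s ∈ S, deg A s < a + k
    · obtain ⟨s, hs, hsd⟩ := hgood
      have h1 := ih (S.erase s) (erase_ssubset hs) ((erase_subset _ _).trans hS)
      have h2 : g s ∉ N (S.erase s) := by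
        rw [memN]
        rintro ⟨u, hu, huA⟩
        exact (mem_erase.1 hu).1 (hdeg.eq_of_deg_lt hk hsd (hg s) huA)
      have h3 : insert (g s) (N (S.erase s)) ⊆ N S := by
        intro v hv
        rcases mem_insert.1 hv with rfl | hv
        · exact memN.2 ⟨s, hs, hg s⟩
        · obtain ⟨u, hu, huA⟩ := memN.1 hv
          exact memN.2 ⟨u, mem_of_mem_erase hu, huA⟩
      have h4 := card_le_card h3
      rw [card_insert_of_notMem h2] at h4
      rw [card_erase_of_mem hs] at h1
      change _ ≤ #(N (S.erase s)) at h1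
      omega
    push Not at hgood
    by_contra! hlt
    have hSX := card_le_card hS
    have hNY : N S ⊆ Y := by
      intro v hv
      obtain ⟨u, hu, huA⟩ := memN.1 hv
      exact h.left (hS hu) huA
    have hod : ∀ u ∈ S, #{y ∈ Y | A u y} ≤ #(N S) := fun u hu =>
      card_le_card fun y hy => memN.2 ⟨u, hu, (mem_filter.1 hy).2⟩
    have hNlow : a - k ≤ #(N S) := by
      obtain ⟨u, hu, v, hv, huv, he⟩ := exists_ne_map_eq_of_card_lt_of_maps_to hlt
        (f := g) (fun u hu => memN.2 ⟨u, hu, hg u⟩)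
      have key : ∀ u ∈ S, 2 * a - k ≤ deg A u → a - k ≤ #(N S) := by
        intro u hu hd
        rw [h.deg_eq (hS hu)] at hd
        have h1 := hod u hu
        have h2 : #{y ∈ Y | A y u} ≤ #Y := card_filter_le _ _
        omega
      rcases hdeg u v ⟨huv, g u, hg u, he ▸ hg v⟩ with hd | hd
      · exact key u hu hd.1
      · exact key v hv hd.2
    have hT : ∀ y ∈ Y \ N S, deg A y < a + k := by
      intro y hy
      rw [mem_sdiff] at hy
      rw [h.symm.deg_eq hy.1]
      have h1 : #{x ∈ X | A y x} ≤ #X := card_filter_le _ _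
      have h2 : #{x ∈ X | A x y} ≤ #(X \ S) := card_le_card fun x hx => by
        simp only [mem_filter, mem_sdiff] at hx ⊢
        exact ⟨hx.1, fun hxS => hy.2 (memN.2 ⟨x, hxS, hx.2⟩)⟩
      rw [card_sdiff_of_subset hS] at h2
      omega
    obtain ⟨y, hy, hyS⟩ : ∃ y ∈ Y \ N S, g y ∈ S := by
      by_contra! hno
      have hmaps : ∀ y ∈ Y \ N S, g y ∈ X \ S := fun y hy =>
        mem_sdiff.2 ⟨h.right (mem_sdiff.1 hy).1 (hg y), hno y hy⟩
      have hinj : Set.InjOn g (Y \ N S : Finset V) := fun y hy z hz hyz =>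
        (hdeg.eq_of_deg_lt hk (hT y hy) (hg y) (hyz ▸ hg z)).symm
      have := card_le_card_of_injOn g hmaps hinj
      rw [card_sdiff_of_subset hS, card_sdiff_of_subset hNY] at this
      have := card_le_card hNY
      omega
    have hd := hgood _ hyS
    rw [h.deg_eq (hS hyS)] at hd
    have h1 := hod _ hyS
    have h2 : #{z ∈ Y | A z (g y)} ≤ 1 := card_le_one.2 fun z hz z' hz' => by
      rw [hdeg.eq_of_deg_lt hk (hT y hy) (hg y) (mem_filter.1 hz).2,
        hdeg.eq_of_deg_lt hk (hT y hy) (hg y) (mem_filter.1 hz').2]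
    omega

lemma hasCycleFactor_of_degCond (h : IsBip A X Y) (hX : #X = a) (hY : #Y = a)
    (hk0 : 1 < k) (hk : 2 * k ≤ a) (hdeg : DegCond A a k) (hout : ∀ u, ∃ v, A u v) :
    HasCycleFactor A := by
  have hall : ∀ S : Finset V, #S ≤ #(S.biUnion fun u => ({v | A u v} : Finset V)) := by
    intro S
    have h1 := card_le_card_biUnion_outNeighbors h hX hY hk0 hk hdeg hout (S ∩ X)
      inter_subset_right
    have h2 := card_le_card_biUnion_outNeighbors h.symm hY hX hk0 hk hdeg hout (S ∩ Y)
      inter_subset_right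
    have hS : S = S ∩ X ∪ S ∩ Y := by
      ext v
      have := h.cover v
      simp only [mem_union, mem_inter]
      tauto
    have hd : Disjoint ((S ∩ X).biUnion fun u => ({v | A u v} : Finset V))
        ((S ∩ Y).biUnion fun u => ({v | A u v} : Finset V)) := by
      rw [Finset.disjoint_left]
      intro v hv hv'
      simp only [mem_biUnion, mem_inter, mem_filter, mem_univ, true_and] at hv hv'
      obtain ⟨u, hu, huA⟩ := hv
      obtain ⟨w, hw, hwA⟩ := hv'
      exact Finset.disjoint_left.1 h.disj (h.right hw.2 hwA) (h.left hu.2 huA)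
    calc #S = #(S ∩ X ∪ S ∩ Y) := by rw [← hS]
      _ ≤ #(S ∩ X) + #(S ∩ Y) := card_union_le _ _
      _ ≤ _ := Nat.add_le_add h1 h2
      _ = _ := by rw [← card_union_of_disjoint hd, ← union_biUnion, ← hS]
  obtain ⟨f, hf, hfA⟩ := (all_card_le_biUnion_card_iff_exists_injective _).1 hall
  refine ⟨Equiv.ofBijective f (Finite.injective_iff_bijective.1 hf), fun v => ?_⟩
  simpa using hfA v

/-- Either the digraph is a directed cycle, or all of its degrees are large. -/
lemma sameCycle_or_le_deg (h : IsBip A X Y) (hX : #X = a) (hY : #Y = a)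
    (hk0 : 1 < k) (hk : 2 * k ≤ a) (hdeg : DegCond A a k) (hsc : StronglyConnected A)
    {σ : Equiv.Perm V} (hσ : ∀ v, A v (σ v)) :
    (∀ u v, σ.SameCycle u v) ∨ ∀ v, a + k ≤ deg A v := by
  by_contra! hcon
  obtain ⟨⟨u, v, huv⟩, s, hs⟩ := hcon
  have hstep : ∀ {u w}, deg A u < a + k → A u w → deg A w < a + k := by
    intro u w hu huw
    have key : ∀ {X Y : Finset V}, IsBip A X Y → #Y = a → w ∈ X → deg A w < a + k := by
      intro X Y h hY hw
      rw [h.deg_eq hw]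
      have h1 : #{y ∈ Y | A w y} ≤ #Y := card_filter_le _ _
      have h2 : #{z ∈ Y | A z w} ≤ 1 := card_le_one.2 fun z hz z' hz' => by
        rw [hdeg.eq_of_deg_lt hk hu huw (mem_filter.1 hz).2,
          hdeg.eq_of_deg_lt hk hu huw (mem_filter.1 hz').2]
      omega
    rcases h.cover w with hw | hw
    · exact key h hY hw
    · exact key h.symm hX hw
  have hall : ∀ w, deg A w < a + k := by
    intro w
    induction hsc s w with
    | refl => exact hs
    | tail _ hA ih => exact hstep ih hA
  refine huv ?_
  clear huv
  induction hsc u v with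
  | refl => exact Equiv.Perm.SameCycle.refl _ _
  | @tail x y _ hA ih =>
    have : σ.symm y = x :=
      hdeg.eq_of_deg_lt hk (hall x) hA (by simpa using hσ (σ.symm y))
    refine ih.trans ⟨1, ?_⟩
    rw [← this]
    simp

/-- A cycle factor with the largest number of pairs of vertices on a common cycle. -/
def IsMaxFactor (A : V → V → Prop) (σ : Equiv.Perm V) : Prop :=
  (∀ v, A v (σ v)) ∧
    ∀ τ : Equiv.Perm V, (∀ v, A v (τ v)) → sameCyclePairs τ ≤ sameCyclePairs σ

lemma HasCycleFactor.exists_isMaxFactor (h : HasCycleFactor A) : ∃ σ, IsMaxFactor A σ := by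
  obtain ⟨σ, hσ, hmax⟩ := exists_max_image ({σ : Equiv.Perm V | ∀ v, A v (σ v)} : Finset _)
    sameCyclePairs (by obtain ⟨σ, hσ⟩ := h; exact ⟨σ, by simpa using hσ⟩)
  exact ⟨σ, by simpa using hσ, fun τ hτ => hmax τ (by simpa using hτ)⟩

lemma IsMaxFactor.not_adj {σ : Equiv.Perm V} (hσ : IsMaxFactor A σ) {u v : V}
    (huv : ¬ σ.SameCycle u v) (h1 : A u (σ v)) : ¬ A v (σ u) := by
  intro h2
  refine (hσ.2 (σ * Equiv.swap u v) fun x => ?_).not_gt (sameCyclePairs_lt_mul_swap huv)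
  rw [Equiv.Perm.mul_apply]
  by_cases hu : x = u
  · subst hu
    simpa using h1
  by_cases hv : x = v
  · subst hv
    simpa using h2
  rw [Equiv.swap_apply_of_ne_of_ne hu hv]
  exact hσ.1 x

lemma not_sameCycle_of_invariant {σ : Equiv.Perm V} {C : Finset V} (hC : ∀ v ∈ C, σ v ∈ C)
    {u v : V} (hu : u ∈ C) (hv : v ∉ C) : ¬ σ.SameCycle u v := by
  intro huv
  obtain ⟨n, -, -, rfl⟩ := huv.exists_pow_eq'
  refine hv ?_
  clear huv hv
  induction n with
  | zero => simpa using hu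
  | succ n ih =>
    rw [pow_succ', Equiv.Perm.mul_apply]
    exact hC _ ih

lemma invariant_compl {σ : Equiv.Perm V} {C : Finset V} (hC : ∀ v ∈ C, σ v ∈ C) :
    ∀ v ∈ Cᶜ, σ v ∈ Cᶜ := by
  intro v hv
  rw [mem_compl] at hv ⊢
  exact fun h => not_sameCycle_of_invariant hC h hv (Equiv.Perm.SameCycle.symm ⟨1, by simp⟩)

lemma IsBip.sum_deg (h : IsBip A X Y) (C : Finset V) :
    ∑ u ∈ X ∩ C, deg A u = arcsFrom A (X ∩ C) (Y ∩ C) + arcsFrom A (X ∩ C) (Y ∩ Cᶜ) +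
      (arcsFrom A (Y ∩ C) (X ∩ C) + arcsFrom A (Y ∩ Cᶜ) (X ∩ C)) := by
  rw [arcsFrom_eq_sum_inNeighbors (Y ∩ C), arcsFrom_eq_sum_inNeighbors (Y ∩ Cᶜ)]
  simp only [arcsFrom, ← sum_add_distrib]
  refine sum_congr rfl fun u hu => ?_
  have hsplit : ∀ p : V → Prop, #{y ∈ Y | p y} = #{y ∈ Y ∩ C | p y} + #{y ∈ Y ∩ Cᶜ | p y} := by
    intro p
    rw [← card_union_of_disjoint, ← filter_union, ← inter_union_distrib_left]
    · simp
    · refine disjoint_filter_filter ?_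
      exact disjoint_compl_right.mono inter_subset_right inter_subset_right
  rw [h.deg_eq (mem_inter.1 hu).1, hsplit, hsplit]

/-- An invariant set of a maximal cycle factor that contains at most half of the vertices
induces a complete bipartite digraph on exactly half of the vertices. -/
lemma IsMaxFactor.extremal (h : IsBip A X Y) (hX : #X = a)
    (hk1 : 1 < k) (hk2 : a < 4 * k) (hk : 2 * k ≤ a) (hdeg : DegCond A a k)
    (hlow : ∀ v, a + k ≤ deg A v) {σ : Equiv.Perm V} (hσ : IsMaxFactor A σ) {C : Finset V}
    (hC : ∀ v ∈ C, σ v ∈ C) (hne : (X ∩ C).Nonempty) (hle : #(X ∩ C) ≤ #(X ∩ Cᶜ)) :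
    #(X ∩ C) = k ∧ #(X ∩ Cᶜ) = k ∧ (∀ u ∈ X ∩ C, ∀ v ∈ Y ∩ C, A u v) ∧
      ∀ u ∈ Y ∩ C, ∀ v ∈ X ∩ C, A u v := by
  have hC' := invariant_compl hC
  have m1 := map_inter_eq h hσ.1 hC
  have m2 := map_inter_eq h.symm hσ.1 hC
  have m3 := map_inter_eq h hσ.1 hC'
  have m4 := map_inter_eq h.symm hσ.1 hC'
  have cY : #(Y ∩ C) = #(X ∩ C) := by rw [← m1, card_map]
  have cY' : #(Y ∩ Cᶜ) = #(X ∩ Cᶜ) := by rw [← m3, card_map]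
  have hsum : #(X ∩ C) + #(X ∩ Cᶜ) = a := by
    rw [← card_union_of_disjoint, ← inter_union_distrib_left]
    · simpa using hX
    · exact disjoint_compl_right.mono inter_subset_right inter_subset_right
  have hcross : ∀ Z : Finset V, ∀ u ∈ Z ∩ C, ∀ v ∈ Z ∩ Cᶜ, A u (σ v) → ¬ A v (σ u) :=
    fun Z u hu v hv => hσ.not_adj (not_sameCycle_of_invariant hC (mem_inter.1 hu).2
      (mem_compl.1 (mem_inter.1 hv).2))
  have x1 := arcsFrom_add_arcsFrom_le σ _ _ (hcross X)
  have x2 := arcsFrom_add_arcsFrom_le σ _ _ (hcross Y)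
  rw [m1, m3] at x1
  rw [m2, m4, cY, cY'] at x2
  have s1 := h.sum_deg C
  have s2 := h.symm.sum_deg C
  have hdisj : ∀ S : Finset V, ∀ u ∈ S, ∀ v ∈ S, deg A u < 2 * a - k → deg A v < 2 * a - k →
      u ≠ v → ∀ w, A u w → ¬ A v w := by
    intro S u _ v _ hu hv huv w hw hw'
    have := hdeg u v ⟨huv, w, hw, hw'⟩
    omega
  have p1 := arcsFrom_add_le (X ∩ C) (Y ∩ C) _ (hdisj _)
  have p2 := arcsFrom_add_le (Y ∩ C) (X ∩ C) _ (hdisj _)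
  have q1 := arcsFrom_le (A := A) (X ∩ C) (Y ∩ C)
  have q2 := arcsFrom_le (A := A) (Y ∩ C) (X ∩ C)
  have hlm : a + k ≤ 2 * a - k := by omega
  have l1 := le_sum_add_card_filter_mul (X ∩ C) (deg A) hlm fun u _ => hlow u
  have l2 := le_sum_add_card_filter_mul (Y ∩ C) (deg A) hlm fun u _ => hlow u
  have n1 := card_nsmul_le_sum (X ∩ C) (deg A) _ fun u _ => hlow u
  have n2 := card_nsmul_le_sum (Y ∩ C) (deg A) _ fun u _ => hlow u
  have hsub : 2 * a - k - (a + k) = a - 2 * k := by omega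
  rw [smul_eq_mul] at n1 n2
  rw [hsub] at l1 l2
  rw [cY] at p1 p2 q1 q2 l2 n2
  obtain ⟨r1, r2, r3, r4⟩ := extremal_of_counts hk1 hk2 hk hne.card_pos hsum hle
    (D := ∑ u ∈ X ∩ C, deg A u + ∑ u ∈ Y ∩ C, deg A u) (by rw [s1, s2]; linarith)
    q1 p1 q2 p2 (by linarith) (by linarith)
  exact ⟨r1, r2, fun u hu v hv => adj_of_arcsFrom_eq (by rwa [cY]) hu hv,
    fun u hu v hv => adj_of_arcsFrom_eq (by rwa [cY]) hu hv⟩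

/-- A maximal cycle factor stays maximal when two vertices on one side of a complete bipartite
invariant set are exchanged. -/
lemma IsMaxFactor.conj_swap {σ : Equiv.Perm V} (hσ : IsMaxFactor A σ) (h : IsBip A X Y)
    {C : Finset V} (hC : ∀ v ∈ C, σ v ∈ C) (h1 : ∀ u ∈ X ∩ C, ∀ v ∈ Y ∩ C, A u v)
    (h2 : ∀ u ∈ Y ∩ C, ∀ v ∈ X ∩ C, A u v) {y z : V} (hy : y ∈ Y ∩ C) (hz : z ∈ Y ∩ C) :
    IsMaxFactor A (Equiv.swap y z * σ * (Equiv.swap y z)⁻¹) := by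
  refine ⟨fun v => ?_, fun τ hτ => (sameCyclePairs_conj σ _).symm ▸ hσ.2 τ hτ⟩
  rw [Equiv.swap_inv, Equiv.Perm.mul_apply, Equiv.Perm.mul_apply]
  have hmem : ∀ {w}, w ∈ Y ∩ C → Equiv.swap y z w ∈ Y ∩ C := by
    intro w hw
    rw [Equiv.swap_apply_def]
    split_ifs <;> assumption
  have hfix : ∀ {w}, w ∉ Y ∩ C → Equiv.swap y z w = w := fun hw =>
    Equiv.swap_apply_of_ne_of_ne (fun e => hw (e ▸ hy)) (fun e => hw (e ▸ hz))
  by_cases hv : v ∈ Y ∩ C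
  · have hw := hmem hv
    rw [mem_inter] at hw
    have hX : σ (Equiv.swap y z v) ∈ X := h.right hw.1 (hσ.1 _)
    rw [hfix fun hY => Finset.disjoint_left.1 h.disj hX (mem_inter.1 hY).1]
    exact h2 _ hv _ (mem_inter.2 ⟨hX, hC _ hw.2⟩)
  · rw [hfix hv]
    by_cases hσv : σ v ∈ Y ∩ C
    · refine h1 _ (mem_inter.2 ⟨h.symm.left' (mem_inter.1 hσv).1 (hσ.1 v), ?_⟩) _ (hmem hσv)
      by_contra hvC
      exact (mem_compl.1 (invariant_compl hC v (mem_compl.2 hvC))) (mem_inter.1 hσv).2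
    · rw [hfix hσv]
      exact hσ.1 v

/-- When `C` and `Cᶜ` both induce complete bipartite digraphs, arcs from `X ∩ C` to `Y ∩ Cᶜ` and
arcs from `X ∩ Cᶜ` to `Y ∩ C` exclude each other. -/
lemma IsMaxFactor.not_adj_of_complete {σ : Equiv.Perm V} (hσ : IsMaxFactor A σ)
    (h : IsBip A X Y) {C : Finset V} (hC : ∀ v ∈ C, σ v ∈ C)
    (h1 : ∀ u ∈ X ∩ C, ∀ v ∈ Y ∩ C, A u v) (h2 : ∀ u ∈ Y ∩ C, ∀ v ∈ X ∩ C, A u v)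
    (h3 : ∀ u ∈ X ∩ Cᶜ, ∀ v ∈ Y ∩ Cᶜ, A u v) (h4 : ∀ u ∈ Y ∩ Cᶜ, ∀ v ∈ X ∩ Cᶜ, A u v)
    {u v w z : V} (hu : u ∈ X ∩ C) (hw : w ∈ Y ∩ Cᶜ) (hv : v ∈ X ∩ Cᶜ) (hz : z ∈ Y ∩ C)
    (huw : A u w) : ¬ A v z := by
  have hσu : σ u ∈ Y ∩ C :=
    mem_inter.2 ⟨h.left (mem_inter.1 hu).1 (hσ.1 u), hC u (mem_inter.1 hu).2⟩
  have hσv : σ v ∈ Y ∩ Cᶜ :=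
    mem_inter.2 ⟨h.left (mem_inter.1 hv).1 (hσ.1 v), invariant_compl hC v (mem_inter.1 hv).2⟩
  have hne : ∀ {x y}, x ∈ X → y ∈ Y → x ≠ y := fun hx hy e =>
    Finset.disjoint_left.1 h.disj hx (e ▸ hy)
  have hneC : ∀ {x y}, x ∈ C → y ∈ Cᶜ → x ≠ y := fun hx hy e => mem_compl.1 hy (e ▸ hx)
  simp only [mem_inter] at hu hv hw hz hσu hσv
  set σ₁ := Equiv.swap (σ u) z * σ * (Equiv.swap (σ u) z)⁻¹ with hσ₁
  have m₁ : IsMaxFactor A σ₁ := hσ.conj_swap h hC h1 h2 (mem_inter.2 hσu) (mem_inter.2 hz)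
  have i₁ : ∀ v ∈ C, σ₁ v ∈ C := conj_swap_invariant hC (by simp [hσu.2, hz.2])
  have e₁u : σ₁ u = z := by
    rw [hσ₁, Equiv.swap_inv, Equiv.Perm.mul_apply, Equiv.Perm.mul_apply,
      Equiv.swap_apply_of_ne_of_ne (hne hu.1 hσu.1) (hne hu.1 hz.1), Equiv.swap_apply_left]
  have e₁v : σ₁ v = σ v := by
    rw [hσ₁, Equiv.swap_inv, Equiv.Perm.mul_apply, Equiv.Perm.mul_apply,
      Equiv.swap_apply_of_ne_of_ne (hne hv.1 hσu.1) (hne hv.1 hz.1),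
      Equiv.swap_apply_of_ne_of_ne (hneC hσu.2 hσv.2).symm (hneC hz.2 hσv.2).symm]
  set σ₂ := Equiv.swap (σ v) w * σ₁ * (Equiv.swap (σ v) w)⁻¹ with hσ₂
  have m₂ : IsMaxFactor A σ₂ :=
    m₁.conj_swap h (invariant_compl i₁) h3 h4 (mem_inter.2 hσv) (mem_inter.2 hw)
  have i₂ : ∀ v ∈ C, σ₂ v ∈ C :=
    conj_swap_invariant i₁ (by simp [mem_compl.1 hσv.2, mem_compl.1 hw.2])
  have e₂u : σ₂ u = z := by
    rw [hσ₂, Equiv.swap_inv, Equiv.Perm.mul_apply, Equiv.Perm.mul_apply,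
      Equiv.swap_apply_of_ne_of_ne (hne hu.1 hσv.1) (hne hu.1 hw.1), e₁u,
      Equiv.swap_apply_of_ne_of_ne (hneC hz.2 hσv.2) (hneC hz.2 hw.2)]
  have e₂v : σ₂ v = w := by
    rw [hσ₂, Equiv.swap_inv, Equiv.Perm.mul_apply, Equiv.Perm.mul_apply,
      Equiv.swap_apply_of_ne_of_ne (hne hv.1 hσv.1) (hne hv.1 hw.1), e₁v,
      Equiv.swap_apply_left]
  have := m₂.not_adj (not_sameCycle_of_invariant i₂ hu.2 (mem_compl.1 hv.2))
  rw [e₂u, e₂v] at this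
  exact this huw

lemma exists_arc_leaving (hsc : StronglyConnected A) {C : Finset V} {u v : V} (hu : u ∈ C)
    (hv : v ∉ C) : ∃ x ∈ C, ∃ y ∈ Cᶜ, A x y := by
  by_contra! hno
  refine hv ?_
  clear hv
  induction hsc u v with
  | refl => exact hu
  | tail _ hA ih =>
    by_contra hy
    exact hno _ ih _ (mem_compl.2 hy) hA

lemma deg_le_of_no_cross_arcs (h : IsBip A X Y) {C : Finset V} {x : V} (hx : x ∈ X ∩ C)
    (h1 : ∀ u ∈ X ∩ C, ∀ v ∈ Y ∩ Cᶜ, ¬ A u v) (h2 : ∀ u ∈ Y ∩ Cᶜ, ∀ v ∈ X ∩ C, ¬ A u v) :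
    deg A x ≤ 2 * #(Y ∩ C) := by
  rw [h.deg_eq (mem_inter.1 hx).1]
  have key : ∀ p : V → Prop, (∀ y ∈ Y ∩ Cᶜ, ¬ p y) → #{y ∈ Y | p y} ≤ #(Y ∩ C) := by
    intro p hp
    refine card_le_card fun y hy => ?_
    rw [mem_filter] at hy
    refine mem_inter.2 ⟨hy.1, ?_⟩
    by_contra hyC
    exact hp y (mem_inter.2 ⟨hy.1, mem_compl.2 hyC⟩) hy.2
  have k1 := key (A x) (h1 x hx)
  have k2 := key (A · x) fun y hy => h2 y hy x hx
  omega

/-- A maximal cycle factor is a single cycle. -/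
lemma IsMaxFactor.sameCycle (h : IsBip A X Y) (hX : #X = a) (hY : #Y = a)
    (hk1 : 1 < k) (hk2 : a < 4 * k) (hk : 2 * k ≤ a) (hdeg : DegCond A a k)
    (hsc : StronglyConnected A) {σ : Equiv.Perm V} (hσ : IsMaxFactor A σ) (u v : V) :
    σ.SameCycle u v := by
  rcases sameCycle_or_le_deg h hX hY hk1 hk hdeg hsc hσ.1 with hall | hlow
  · exact hall u v
  by_contra huv
  obtain ⟨C, hC, ⟨s, hs⟩, ⟨t, ht⟩, hle⟩ : ∃ C : Finset V, (∀ v ∈ C, σ v ∈ C) ∧ C.Nonempty ∧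
      Cᶜ.Nonempty ∧ #(X ∩ C) ≤ #(X ∩ Cᶜ) := by
    set C : Finset V := {w | σ.SameCycle u w} with hCdef
    have hC : ∀ v ∈ C, σ v ∈ C := by simp [hCdef]
    have hu : u ∈ C := by simp [hCdef, Equiv.Perm.SameCycle.refl]
    have hv : v ∈ Cᶜ := by simpa [hCdef] using huv
    rcases le_total #(X ∩ C) #(X ∩ Cᶜ) with hle | hle
    · exact ⟨C, hC, ⟨u, hu⟩, ⟨v, hv⟩, hle⟩
    · exact ⟨Cᶜ, invariant_compl hC, ⟨v, hv⟩, ⟨u, by simpa using hu⟩, by simpa using hle⟩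
  have hC' := invariant_compl hC
  have meets : ∀ {C : Finset V}, (∀ v ∈ C, σ v ∈ C) → ∀ {s}, s ∈ C → (X ∩ C).Nonempty := by
    intro C hC s hs
    rcases h.cover s with hsX | hsY
    · exact ⟨s, mem_inter.2 ⟨hsX, hs⟩⟩
    · exact ⟨σ s, mem_inter.2 ⟨h.right hsY (hσ.1 s), hC s hs⟩⟩
  obtain ⟨c1, c2, h1, h2⟩ := hσ.extremal h hX hk1 hk2 hk hdeg hlow hC (meets hC hs) hle
  obtain ⟨-, -, h3, h4⟩ := hσ.extremal h hX hk1 hk2 hk hdeg hlow hC' (meets hC' ht)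
    (by rw [compl_compl, c1, c2])
  have cY : #(Y ∩ C) = k := by rw [← map_inter_eq h hσ.1 hC, card_map, c1]
  obtain ⟨x, hx⟩ := meets hC hs
  have hy : σ x ∈ Y ∩ C :=
    mem_inter.2 ⟨h.left (mem_inter.1 hx).1 (hσ.1 x), hC x (mem_inter.1 hx).2⟩
  have exclX : (∀ u ∈ X ∩ C, ∀ w ∈ Y ∩ Cᶜ, ¬ A u w) ∨ ∀ v ∈ X ∩ Cᶜ, ∀ z ∈ Y ∩ C, ¬ A v z := by
    by_contra! hcon
    obtain ⟨⟨u, hu, w, hw, huw⟩, v, hv, z, hz, hvz⟩ := hcon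
    exact hσ.not_adj_of_complete h hC h1 h2 h3 h4 hu hw hv hz huw hvz
  have exclY : (∀ u ∈ Y ∩ C, ∀ w ∈ X ∩ Cᶜ, ¬ A u w) ∨ ∀ v ∈ Y ∩ Cᶜ, ∀ z ∈ X ∩ C, ¬ A v z := by
    by_contra! hcon
    obtain ⟨⟨u, hu, w, hw, huw⟩, v, hv, z, hz, hvz⟩ := hcon
    exact hσ.not_adj_of_complete h.symm hC h2 h1 h4 h3 hu hw hv hz huw hvz
  have leave : ∀ {C : Finset V} {s t}, s ∈ C → t ∉ C →
      (∀ u ∈ X ∩ C, ∀ w ∈ Y ∩ Cᶜ, ¬ A u w) → ¬ ∀ u ∈ Y ∩ C, ∀ w ∈ X ∩ Cᶜ, ¬ A u w := by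
    intro C s t hs ht n1 n2
    obtain ⟨p, hp, q, hq, hpq⟩ := exists_arc_leaving hsc hs ht
    rcases h.cover p with hpX | hpY
    · exact n1 p (mem_inter.2 ⟨hpX, hp⟩) q (mem_inter.2 ⟨h.left hpX hpq, hq⟩) hpq
    · exact n2 p (mem_inter.2 ⟨hpY, hp⟩) q (mem_inter.2 ⟨h.right hpY hpq, hq⟩) hpq
  rcases exclX with n1 | n1 <;> rcases exclY with n2 | n2
  · exact leave hs (mem_compl.1 ht) n1 n2
  · have := deg_le_of_no_cross_arcs h hx n1 n2
    have := hlow x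
    omega
  · have := deg_le_of_no_cross_arcs h.symm hy n2 n1
    have := hlow (σ x)
    omega
  · exact leave ht (by simpa using hs) (by simpa using n1) (by simpa using n2)

end Bipartite

/-- Wang–Wu: condition (B_k) on dominating pairs implies hamiltonicity. -/
theorem stmt_10 {V : Type*} [Fintype V] (A : V → V → Prop) (a k : ℕ) (X Y : Set V)
    (ha : 3 ≤ a) (hk1 : 1 < k) (hk2 : a < 4 * k) (hk3 : 2 * k ≤ a)
    (hcard : Fintype.card V = 2 * a)
    (hbip : IsBipartition A X Y) (hX : X.ncard = a) (hY : Y.ncard = a)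
    (hsc : StronglyConnected A)
    (hdeg : ∀ u v : V, IsDominatingPair A u v →
      (2 * a - k ≤ deg A u ∧ a + k ≤ deg A v) ∨
      (a + k ≤ deg A u ∧ 2 * a - k ≤ deg A v)) :
    IsHamiltonian A := by
  classical
  obtain ⟨hdisj, hcov, harc⟩ := hbip
  have hno : ∀ v, v ∈ X → v ∉ Y := fun v hv => Set.disjoint_left.1 hdisj hv
  have h : IsBip A X.toFinset Y.toFinset :=
    { disj := by simpa using hdisj
      cover := fun v => by simpa using (hcov ▸ Set.mem_univ v : v ∈ X ∪ Y)
      left := fun {u v} hu hA => by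
        have := harc u v hA
        have := hno u
        simp only [Set.mem_toFinset] at hu ⊢
        tauto
      right := fun {u v} hu hA => by
        have := harc u v hA
        have := hno u
        simp only [Set.mem_toFinset] at hu ⊢
        tauto }
  have hX' : #X.toFinset = a := by rw [← hX, Set.ncard_eq_toFinset_card']
  have hY' : #Y.toFinset = a := by rw [← hY, Set.ncard_eq_toFinset_card']
  have : Nontrivial V := Fintype.one_lt_card_iff_nontrivial.1 (by omega)
  have hout : ∀ u, ∃ v, A u v := by
    intro u
    obtain ⟨w, hw⟩ := exists_ne u
    rcases (hsc u w).cases_head with rfl | ⟨v, hv, -⟩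
    · exact absurd rfl hw
    · exact ⟨v, hv⟩
  obtain ⟨σ, hσ⟩ := (hasCycleFactor_of_degCond h hX' hY' hk1 hk3 hdeg hout).exists_isMaxFactor
  exact isHamiltonian_of_sameCycle hσ.1 (hσ.sameCycle h hX' hY' hk1 hk2 hk3 hdeg hsc)
end
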